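/- Let n ≥ 1, let 0 < p < ∞, and let g be a holomorphic function on B_n; set dμ_g(z) = |Rg(z)|²(1−|z|²) dv(z). Then J_g is compact from H^p to H^p (meaning ‖J_g f_k‖_{H^p} → 0 for every sequence (f_k) in H^p with sup_k ‖f_k‖_{H^p} < ∞ converging to 0 uniformly on compact subsets of B_n) if and only if μ_g is a vanishing Carleson measure, i.e. lim_{δ→0⁺} sup_{ζ∈S_n} δ^{−n} μ_g(B_δ(ζ)) = 0 (equivalently, g ∈ VMOA). -/

import Mathlib

open MeasureTheory Metric Set Filter
open scoped ENNReal NNReal Topology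

noncomputable section

/-- ℂⁿ with its Euclidean (Hermitian) structure. -/
abbrev En (n : ℕ) := EuclideanSpace ℂ (Fin n)

instance (n : ℕ) : MeasurableSpace (En n) := borel _
instance (n : ℕ) : BorelSpace (En n) := ⟨rfl⟩

/-- The open unit ball `B_n` of ℂⁿ. -/
def Bn (n : ℕ) : Set (En n) := Metric.ball 0 1

/-- The unit sphere `S_n = ∂B_n`. -/
def Sn (n : ℕ) : Set (En n) := Metric.sphere 0 1

/-- The Hermitian inner product `⟨z,w⟩ = ∑ z_k * conj (w_k)`. -/
def herm {n : ℕ} (z w : En n) : ℂ := ∑ k, z k * (starRingEnd ℂ) (w k)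

/-- The surface measure on the unit sphere, normalized so that `σ(S_n) = 1`
(the `(2n-1)`-dimensional Hausdorff measure restricted to the sphere, normalized). -/
def sigmaS (n : ℕ) : Measure (En n) :=
  ((μH[(2 * n - 1 : ℝ)] (Sn n))⁻¹) • (μH[(2 * n - 1 : ℝ)]).restrict (Sn n)

/-- Lebesgue measure on the unit ball, normalized so that `v(B_n) = 1`. -/
def volN (n : ℕ) : Measure (En n) :=
  ((volume (Bn n))⁻¹) • volume.restrict (Bn n)

/-- The radial derivative `Rg(z) = ∑ z_k ∂g/∂z_k (z) = (Dg)(z)[z]`. -/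
def radD {n : ℕ} (g : En n → ℂ) (z : En n) : ℂ := fderiv ℂ g z z

/-- The Volterra-type integration operator `J_g f(z) = ∫₀¹ f(tz) Rg(tz) dt/t`. -/
def J {n : ℕ} (g f : En n → ℂ) (z : En n) : ℂ :=
  ∫ t in Set.Ioo (0 : ℝ) 1, f (t • z) * radD g (t • z) / (t : ℂ)

/-- The Hardy space quasinorm `‖f‖_{H^p}`, with values in `ℝ≥0∞`:
`‖f‖_{H^p}^p = sup_{0<r<1} ∫_{S_n} |f(rζ)|^p dσ(ζ)`. -/
def hNorm (n : ℕ) (p : ℝ) (f : En n → ℂ) : ℝ≥0∞ :=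
  (⨆ r ∈ Set.Ioo (0 : ℝ) 1,
    ∫⁻ ζ, (‖f (r • ζ)‖₊ : ℝ≥0∞) ^ p ∂(sigmaS n)) ^ (1 / p)

/-- Membership in the Hardy space `H^p(B_n)`. -/
def MemHp (n : ℕ) (p : ℝ) (f : En n → ℂ) : Prop :=
  DifferentiableOn ℂ f (Bn n) ∧ hNorm n p f < ⊤

/-- The Carleson box `B_δ(ζ) = {z ∈ B_n : |1 - ⟨z,ζ⟩| < δ}`. -/
def cBox {n : ℕ} (ζ : En n) (δ : ℝ) : Set (En n) :=
  {z ∈ Bn n | ‖(1 : ℂ) - herm z ζ‖ < δ}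

/-- The measure `dμ_g(z) = |Rg(z)|²(1-|z|²) dv(z)`. -/
def muJ (n : ℕ) (g : En n → ℂ) : Measure (En n) :=
  (volN n).withDensity
    (fun z => (‖radD g z‖₊ : ℝ≥0∞) ^ 2 * ENNReal.ofReal (1 - ‖z‖ ^ 2))

/-- The admissible approach region `Γ_α(ζ) = {z ∈ B_n : |1-⟨z,ζ⟩| < (α/2)(1-|z|²)}`. -/
def Gam {n : ℕ} (α : ℝ) (ζ : En n) : Set (En n) :=
  {z ∈ Bn n | ‖(1 : ℂ) - herm z ζ‖ < α / 2 * (1 - ‖z‖ ^ 2)}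

open Classical in
/-- The involutive automorphism `φ_a` of the unit ball interchanging `0` and `a`:
`φ_a(z) = (a - P_a z - √(1-|a|²) (z - P_a z)) / (1 - ⟨z,a⟩)`, where `P_a` is the
orthogonal projection onto `ℂa`. -/
def mob {n : ℕ} (a z : En n) : En n :=
  if a = 0 then -z
  else ((1 : ℂ) - herm z a)⁻¹ •
    ((a - (herm z a / herm a a) • a) -
      ((Real.sqrt (1 - ‖a‖ ^ 2) : ℂ)) • (z - (herm z a / herm a a) • a))

/-- The norm of the invariant (real) gradient `∇̃f(z) = ∇(f ∘ φ_z)(0)`. -/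
def invGrad {n : ℕ} {F : Type*} [NormedAddCommGroup F] [NormedSpace ℝ F]
    (f : En n → F) (z : En n) : ℝ :=
  ‖fderiv ℝ (fun w => f (mob z w)) 0‖

/-- The invariant measure `dλ_n(z) = (1-|z|²)^{-(n+1)} dv(z)`. -/
def lamN (n : ℕ) : Measure (En n) :=
  (volN n).withDensity (fun z => ENNReal.ofReal ((1 - ‖z‖ ^ 2) ^ (-(n + 1 : ℝ))))

/-- The invariant Poisson integral `u_φ(z) = ∫_{S_n} φ(ζ) (1-|z|²)ⁿ/|1-⟨z,ζ⟩|^{2n} dσ(ζ)`. -/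
def poisson (n : ℕ) (φ : En n → ℝ) (z : En n) : ℝ :=
  ∫ ζ, φ ζ * ((1 - ‖z‖ ^ 2) ^ n / ‖(1 : ℂ) - herm z ζ‖ ^ (2 * n)) ∂(sigmaS n)

/-- The function `μ̃(ζ) = ∫_{Γ_α(ζ)} (1-|z|²)^{-n} dμ(z)`. -/
def tildeMu (n : ℕ) (α : ℝ) (μ : Measure (En n)) (ζ : En n) : ℝ≥0∞ :=
  ∫⁻ z in Gam α ζ, ENNReal.ofReal ((1 - ‖z‖ ^ 2) ^ (-(n : ℝ))) ∂μ

/-- The `L^{p/(p-s)}(S_n)`-norm of `μ̃`. -/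
def tildeMuNorm (n : ℕ) (α p s : ℝ) (μ : Measure (En n)) : ℝ≥0∞ :=
  (∫⁻ ζ, tildeMu n α μ ζ ^ (p / (p - s)) ∂(sigmaS n)) ^ ((p - s) / p)

/-! ### The surface measure of the sphere -/

section Sphere

variable {E : Type*} [NormedAddCommGroup E] [InnerProductSpace ℝ E]

lemma finrank_orthogonal_singleton [FiniteDimensional ℝ E] {d : ℕ}
    (hd : Module.finrank ℝ E = d + 1) {v : E} (hv : ‖v‖ = 1) :
    Module.finrank ℝ (ℝ ∙ v)ᗮ = d := by
  have : Fact (Module.finrank ℝ E = d + 1) := ⟨hd⟩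
  exact Submodule.finrank_orthogonal_span_singleton (by rintro rfl; simp at hv)

lemma norm_normalize_sub_normalize_le {y z : E} (hy : 1 ≤ ‖y‖) (hz : 1 ≤ ‖z‖) :
    ‖‖y‖⁻¹ • y - ‖z‖⁻¹ • z‖ ≤ 2 * ‖y - z‖ := by
  have h1 : ‖y‖⁻¹ • y - ‖z‖⁻¹ • z = ‖y‖⁻¹ • (y - z) + (‖y‖⁻¹ - ‖z‖⁻¹) • z := by
    module
  have hy0 : 0 < ‖y‖ := by linarith
  have hz0 : 0 < ‖z‖ := by linarith
  rw [h1]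
  refine (norm_add_le _ _).trans ?_
  rw [norm_smul, norm_smul]
  have h2 : ‖‖y‖⁻¹‖ ≤ 1 := by
    rw [Real.norm_of_nonneg (by positivity)]; exact inv_le_one_of_one_le₀ hy
  have h3 : ‖‖y‖⁻¹ - ‖z‖⁻¹‖ * ‖z‖ ≤ ‖y - z‖ := by
    have : (‖y‖⁻¹ - ‖z‖⁻¹) = (‖z‖ - ‖y‖) * (‖y‖⁻¹ * ‖z‖⁻¹) := by field_simp
    rw [this, norm_mul, Real.norm_of_nonneg (by positivity : 0 ≤ ‖y‖⁻¹ * ‖z‖⁻¹), mul_assoc, mul_assoc,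
      inv_mul_cancel₀ hz0.ne', mul_one]
    have h4 : ‖‖z‖ - ‖y‖‖ ≤ ‖y - z‖ := by
      rw [Real.norm_eq_abs, norm_sub_rev]; exact abs_norm_sub_norm_le z y
    calc _ ≤ ‖y - z‖ * 1 := by
            gcongr; exact inv_le_one_of_one_le₀ hy
      _ = _ := mul_one _
  nlinarith [norm_nonneg (y - z)]

variable [MeasurableSpace E] [BorelSpace E]

lemma hausdorffMeasure_closedBall_pos_lt_top [FiniteDimensional ℝ E] {d : ℕ}
    (hd : Module.finrank ℝ E = d) {r : ℝ} (hr : 0 < r) :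
    0 < μH[(d : ℝ)] (closedBall (0 : E) r) ∧ μH[(d : ℝ)] (closedBall (0 : E) r) < ⊤ := by
  have h := InnerProductSpace.euclideanHausdorffMeasure_eq_volume (V := E)
  rw [hd] at h
  have h2 : (volume : Measure E) (closedBall 0 r) = μHE[d] (closedBall (0 : E) r) := by rw [h]
  rw [Measure.euclideanHausdorffMeasure_def, Measure.smul_apply, ENNReal.smul_def, smul_eq_mul] at h2
  have hc := Measure.addHaarScalarFactor_volume_hausdorffMeasure_ne_zero d
  have hpos : 0 < (volume : Measure E) (closedBall 0 r) := measure_closedBall_pos _ _ hr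
  have hlt : (volume : Measure E) (closedBall 0 r) < ⊤ := measure_closedBall_lt_top
  rw [h2] at hpos hlt
  constructor
  · by_contra hcon
    simp only [not_lt, nonpos_iff_eq_zero] at hcon
    simp [hcon] at hpos
  · exact ENNReal.lt_top_of_mul_ne_top_right hlt.ne (by simpa using hc)

lemma hausdorffMeasure_sphere_pos [FiniteDimensional ℝ E] {d : ℕ}
    (hd : Module.finrank ℝ E = d + 1) : 0 < μH[(d : ℝ)] (sphere (0 : E) 1) := by
  have : Nontrivial E := Module.nontrivial_of_finrank_pos (R := ℝ) (by omega)
  obtain ⟨v, hv⟩ := exists_norm_eq E zero_le_one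
  set W := (ℝ ∙ v)ᗮ
  have hW : Module.finrank ℝ W = d := finrank_orthogonal_singleton hd hv
  have hL : LipschitzWith 1 (W.orthogonalProjectionOnto : E → W) := by
    have := W.orthogonalProjectionOnto.lipschitz
    refine this.weaken ?_
    exact Submodule.orthogonalProjectionOnto_norm_le W
  have := hL.hausdorffMeasure_image_le (d := (d : ℝ)) (by positivity) (sphere (0 : E) 1)
  simp only [ENNReal.coe_one, ENNReal.one_rpow, one_mul] at this
  refine lt_of_lt_of_le ?_ this
  refine lt_of_lt_of_le (hausdorffMeasure_closedBall_pos_lt_top hW one_pos).1 (measure_mono ?_)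
  intro w hw
  have hw1 : ‖(w : E)‖ ≤ 1 := by simpa using hw
  have hwv : inner ℝ (w : E) v = 0 := by
    have := Submodule.mem_orthogonal_singleton_iff_inner_left.1 w.2
    exact this
  refine ⟨(w : E) + Real.sqrt (1 - ‖(w : E)‖ ^ 2) • v, ?_, ?_⟩
  · rw [mem_sphere_zero_iff_norm]
    have : ‖(w : E) + Real.sqrt (1 - ‖(w : E)‖ ^ 2) • v‖ ^ 2 = 1 := by
      rw [norm_add_sq_real, inner_smul_right, hwv, norm_smul, hv, Real.norm_of_nonneg (Real.sqrt_nonneg _),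
        mul_one, Real.sq_sqrt (by nlinarith [norm_nonneg (w : E)])]
      ring
    nlinarith [norm_nonneg ((w : E) + Real.sqrt (1 - ‖(w : E)‖ ^ 2) • v)]
  · rw [map_add, map_smul, Submodule.orthogonalProjectionOnto_mem_subspace_eq_self]
    have : W.orthogonalProjectionOnto v = 0 := by
      rw [Submodule.orthogonalProjectionOnto_eq_zero_iff]
      exact Submodule.le_orthogonal_orthogonal _ (Submodule.mem_span_singleton_self v)
    rw [this]; simp

lemma hausdorffMeasure_sphere_lt_top [FiniteDimensional ℝ E] {d : ℕ}
    (hd : Module.finrank ℝ E = d + 1) : μH[(d : ℝ)] (sphere (0 : E) 1) < ⊤ := by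
  refine (isCompact_sphere (0 : E) 1).measure_lt_top_of_nhdsWithin fun v hv ↦ ?_
  have hv : ‖v‖ = 1 := by simpa using hv
  set W := (ℝ ∙ v)ᗮ
  have hW : Module.finrank ℝ W = d := finrank_orthogonal_singleton hd hv
  have hwv : ∀ w : W, inner ℝ v (w : E) = 0 := fun w ↦
    Submodule.mem_orthogonal_singleton_iff_inner_right.1 w.2
  let T : W → E := fun w ↦ ‖(w : E) + v‖⁻¹ • ((w : E) + v)
  have hge : ∀ w : W, 1 ≤ ‖(w : E) + v‖ := by
    intro w
    have : ‖(w : E) + v‖ ^ 2 = ‖(w : E)‖ ^ 2 + 1 := by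
      rw [norm_add_sq_real, real_inner_comm, hwv, hv]; ring
    nlinarith [norm_nonneg ((w : E) + v), sq_nonneg ‖(w : E)‖]
  have hT : LipschitzWith 2 T := by
    refine LipschitzWith.of_dist_le_mul fun a b ↦ ?_
    rw [dist_eq_norm, dist_eq_norm]
    refine (norm_normalize_sub_normalize_le (hge a) (hge b)).trans ?_
    simp
  have h1 := hT.hausdorffMeasure_image_le (d := (d : ℝ)) (by positivity) (closedBall 0 3)
  have h2 : μH[(d : ℝ)] (T '' closedBall 0 3) < ⊤ := by
    refine h1.trans_lt (ENNReal.mul_lt_top ?_ (hausdorffMeasure_closedBall_pos_lt_top hW (by norm_num)).2)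
    exact ENNReal.rpow_lt_top_of_nonneg (by positivity) (by simp)
  refine ⟨_, ?_, h2⟩
  have hopen : {x : E | (1 / 2 : ℝ) < inner ℝ v x} ∈ 𝓝 v := by
    refine IsOpen.mem_nhds (isOpen_lt continuous_const (by fun_prop)) ?_
    simp [hv]; norm_num
  filter_upwards [mem_nhdsWithin_of_mem_nhds hopen, self_mem_nhdsWithin] with x hx hxs
  have hx : (1 / 2 : ℝ) < inner ℝ v x := hx
  have hxs : ‖x‖ = 1 := by simpa using hxs
  set c : ℝ := inner ℝ v x
  have hc : 0 < c := by linarith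
  have hmem : c⁻¹ • x - v ∈ W := by
    rw [Submodule.mem_orthogonal_singleton_iff_inner_right, inner_sub_right, inner_smul_right,
      real_inner_self_eq_norm_sq, hv]
    change c⁻¹ * c - 1 ^ 2 = 0
    rw [inv_mul_cancel₀ hc.ne']; norm_num
  refine ⟨⟨_, hmem⟩, ?_, ?_⟩
  · rw [mem_closedBall_zero_iff]
    change ‖c⁻¹ • x - v‖ ≤ 3
    refine (norm_sub_le _ _).trans ?_
    rw [norm_smul, hv, hxs, Real.norm_of_nonneg (by positivity)]
    have : c⁻¹ ≤ 2 := by rw [inv_le_comm₀ hc (by norm_num)]; linarith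
    linarith
  · change ‖c⁻¹ • x - v + v‖⁻¹ • (c⁻¹ • x - v + v) = x
    rw [sub_add_cancel, norm_smul, hxs, Real.norm_of_nonneg (by positivity), smul_smul]
    simp [hc.ne']

/-- Two finite measures on a compact metric space, for both of which all balls of a given radius
have the same measure, are proportional. -/
lemma smul_eq_smul_of_uniformlyDistributed {X : Type*} [MetricSpace X] [CompactSpace X]
    [MeasurableSpace X] [BorelSpace X] (μ ν : Measure X) [IsFiniteMeasure μ] [IsFiniteMeasure ν]
    (hμ : ∀ x y r, μ (ball x r) = μ (ball y r)) (hν : ∀ x y r, ν (ball x r) = ν (ball y r))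
    (hμ0 : ∀ x r, 0 < r → μ (ball x r) ≠ 0) :
    μ univ • ν = ν univ • μ := by
  rcases isEmpty_or_nonempty X with hX | ⟨⟨x₀⟩⟩
  · simp [Measure.eq_zero_of_isEmpty]
  have : SecondCountableTopology X := inferInstance
  have key : ∀ f : X → ℝ, Continuous f → ∀ r > 0, ∀ ω : ℝ,
      (∀ x y, dist x y < r → |f x - f y| ≤ ω) →
      |ν.real (ball x₀ r) * ∫ y, f y ∂μ - μ.real (ball x₀ r) * ∫ x, f x ∂ν| ≤
        ω * μ.real (ball x₀ r) * ν.real univ := by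
    intro f hf r hr ω hω
    obtain ⟨C, hC⟩ : ∃ C, ∀ x, ‖f x‖ ≤ C := by
      obtain ⟨C, hC⟩ := isCompact_univ.exists_bound_of_continuousOn hf.continuousOn
      exact ⟨C, fun x ↦ hC x (mem_univ x)⟩
    have hmeas : MeasurableSet {p : X × X | dist p.1 p.2 < r} :=
      (isOpen_lt (by fun_prop) continuous_const).measurableSet
    let G : X → X → ℝ := fun x y ↦ {p : X × X | dist p.1 p.2 < r}.indicator (fun p ↦ f p.2) (x, y)
    have hGi : Integrable (Function.uncurry G) (ν.prod μ) := by
      have : Integrable (fun p : X × X ↦ f p.2) (ν.prod μ) :=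
        Integrable.of_bound (by fun_prop) C (by filter_upwards with p using hC _)
      exact this.indicator hmeas
    have h1 : ∫ x, ∫ y, G x y ∂μ ∂ν = ν.real (ball x₀ r) * ∫ y, f y ∂μ := by
      rw [integral_integral_swap hGi, ← integral_const_mul]
      congr 1; ext y
      have : (fun x ↦ G x y) = (ball y r).indicator (fun _ ↦ f y) := by
        ext x; simp [G, indicator, mem_ball]
      rw [this, integral_indicator measurableSet_ball, setIntegral_const, smul_eq_mul, Measure.real,
        hν y x₀ r, Measure.real]
    have h2 : ∀ x, |∫ y, G x y ∂μ - μ.real (ball x₀ r) * f x| ≤ ω * μ.real (ball x₀ r) := by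
      intro x
      have e1 : (fun y ↦ G x y) = (ball x r).indicator f := by
        ext y; simp [G, indicator, mem_ball, dist_comm]
      have e2 : μ.real (ball x₀ r) = μ.real (ball x r) := by rw [Measure.real, hμ x₀ x r, Measure.real]
      have hfi : Integrable f μ := Integrable.of_bound (by fun_prop) C (by filter_upwards with p using hC _)
      rw [e1, integral_indicator measurableSet_ball, e2, ← smul_eq_mul, ← setIntegral_const,
        ← integral_sub hfi.integrableOn (integrable_const _).integrableOn, ← Real.norm_eq_abs]
      refine norm_setIntegral_le_of_norm_le_const (measure_lt_top _ _) fun y hy ↦ ?_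
      exact hω y x hy
    have hGi' : Integrable (fun x ↦ ∫ y, G x y ∂μ) ν := hGi.integral_prod_left
    rw [← h1, ← integral_const_mul, ← integral_sub hGi', ← Real.norm_eq_abs]
    · refine (norm_integral_le_of_norm_le_const (μ := ν) (C := ω * μ.real (ball x₀ r)) ?_)
      filter_upwards with x using h2 x
    · exact (Integrable.of_bound (by fun_prop) C (by filter_upwards with p using hC _)).const_mul _
  have hk : ∀ r > 0, ν.real (ball x₀ r) * μ.real univ = μ.real (ball x₀ r) * ν.real univ := by
    intro r hr
    have := key (fun _ ↦ 1) continuous_const r hr 0 (by simp)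
    simp only [integral_const, smul_eq_mul, mul_one, zero_mul] at this
    exact sub_eq_zero.1 (abs_eq_zero.1 (le_antisymm this (abs_nonneg _)))
  have hfin : ∀ f : X → ℝ, Continuous f → μ.real univ * ∫ x, f x ∂ν = ν.real univ * ∫ x, f x ∂μ := by
    intro f hf
    have hu := CompactSpace.uniformContinuous_of_continuous hf
    have : ∀ ω > 0, |ν.real univ * ∫ y, f y ∂μ - μ.real univ * ∫ x, f x ∂ν| ≤
        ω * (μ.real univ * ν.real univ) := by
      intro ω hω
      obtain ⟨r, hr, hrω⟩ := Metric.uniformContinuous_iff.1 hu ω hω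
      have h := key f hf r hr ω (fun x y hxy ↦ (hrω hxy).le)
      have hpos : 0 < μ.real (ball x₀ r) :=
        ENNReal.toReal_pos (hμ0 x₀ r hr) (measure_ne_top _ _)
      have h3 := hk r hr
      rw [← mul_le_mul_iff_right₀ hpos, ← abs_of_pos hpos, ← abs_mul, abs_of_pos hpos]
      have e : μ.real (ball x₀ r) * (ν.real univ * ∫ y, f y ∂μ - μ.real univ * ∫ x, f x ∂ν) =
        μ.real univ * (ν.real (ball x₀ r) * ∫ y, f y ∂μ - μ.real (ball x₀ r) * ∫ x, f x ∂ν) := by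
        linear_combination (- ∫ y, f y ∂μ) * h3
      rw [e, abs_mul, abs_of_nonneg measureReal_nonneg]
      calc _ ≤ μ.real univ * (ω * μ.real (ball x₀ r) * ν.real univ) := by gcongr
        _ = _ := by ring
    have h0 : |ν.real univ * ∫ y, f y ∂μ - μ.real univ * ∫ x, f x ∂ν| ≤ 0 := by
      refine le_of_forall_pos_le_add fun ε hε ↦ ?_
      have hM : 0 ≤ μ.real univ * ν.real univ := by positivity
      have := this (ε / (μ.real univ * ν.real univ + 1)) (by positivity)
      refine this.trans ?_
      rw [zero_add, div_mul_eq_mul_div, div_le_iff₀ (by positivity)]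
      nlinarith
    linarith [sub_eq_zero.1 (abs_eq_zero.1 (le_antisymm h0 (abs_nonneg _)))]
  have : IsFiniteMeasure (μ univ • ν) := ν.smul_finite (measure_ne_top _ _)
  have : IsFiniteMeasure (ν univ • μ) := μ.smul_finite (measure_ne_top _ _)
  refine ext_of_forall_integral_eq_of_IsFiniteMeasure fun f ↦ ?_
  rw [integral_smul_measure, integral_smul_measure]
  exact hfin f f.continuous

end Sphere

section Polar

lemma image_coe_ball_sphere {E : Type*} [NormedAddCommGroup E] (x : sphere (0 : E) 1) (r : ℝ) :
    Subtype.val '' ball x r = ball (x : E) r ∩ sphere 0 1 := by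
  ext z
  constructor
  · rintro ⟨w, hw, rfl⟩
    exact ⟨hw, w.2⟩
  · rintro ⟨h1, h2⟩
    exact ⟨⟨z, h2⟩, h1, rfl⟩

variable {E : Type*} [NormedAddCommGroup E] [InnerProductSpace ℝ E]

lemma exists_linearIsometryEquiv_apply_eq {x y : E} (h : ‖x‖ = ‖y‖) :
    ∃ ρ : E ≃ₗᵢ[ℝ] E, ρ x = y :=
  ⟨_, Submodule.reflection_sub h⟩

lemma LinearIsometryEquiv.image_ball_inter_sphere (ρ : E ≃ₗᵢ[ℝ] E) (x : E) (r : ℝ) :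
    ρ '' (ball x r ∩ sphere 0 1) = ball (ρ x) r ∩ sphere 0 1 := by
  rw [image_inter ρ.injective, ρ.image_ball, ρ.image_sphere, map_zero]

variable [MeasurableSpace E] [BorelSpace E]

open scoped Pointwise in
lemma smul_toSphere_eq_smul_hausdorffMeasure [FiniteDimensional ℝ E] {d : ℕ}
    (hd : Module.finrank ℝ E = d + 1) :
    (μH[(d : ℝ)] (sphere (0 : E) 1)) • (volume : Measure E).toSphere =
      ((volume : Measure E).toSphere univ) •
        (μH[(d : ℝ)] : Measure E).comap (Subtype.val : sphere (0 : E) 1 → E) := by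
  have hemb : MeasurableEmbedding (Subtype.val : sphere (0 : E) 1 → E) :=
    MeasurableEmbedding.subtype_coe isClosed_sphere.measurableSet
  have huniv : (μH[(d : ℝ)] : Measure E).comap (Subtype.val : sphere (0 : E) 1 → E) univ =
      μH[(d : ℝ)] (sphere (0 : E) 1) := by
    rw [hemb.comap_apply, image_univ, Subtype.range_coe]
  have hfin : IsFiniteMeasure
      ((μH[(d : ℝ)] : Measure E).comap (Subtype.val : sphere (0 : E) 1 → E)) :=
    ⟨by rw [huniv]; exact hausdorffMeasure_sphere_lt_top hd⟩
  have hball : ∀ (x y : sphere (0 : E) 1) (r : ℝ),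
      (μH[(d : ℝ)] : Measure E).comap (Subtype.val : sphere (0 : E) 1 → E) (ball x r) =
      (μH[(d : ℝ)] : Measure E).comap (Subtype.val : sphere (0 : E) 1 → E) (ball y r) := by
    intro x y r
    obtain ⟨ρ, hρ⟩ := exists_linearIsometryEquiv_apply_eq (x := (x : E)) (y := y) (by simp)
    rw [hemb.comap_apply, hemb.comap_apply, image_coe_ball_sphere, image_coe_ball_sphere, ← hρ,
      ← LinearIsometryEquiv.image_ball_inter_sphere, ρ.isometry.hausdorffMeasure_image (by simp)]
  rw [← huniv]
  refine smul_eq_smul_of_uniformlyDistributed _ _ hball (fun x y r ↦ ?_) fun x r hr h0 ↦ ?_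
  · obtain ⟨ρ, hρ⟩ := exists_linearIsometryEquiv_apply_eq (x := (x : E)) (y := y) (by simp)
    rw [Measure.toSphere_apply' _ measurableSet_ball, Measure.toSphere_apply' _ measurableSet_ball,
      image_coe_ball_sphere, image_coe_ball_sphere, ← hρ,
      ← LinearIsometryEquiv.image_ball_inter_sphere]
    congr 1
    have : Ioo (0 : ℝ) 1 • (ρ '' (ball (x : E) r ∩ sphere 0 1)) =
        ρ '' (Ioo (0 : ℝ) 1 • (ball (x : E) r ∩ sphere 0 1)) := by
      ext z
      simp only [Set.mem_smul, mem_image]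
      constructor
      · rintro ⟨t, ht, _, ⟨w, hw, rfl⟩, rfl⟩
        exact ⟨t • w, ⟨t, ht, w, hw, rfl⟩, by simp⟩
      · rintro ⟨_, ⟨t, ht, w, hw, rfl⟩, rfl⟩
        exact ⟨t, ht, ρ w, ⟨w, hw, rfl⟩, by simp⟩
    rw [this, ← ρ.measurePreserving.measure_preimage_emb ρ.toHomeomorph.measurableEmbedding
      (ρ '' _), ρ.injective.preimage_image]
  · obtain ⟨t, ht⟩ := isCompact_univ.elim_nhds_subcover' (fun (y : sphere (0 : E) 1) _ ↦ ball y r)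
      (fun y _ ↦ ball_mem_nhds y hr)
    refine (hausdorffMeasure_sphere_pos hd).ne' ?_
    rw [← huniv]
    refine measure_mono_null ht ((measure_biUnion_null_iff t.countable_toSet).2 fun y _ ↦ ?_)
    rw [hball _ x, h0]

lemma lintegral_ball_eq_lintegral_toSphere [FiniteDimensional ℝ E] {d : ℕ}
    (hd : Module.finrank ℝ E = d + 1) {φ : E → ℝ≥0∞} (hφ : Measurable φ) :
    ∫⁻ x in ball (0 : E) 1, φ x =
      ∫⁻ r in Ioo (0 : ℝ) 1, ENNReal.ofReal (r ^ d) *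
        ∫⁻ ζ : sphere (0 : E) 1, φ (r • (ζ : E)) ∂(volume : Measure E).toSphere := by
  have : Nontrivial E := Module.nontrivial_of_finrank_pos (R := ℝ) (by omega)
  set ψ := (ball (0 : E) 1).indicator φ
  have hψ : Measurable ψ := hφ.indicator measurableSet_ball
  rw [← lintegral_indicator measurableSet_ball]
  change ∫⁻ x, ψ x = _
  have h1 : ∫⁻ x, ψ x = ∫⁻ x in ({0}ᶜ : Set E), ψ x := by
    rw [restrict_compl_singleton]
  have hmp := Measure.measurePreserving_homeomorphUnitSphereProd (volume : Measure E)
  rw [h1, ← lintegral_subtype_comap (measurableSet_singleton _).compl]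
  have h2 : ∀ x : ({0}ᶜ : Set E), ψ x = (fun p : sphere (0 : E) 1 × Ioi (0 : ℝ) ↦
      ψ ((p.2 : ℝ) • (p.1 : E))) (homeomorphUnitSphereProd E x) := by
    intro x
    have := homeomorphUnitSphereProd_symm_apply_coe E (homeomorphUnitSphereProd E x)
    rw [Homeomorph.symm_apply_apply] at this
    simp only
    rw [← this]
  have hm : Measurable (fun p : sphere (0 : E) 1 × Ioi (0 : ℝ) ↦ ψ ((p.2 : ℝ) • (p.1 : E))) :=
    hψ.comp (by fun_prop)
  have hm' : Measurable (fun p : Ioi (0 : ℝ) × sphere (0 : E) 1 ↦ ψ ((p.1 : ℝ) • (p.2 : E))) :=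
    hψ.comp (by fun_prop)
  rw [lintegral_congr h2, hmp.lintegral_comp hm, lintegral_prod_symm' _ hm, hd,
    Nat.add_sub_cancel, Measure.volumeIoiPow,
    lintegral_withDensity_eq_lintegral_mul _ (by fun_prop) hm'.lintegral_prod_right']
  simp only [Pi.mul_apply]
  rw [lintegral_subtype_comap measurableSet_Ioi (fun r : ℝ ↦ ENNReal.ofReal (r ^ d) *
        ∫⁻ ζ : sphere (0 : E) 1, ψ (r • (ζ : E)) ∂(volume : Measure E).toSphere),
    ← lintegral_indicator measurableSet_Ioi, ← lintegral_indicator measurableSet_Ioo]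
  congr 1
  ext r
  simp only [indicator, mem_Ioi, mem_Ioo, ψ, mem_ball_zero_iff, norm_smul, norm_eq_of_mem_sphere,
    mul_one, Real.norm_eq_abs]
  by_cases hr : 0 < r
  · by_cases hr1 : r < 1
    · simp [hr, hr1, abs_of_pos hr]
    · simp [hr, hr1, abs_of_pos hr]
  · simp [hr]

end Polar

section SigmaS

variable {n : ℕ}

lemma finrank_real_En : Module.finrank ℝ (En n) = 2 * n := by
  have := finrank_real_of_complex (En n)
  simpa using this

lemma ae_norm_eq_one_sigmaS : ∀ᵐ ζ ∂sigmaS n, ‖ζ‖ = 1 := by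
  refine Measure.ae_smul_measure ?_ _
  filter_upwards [ae_restrict_mem (isClosed_sphere (x := (0 : En n)) (ε := 1)).measurableSet]
    with ζ hζ
  exact mem_sphere_zero_iff_norm.1 hζ

lemma measurePreserving_sigmaS (ρ : En n ≃ₗᵢ[ℝ] En n) :
    MeasurePreserving ρ (sigmaS n) (sigmaS n) := by
  refine MeasurePreserving.smul_measure ?_ _
  have h : MeasurePreserving ρ (μH[(2 * n - 1 : ℝ)] : Measure (En n)) μH[(2 * n - 1 : ℝ)] :=
    ρ.toIsometryEquiv.measurePreserving_hausdorffMeasure _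
  have := h.restrict_preimage (isClosed_sphere (x := (0 : En n)) (ε := 1)).measurableSet
  have h2 : ρ ⁻¹' (sphere (0 : En n) 1) = sphere 0 1 := by
    rw [ρ.preimage_sphere, map_zero]
  rwa [h2] at this

lemma toSphere_univ_En : (volume : Measure (En n)).toSphere univ = (2 * n : ℕ) * volume (Bn n) := by
  rw [Measure.toSphere_apply_univ, finrank_real_En]; rfl

variable [NeZero n]

lemma finrank_real_En_eq_add_one : Module.finrank ℝ (En n) = (2 * n - 1) + 1 := by
  rw [finrank_real_En]
  have := NeZero.ne n
  omega

lemma cast_two_mul_sub_one : ((2 * n - 1 : ℕ) : ℝ) = 2 * n - 1 := by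
  have := NeZero.one_le (n := n)
  rw [Nat.cast_sub (by omega)]
  push_cast
  rfl

lemma hausdorffMeasure_Sn_pos_lt_top :
    0 < μH[(2 * n - 1 : ℝ)] (Sn n) ∧ μH[(2 * n - 1 : ℝ)] (Sn n) < ⊤ := by
  rw [← cast_two_mul_sub_one]
  exact ⟨hausdorffMeasure_sphere_pos finrank_real_En_eq_add_one,
    hausdorffMeasure_sphere_lt_top finrank_real_En_eq_add_one⟩

instance : IsProbabilityMeasure (sigmaS n) :=
  ⟨by
    rw [sigmaS, Measure.smul_apply, Measure.restrict_apply_univ, smul_eq_mul,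
      ENNReal.inv_mul_cancel hausdorffMeasure_Sn_pos_lt_top.1.ne'
        hausdorffMeasure_Sn_pos_lt_top.2.ne]⟩

lemma lintegral_toSphere_En (φ : En n → ℝ≥0∞) :
    ∫⁻ ζ : sphere (0 : En n) 1, φ ζ ∂(volume : Measure (En n)).toSphere =
      (2 * n : ℕ) * volume (Bn n) * ∫⁻ ζ, φ ζ ∂sigmaS n := by
  have h := smul_toSphere_eq_smul_hausdorffMeasure (E := En n) finrank_real_En_eq_add_one
  have h1 := congrArg (fun μ ↦ ∫⁻ ζ : sphere (0 : En n) 1, φ ζ ∂μ) h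
  simp only [lintegral_smul_measure, smul_eq_mul] at h1
  rw [lintegral_subtype_comap isClosed_sphere.measurableSet, cast_two_mul_sub_one,
    toSphere_univ_En] at h1
  rw [sigmaS, lintegral_smul_measure, smul_eq_mul, ← mul_assoc, mul_comm _ (_)⁻¹, mul_assoc]
  erw [← h1]
  rw [← mul_assoc]
  erw [ENNReal.inv_mul_cancel hausdorffMeasure_Sn_pos_lt_top.1.ne'
        hausdorffMeasure_Sn_pos_lt_top.2.ne, one_mul]

/-- Integration in polar coordinates. -/
lemma lintegral_volN_eq_lintegral_sigmaS {φ : En n → ℝ≥0∞} (hφ : Measurable φ) :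
    ∫⁻ z, φ z ∂volN n = ∫⁻ r in Ioo (0 : ℝ) 1, ENNReal.ofReal (2 * n * r ^ (2 * n - 1)) *
      ∫⁻ ζ, φ (r • ζ) ∂sigmaS n := by
  have hpos : (volume : Measure (En n)) (Bn n) ≠ 0 := (measure_ball_pos _ _ one_pos).ne'
  have htop : (volume : Measure (En n)) (Bn n) ≠ ⊤ := measure_ball_lt_top.ne
  rw [volN, lintegral_smul_measure, smul_eq_mul]
  change _ * ∫⁻ z in ball 0 1, φ z = _
  rw [
    lintegral_ball_eq_lintegral_toSphere finrank_real_En_eq_add_one hφ,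
    ← lintegral_const_mul' _ _ (by exact ENNReal.inv_ne_top.2 hpos)]
  refine setLIntegral_congr_fun measurableSet_Ioo fun r hr ↦ ?_
  rw [lintegral_toSphere_En fun ζ ↦ φ (r • ζ),
    ENNReal.ofReal_mul (by positivity)]
  have h2 : ENNReal.ofReal (2 * n) = (2 * n : ℕ) := by
    rw [← ENNReal.ofReal_natCast]; push_cast; rfl
  rw [h2]
  calc _ = ((volume (Bn n))⁻¹ * volume (Bn n)) * ((2 * n : ℕ) * ENNReal.ofReal (r ^ (2 * n - 1)) *
      ∫⁻ ζ, φ (r • ζ) ∂sigmaS n) := by rw [Bn]; ring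
    _ = _ := by rw [ENNReal.inv_mul_cancel hpos htop, one_mul]

end SigmaS

section RadialDerivative

variable {n : ℕ} {f g h : En n → ℂ}

lemma isOpen_Bn : IsOpen (Bn n) := isOpen_ball

lemma mem_Bn {z : En n} : z ∈ Bn n ↔ ‖z‖ < 1 := mem_ball_zero_iff

lemma smul_mem_Bn {z : En n} (hz : z ∈ Bn n) {c : ℂ} (hc : ‖c‖ ≤ 1) : c • z ∈ Bn n := by
  rw [mem_Bn] at *
  rw [norm_smul]
  nlinarith [norm_nonneg z, norm_nonneg c]

lemma real_smul_mem_Bn {z : En n} (hz : z ∈ Bn n) {t : ℝ} (ht : t ∈ Icc (0 : ℝ) 1) :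
    t • z ∈ Bn n := by
  rw [mem_Bn] at *
  rw [norm_smul, Real.norm_of_nonneg ht.1]
  nlinarith [norm_nonneg z, ht.1, ht.2]

lemma DifferentiableOn.differentiableAt_of_mem_Bn (hf : DifferentiableOn ℂ f (Bn n)) {z : En n}
    (hz : z ∈ Bn n) : DifferentiableAt ℂ f z :=
  hf.differentiableAt (isOpen_Bn.mem_nhds hz)

lemma exists_norm_le_of_continuousOn_Bn {F : Type*} [NormedAddCommGroup F] {f : En n → F}
    (hf : ContinuousOn f (Bn n)) {ρ : ℝ} (hρ : ρ < 1) :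
    ∃ C, 0 ≤ C ∧ ∀ z : En n, ‖z‖ ≤ ρ → ‖f z‖ ≤ C := by
  obtain ⟨C, hC⟩ := (isCompact_closedBall (0 : En n) ρ).exists_bound_of_continuousOn
    (hf.mono (closedBall_subset_ball hρ))
  exact ⟨max C 0, le_max_right _ _, fun z hz ↦
    (hC z (mem_closedBall_zero_iff.2 hz)).trans (le_max_left _ _)⟩

lemma exists_norm_fderiv_le (hf : DifferentiableOn ℂ f (Bn n)) {ρ : ℝ} (hρ : ρ < 1) :
    ∃ C, 0 ≤ C ∧ ∀ z : En n, ‖z‖ ≤ ρ → ‖fderiv ℂ f z‖ ≤ C := by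
  obtain ⟨C, hC0, hC⟩ := exists_norm_le_of_continuousOn_Bn hf.continuousOn
    (show (1 + ρ) / 2 < 1 by linarith)
  refine ⟨(C + C) / ((1 - ρ) / 2), by have : 0 ≤ 1 - ρ := by linarith
                                      positivity, fun z hz ↦ ?_⟩
  have hball : ∀ w ∈ ball z ((1 - ρ) / 2), ‖w‖ ≤ (1 + ρ) / 2 := by
    intro w hw
    have h1 : ‖w - z‖ < (1 - ρ) / 2 := by simpa [dist_eq_norm] using hw
    have h2 := norm_add_le (w - z) z
    rw [sub_add_cancel] at h2
    linarith
  refine Complex.norm_fderiv_le_div_of_mapsTo_ball (R₂ := C + C) (hf.mono fun w hw ↦ ?_)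
    (fun w hw ↦ ?_) (by linarith)
  · rw [mem_Bn]
    have := hball w hw
    linarith
  · rw [mem_closedBall, dist_eq_norm]
    exact (norm_sub_le _ _).trans (add_le_add (hC _ (hball w hw)) (hC _ (by linarith)))

lemma measurable_indicator_Bn {F : Type*} [NormedAddCommGroup F] [MeasurableSpace F]
    [BorelSpace F] {f : En n → F} (hf : ContinuousOn f (Bn n)) :
    Measurable ((Bn n).indicator f) := by
  classical
  rw [← Set.piecewise_eq_indicator]
  exact hf.measurable_piecewise continuousOn_const isOpen_Bn.measurableSet

lemma aestronglyMeasurable_comp_of_mem_Bn {α : Type*} [MeasurableSpace α] {μ : Measure α}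
    {f : En n → ℂ} (hf : ContinuousOn f (Bn n)) {u : α → En n} (hu : Measurable u)
    (hmem : ∀ᵐ a ∂μ, u a ∈ Bn n) : AEStronglyMeasurable (fun a ↦ f (u a)) μ := by
  refine AEStronglyMeasurable.congr (f := fun a ↦ (Bn n).indicator f (u a))
    ((measurable_indicator_Bn hf).comp hu).aestronglyMeasurable ?_
  filter_upwards [hmem] with a ha
  simp [ha]

/-- Differentiation under the integral sign for averages of dilates. -/
lemma hasFDerivAt_integral_dilates (hh : DifferentiableOn ℂ h (Bn n)) {μ : Measure ℝ}
    {c l : ℝ → ℂ} (hc : Measurable c) (hl : Measurable l) {L : ℝ}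
    (hlL : ∀ᵐ a ∂μ, ‖l a‖ ≤ L) (hcl : Integrable (fun a ↦ c a * l a) μ) {z : En n}
    (hz : L * ‖z‖ < 1) (hF : Integrable (fun a ↦ c a * h (l a • z)) μ) :
    HasFDerivAt (fun z ↦ ∫ a, c a * h (l a • z) ∂μ)
      (∫ a, (c a * l a) • fderiv ℂ h (l a • z) ∂μ) z := by
  set ρ := (1 + L * ‖z‖) / 2
  have hρ1 : ρ < 1 := by simp only [ρ]; linarith
  have hρ2 : L * ‖z‖ < ρ := by simp only [ρ]; linarith
  obtain ⟨C, hC0, hC⟩ := exists_norm_fderiv_le hh hρ1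
  have hnear : {x : En n | L * ‖x‖ < ρ} ∈ 𝓝 z :=
    (isOpen_lt (by fun_prop) continuous_const).mem_nhds hρ2
  have hmem : ∀ x : En n, L * ‖x‖ < ρ → ∀ a, ‖l a‖ ≤ L → ‖l a • x‖ ≤ ρ := by
    intro x hx a ha
    rw [norm_smul]
    exact (mul_le_mul_of_nonneg_right ha (norm_nonneg x)).trans hx.le
  refine hasFDerivAt_integral_of_dominated_of_fderiv_le (bound := fun a ↦ ‖c a * l a‖ * C)
    (F' := fun z a ↦ (c a * l a) • fderiv ℂ h (l a • z)) hnear ?_ hF ?_ ?_ (hcl.norm.mul_const C) ?_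
  · filter_upwards [hnear] with x hx
    refine hc.aestronglyMeasurable.mul
      (aestronglyMeasurable_comp_of_mem_Bn hh.continuousOn (by fun_prop) ?_)
    filter_upwards [hlL] with a ha
    exact mem_Bn.2 ((hmem x hx a ha).trans_lt hρ1)
  · have := (measurable_fderiv ℂ h).comp (hl.smul_const z)
    exact ((hc.mul hl).smul this).aestronglyMeasurable
  · filter_upwards [hlL] with a ha x hx
    rw [norm_smul]
    exact mul_le_mul_of_nonneg_left (hC _ (hmem x hx a ha)) (norm_nonneg _)
  · filter_upwards [hlL] with a ha x hx
    have h1 : HasFDerivAt h (fderiv ℂ h (l a • x)) (l a • x) :=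
      (hh.differentiableAt_of_mem_Bn (mem_Bn.2 ((hmem x hx a ha).trans_lt hρ1))).hasFDerivAt
    have h2 : HasFDerivAt (fun x : En n ↦ l a • x) (l a • ContinuousLinearMap.id ℂ (En n)) x :=
      (hasFDerivAt_id x).const_smul (l a)
    have h3 := (h1.comp x h2).const_mul (c a)
    have h4 : (c a * l a) • fderiv ℂ h (l a • x) =
        c a • (fderiv ℂ h (l a • x)).comp (l a • ContinuousLinearMap.id ℂ (En n)) := by
      ext v
      simp [mul_assoc]
    rw [h4]
    exact h3

lemma hasDerivAt_slice (hf : DifferentiableOn ℂ f (Bn n)) {z : En n} {l : ℂ} (hl : l • z ∈ Bn n) :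
    HasDerivAt (fun l : ℂ ↦ f (l • z)) (fderiv ℂ f (l • z) z) l := by
  have h2 : HasDerivAt (fun l : ℂ ↦ l • z) z l := by simpa using (hasDerivAt_id l).smul_const z
  exact (hf.differentiableAt_of_mem_Bn hl).hasFDerivAt.comp_hasDerivAt l h2

lemma radD_eq_circleIntegral (hf : DifferentiableOn ℂ f (Bn n)) {z : En n} {r : ℝ} (hr : 0 < r)
    (hz : (1 + r) * ‖z‖ < 1) :
    radD f z = (2 * Real.pi * Complex.I : ℂ)⁻¹ • ∮ l in C(1, r), ((l - 1) ^ 2)⁻¹ • f (l • z) := by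
  have hsub : closedBall (1 : ℂ) r ⊆ {l : ℂ | l • z ∈ Bn n} := by
    intro l hl
    have h1 : ‖l - 1‖ ≤ r := by simpa [dist_eq_norm] using hl
    have h2 : ‖l‖ ≤ 1 + r := by
      have := norm_add_le (l - 1) 1
      simp only [sub_add_cancel, norm_one] at this
      linarith
    change l • z ∈ Bn n
    rw [mem_Bn, norm_smul]
    exact (mul_le_mul_of_nonneg_right h2 (norm_nonneg z)).trans_lt hz
  have hopen : IsOpen {l : ℂ | l • z ∈ Bn n} := isOpen_Bn.preimage (by fun_prop)
  rw [Complex.two_pi_I_inv_smul_circleIntegral_sub_sq_inv_smul_of_differentiable hopen hsub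
    (fun l hl ↦ (hasDerivAt_slice hf hl).differentiableAt.differentiableWithinAt)
    (mem_ball_self hr)]
  rw [(hasDerivAt_slice hf (l := 1) (hsub (mem_closedBall_self hr.le))).deriv, one_smul, radD]

lemma differentiableOn_radD (hf : DifferentiableOn ℂ f (Bn n)) :
    DifferentiableOn ℂ (radD f) (Bn n) := by
  intro z hz
  rw [mem_Bn] at hz
  obtain ⟨r, hr, hrz⟩ : ∃ r : ℝ, 0 < r ∧ (1 + r) * ‖z‖ < 1 := by
    refine ⟨(1 - ‖z‖) / 2, by linarith, ?_⟩
    nlinarith [norm_nonneg z]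
  have hnear : {x : En n | (1 + r) * ‖x‖ < 1} ∈ 𝓝 z :=
    (isOpen_lt (by fun_prop) continuous_const).mem_nhds hrz
  set c : ℝ → ℂ := fun θ ↦ (2 * Real.pi * Complex.I : ℂ)⁻¹ *
    (deriv (circleMap 1 r) θ * ((circleMap 1 r θ - 1) ^ 2)⁻¹)
  have hsub : ∀ θ, circleMap 1 r θ - 1 ≠ 0 := fun θ ↦ by simp [circleMap, hr.ne']
  have hcc : Continuous c := by
    simp only [c, deriv_circleMap]
    refine continuous_const.mul (((continuous_circleMap 0 r).mul continuous_const).mul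
      (Continuous.inv₀ (by fun_prop) fun θ ↦ pow_ne_zero 2 (hsub θ)))
  have hlc : Continuous (circleMap 1 r) := continuous_circleMap 1 r
  have hl : ∀ θ, ‖circleMap 1 r θ‖ ≤ 1 + r := fun θ ↦ by
    have := norm_add_le (circleMap 1 r θ - 1) 1
    simp only [sub_add_cancel, norm_one] at this
    have h2 : ‖circleMap 1 r θ - 1‖ = r := by simp [circleMap, abs_of_pos hr]
    linarith
  have heq : ∀ x : En n, (1 + r) * ‖x‖ < 1 →
      radD f x = ∫ θ in Ioc 0 (2 * Real.pi), c θ * f (circleMap 1 r θ • x) := by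
    intro x hx
    rw [radD_eq_circleIntegral hf hr hx, circleIntegral,
      intervalIntegral.integral_of_le (by positivity), smul_eq_mul, ← integral_const_mul]
    congr 1
    ext θ
    simp only [c, smul_eq_mul]
    ring
  have hbdd : ∀ θ, circleMap 1 r θ • z ∈ Bn n := fun θ ↦ by
    rw [mem_Bn, norm_smul]
    exact (mul_le_mul_of_nonneg_right (hl θ) (norm_nonneg z)).trans_lt hrz
  have hcont : Continuous fun θ ↦ c θ * f (circleMap 1 r θ • z) :=
    hcc.mul (hf.continuousOn.comp_continuous (by fun_prop) hbdd)
  have key := hasFDerivAt_integral_dilates (μ := volume.restrict (Ioc 0 (2 * Real.pi))) hf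
    hcc.measurable hlc.measurable (ae_of_all _ hl)
    ((hcc.mul hlc).integrableOn_Ioc) hrz hcont.integrableOn_Ioc
  refine (key.congr_of_eventuallyEq ?_).differentiableAt.differentiableWithinAt
  filter_upwards [hnear] with x hx using heq x hx

lemma radD_zero (f : En n → ℂ) : radD f 0 = 0 := by simp [radD]

lemma fderiv_real_smul_apply (h : En n → ℂ) (t : ℝ) (z : En n) :
    (t : ℂ) * fderiv ℂ h (t • z) z = radD h (t • z) := by
  rw [radD, ← Complex.coe_smul, map_smul, smul_eq_mul]

lemma hasDerivAt_real_slice (hf : DifferentiableOn ℂ f (Bn n)) {z : En n} {t : ℝ}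
    (ht : t • z ∈ Bn n) : HasDerivAt (fun t : ℝ ↦ f (t • z)) (fderiv ℂ f (t • z) z) t := by
  have := (hasDerivAt_slice hf (z := z) (l := t) (by simpa using ht)).comp_ofReal
  simpa using this

/-- A holomorphic function vanishing at the origin is `O(|z|)`, uniformly on compacts. -/
lemma exists_norm_le_mul_norm (hf : DifferentiableOn ℂ f (Bn n)) (hf0 : f 0 = 0) {ρ : ℝ}
    (hρ : ρ < 1) : ∃ C, 0 ≤ C ∧ ∀ z : En n, ‖z‖ ≤ ρ → ‖f z‖ ≤ C * ‖z‖ := by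
  obtain ⟨C, hC0, hC⟩ := exists_norm_fderiv_le hf hρ
  refine ⟨C, hC0, fun z hz ↦ ?_⟩
  have := (convex_closedBall (0 : En n) ρ).norm_image_sub_le_of_norm_fderiv_le (𝕜 := ℂ) (f := f)
    (fun x hx ↦ hf.differentiableAt_of_mem_Bn (closedBall_subset_ball hρ hx))
    (fun x hx ↦ hC x (mem_closedBall_zero_iff.1 hx))
    (mem_closedBall_self ((norm_nonneg z).trans hz)) (mem_closedBall_zero_iff.2 hz)
  simpa [hf0] using this

lemma integral_fderiv_real_smul (hf : DifferentiableOn ℂ f (Bn n)) {z : En n} (hz : z ∈ Bn n) :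
    ∫ t in Ioo (0 : ℝ) 1, fderiv ℂ f (t • z) z = f z - f 0 := by
  have hsl : ∀ t ∈ Icc (0 : ℝ) 1, t • z ∈ Bn n := fun t ht ↦ real_smul_mem_Bn hz ht
  obtain ⟨C, -, hC⟩ := exists_norm_fderiv_le hf (mem_Bn.1 hz)
  rw [← integral_Ioc_eq_integral_Ioo, ← intervalIntegral.integral_of_le zero_le_one,
    intervalIntegral.integral_eq_sub_of_hasDerivAt (f := fun t : ℝ ↦ f (t • z))
      (fun t ht ↦ hasDerivAt_real_slice hf (hsl t (by simpa using ht)))]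
  · simp
  · rw [intervalIntegrable_iff_integrableOn_Ioc_of_le zero_le_one]
    refine Measure.integrableOn_of_bounded (M := C * ‖z‖) (by simp) ?_ ?_
    · have : Measurable fun t : ℝ ↦ fderiv ℂ f (t • z) z :=
        (measurable_fderiv_apply_const ℂ f z).comp (by fun_prop)
      exact this.aestronglyMeasurable
    · filter_upwards [ae_restrict_mem measurableSet_Ioc] with t ht
      refine (ContinuousLinearMap.le_opNorm _ _).trans
        (mul_le_mul_of_nonneg_right (hC _ ?_) (norm_nonneg z))
      rw [norm_smul, Real.norm_of_nonneg ht.1.le]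
      nlinarith [norm_nonneg z, ht.1, ht.2]

lemma hasFDerivAt_J (hg : DifferentiableOn ℂ g (Bn n)) (hf : DifferentiableOn ℂ f (Bn n))
    {z : En n} (hz : z ∈ Bn n) :
    HasFDerivAt (J g f)
      (∫ t in Ioo (0 : ℝ) 1, fderiv ℂ (fun z ↦ f z * radD g z) (t • z)) z := by
  set h : En n → ℂ := fun z ↦ f z * radD g z
  have hh : DifferentiableOn ℂ h (Bn n) := hf.mul (differentiableOn_radD hg)
  obtain ⟨C, hC0, hC⟩ := exists_norm_le_mul_norm hh (by simp [h, radD_zero]) (mem_Bn.1 hz)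
  have hl : ∀ᵐ t : ℝ ∂volume.restrict (Ioo (0 : ℝ) 1), ‖(t : ℂ)‖ ≤ 1 := by
    filter_upwards [ae_restrict_mem measurableSet_Ioo] with t ht
    rw [Complex.norm_real, Real.norm_of_nonneg ht.1.le]
    exact ht.2.le
  have hmul : ∀ᵐ t : ℝ ∂volume.restrict (Ioo (0 : ℝ) 1), (t : ℂ)⁻¹ * t = 1 := by
    filter_upwards [ae_restrict_mem measurableSet_Ioo] with t ht
    exact inv_mul_cancel₀ (by exact_mod_cast ht.1.ne')
  have hcl : Integrable (fun t : ℝ ↦ (t : ℂ)⁻¹ * t) (volume.restrict (Ioo (0 : ℝ) 1)) :=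
    (integrable_const (1 : ℂ)).congr (hmul.mono fun t ht ↦ ht.symm)
  have hF : Integrable (fun t : ℝ ↦ (t : ℂ)⁻¹ * h ((t : ℂ) • z))
      (volume.restrict (Ioo (0 : ℝ) 1)) := by
    refine Integrable.of_bound (C := C * ‖z‖) ?_ ?_
    · refine AEStronglyMeasurable.mul (by fun_prop)
        (aestronglyMeasurable_comp_of_mem_Bn hh.continuousOn (by fun_prop) ?_)
      filter_upwards [hl] with t ht using smul_mem_Bn hz ht
    · filter_upwards [ae_restrict_mem measurableSet_Ioo, hl] with t ht htl
      have h1 := hC ((t : ℂ) • z) (by rw [norm_smul]; nlinarith [norm_nonneg z])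
      rw [norm_smul, Complex.norm_real, Real.norm_of_nonneg ht.1.le] at h1
      rw [norm_mul, norm_inv, Complex.norm_real, Real.norm_of_nonneg ht.1.le,
        inv_mul_le_iff₀ ht.1]
      linarith
  have key := hasFDerivAt_integral_dilates (μ := volume.restrict (Ioo (0 : ℝ) 1)) hh
    (c := fun t : ℝ ↦ (t : ℂ)⁻¹) (l := fun t : ℝ ↦ (t : ℂ)) (by fun_prop) (by fun_prop) hl
    hcl (by rw [one_mul]; exact mem_Bn.1 hz) hF
  have e1 : J g f = fun z ↦ ∫ t in Ioo (0 : ℝ) 1, (t : ℂ)⁻¹ * h ((t : ℂ) • z) := by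
    ext w
    simp only [J, h, Complex.coe_smul]
    congr 1
    ext t
    rw [div_eq_inv_mul]
  rw [e1]
  convert key using 1
  refine integral_congr_ae ?_
  filter_upwards [hmul] with t ht
  rw [ht, one_smul, Complex.coe_smul]

lemma differentiableOn_J (hg : DifferentiableOn ℂ g (Bn n)) (hf : DifferentiableOn ℂ f (Bn n)) :
    DifferentiableOn ℂ (J g f) (Bn n) :=
  fun _ hz ↦ (hasFDerivAt_J hg hf hz).differentiableAt.differentiableWithinAt

lemma J_zero (g f : En n → ℂ) : J g f 0 = 0 := by simp [J, radD_zero]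

lemma radD_J (hg : DifferentiableOn ℂ g (Bn n)) (hf : DifferentiableOn ℂ f (Bn n)) {z : En n}
    (hz : z ∈ Bn n) : radD (J g f) z = f z * radD g z := by
  have hh : DifferentiableOn ℂ (fun z ↦ f z * radD g z) (Bn n) := hf.mul (differentiableOn_radD hg)
  obtain ⟨C, -, hC⟩ := exists_norm_fderiv_le hh (mem_Bn.1 hz)
  rw [radD, (hasFDerivAt_J hg hf hz).fderiv, ContinuousLinearMap.integral_apply,
    integral_fderiv_real_smul hh hz, radD_zero, mul_zero, sub_zero]
  refine Measure.integrableOn_of_bounded (M := C) (by simp) ?_ ?_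
  · have : Measurable fun t : ℝ ↦ fderiv ℂ (fun z ↦ f z * radD g z) (t • z) :=
      (measurable_fderiv ℂ _).comp (by fun_prop)
    exact this.aestronglyMeasurable
  · filter_upwards [ae_restrict_mem measurableSet_Ioo] with t ht
    refine hC _ ?_
    rw [norm_smul, Real.norm_of_nonneg ht.1.le]
    nlinarith [norm_nonneg z, ht.1, ht.2]

/-- `J g h` is the solution of `R G = h R g` with `G 0 = 0`. -/
lemma J_eq_of_radD_eq {G : En n → ℂ} (hG : DifferentiableOn ℂ G (Bn n)) (hG0 : G 0 = 0)
    (h : ∀ z ∈ Bn n, radD G z = f z * radD g z) {z : En n} (hz : z ∈ Bn n) : J g f z = G z := by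
  rw [← sub_zero (G z), ← hG0, ← integral_fderiv_real_smul hG hz, J]
  refine setIntegral_congr_fun measurableSet_Ioo fun t ht ↦ ?_
  have ht0 : (t : ℂ) ≠ 0 := by exact_mod_cast ht.1.ne'
  rw [← h _ (real_smul_mem_Bn hz ⟨ht.1.le, ht.2.le⟩), ← fderiv_real_smul_apply,
    mul_div_cancel_left₀ _ ht0]

lemma radD_pow (hf : DifferentiableOn ℂ f (Bn n)) (j : ℕ) {z : En n}
    (hz : z ∈ Bn n) : radD (fun z ↦ f z ^ j) z = j * f z ^ (j - 1) * radD f z := by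
  have := (hf.differentiableAt_of_mem_Bn hz).hasFDerivAt.pow j
  simp only [radD]
  erw [this.fderiv]
  simp [mul_assoc]

end RadialDerivative

section Green

variable {n : ℕ}

/-- `U` has derivative `w ↦ A z * w + B z * conj w` along the complex curves
`w ↦ exp w • z`, at every point of the ball. -/
def HasSliceDeriv (U A B : En n → ℂ) : Prop :=
  ∀ z ∈ Bn n, ∀ τ : ℂ, HasDerivAt (fun t : ℝ ↦ U (Complex.exp (t * τ) • z))
    (A z * τ + B z * (starRingEnd ℂ) τ) 0

lemma HasSliceDeriv.hasDerivAt {U A B : En n → ℂ} (h : HasSliceDeriv U A B) {z : En n} {τ : ℂ}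
    {t : ℝ} (ht : Complex.exp (t * τ) • z ∈ Bn n) :
    HasDerivAt (fun t : ℝ ↦ U (Complex.exp (t * τ) • z))
      (A (Complex.exp (t * τ) • z) * τ + B (Complex.exp (t * τ) • z) * (starRingEnd ℂ) τ) t := by
  have h1 := h _ ht τ
  rw [← sub_self t] at h1
  have h2 := h1.comp_sub_const t t
  refine h2.congr_of_eventuallyEq (Eventually.of_forall fun x ↦ ?_)
  simp only
  rw [smul_smul, ← Complex.exp_add]
  congr 3
  push_cast
  ring

lemma norm_real_smul_eq {r : ℝ} (hr : 0 ≤ r) {ζ : En n} (hζ : ‖ζ‖ = 1) : ‖r • ζ‖ = r := by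
  rw [norm_smul, hζ, Real.norm_of_nonneg hr, mul_one]

lemma measurePreserving_smul_sigmaS {c : ℂ} (hc : ‖c‖ = 1) :
    MeasurePreserving (fun ζ : En n ↦ c • ζ) (sigmaS n) (sigmaS n) := by
  have hc0 : c ≠ 0 := by rintro rfl; simp at hc
  let e : En n ≃ₗᵢ[ℂ] En n :=
    ⟨LinearEquiv.smulOfNeZero ℂ (En n) c hc0, fun x ↦ by simp [norm_smul, hc]⟩
  exact measurePreserving_sigmaS ⟨e.toLinearEquiv.restrictScalars ℝ, e.norm_map⟩

lemma integral_sigmaS_smul {c : ℂ} (hc : ‖c‖ = 1) {F : Type*} [NormedAddCommGroup F]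
    [NormedSpace ℝ F] (φ : En n → F) : ∫ ζ, φ (c • ζ) ∂sigmaS n = ∫ ζ, φ ζ ∂sigmaS n := by
  have hc0 : c ≠ 0 := by rintro rfl; simp at hc
  exact (measurePreserving_smul_sigmaS hc).integral_comp
    (Homeomorph.smulOfNeZero c hc0).measurableEmbedding φ

variable [NeZero n]

lemma integrable_sigmaS_smul {F : Type*} [NormedAddCommGroup F] {U : En n → F}
    (hU : ContinuousOn U (Bn n)) {r : ℝ} (hr : r ∈ Ico (0 : ℝ) 1) :
    Integrable (fun ζ ↦ U (r • ζ)) (sigmaS n) := by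
  obtain ⟨C, -, hC⟩ := exists_norm_le_of_continuousOn_Bn hU hr.2
  have h : ContinuousOn (fun ζ : En n ↦ U (r • ζ)) (Sn n) := by
    refine hU.comp (by fun_prop) fun ζ hζ ↦ ?_
    rw [mem_Bn, norm_real_smul_eq hr.1 (mem_sphere_zero_iff_norm.1 hζ)]
    exact hr.2
  refine Integrable.of_bound (C := C) ?_ ?_
  · have := h.aestronglyMeasurable (μ := μH[(2 * n - 1 : ℝ)]) isClosed_sphere.measurableSet
    exact AEStronglyMeasurable.smul_measure this _
  · filter_upwards [ae_norm_eq_one_sigmaS] with ζ hζ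
    exact hC _ (norm_real_smul_eq hr.1 hζ).le

lemma hasDerivAt_integral_slice {U A B : En n → ℂ} (hU : ContinuousOn U (Bn n))
    (hA : ContinuousOn A (Bn n)) (hB : ContinuousOn B (Bn n)) (h : HasSliceDeriv U A B)
    {r : ℝ} (hr : r ∈ Ico (0 : ℝ) 1) (τ : ℂ) :
    HasDerivAt (fun t : ℝ ↦ ∫ ζ, U (Complex.exp (t * τ) • r • ζ) ∂sigmaS n)
      ((∫ ζ, A (r • ζ) ∂sigmaS n) * τ + (∫ ζ, B (r • ζ) ∂sigmaS n) * (starRingEnd ℂ) τ) 0 := by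
  set ρ := (1 + r) / 2
  have hρ1 : ρ < 1 := by simp only [ρ]; linarith [hr.2]
  have hρ2 : r < ρ := by simp only [ρ]; linarith [hr.2]
  obtain ⟨C, hC0, hC⟩ := exists_norm_le_of_continuousOn_Bn hA hρ1
  obtain ⟨C', hC0', hC'⟩ := exists_norm_le_of_continuousOn_Bn hB hρ1
  set s : Set ℝ := {t | ‖Complex.exp (t * τ)‖ * r < ρ}
  have hs : s ∈ 𝓝 0 := (isOpen_lt (by fun_prop) continuous_const).mem_nhds (by simpa using hρ2)
  have hmem : ∀ t ∈ s, ∀ ζ : En n, ‖ζ‖ = 1 → ‖Complex.exp (t * τ) • r • ζ‖ ≤ ρ := by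
    intro t ht ζ hζ
    rw [norm_smul, norm_real_smul_eq hr.1 hζ]
    exact le_of_lt ht
  have hB' : ∀ t ∈ s, ∀ ζ : En n, ‖ζ‖ = 1 → Complex.exp (t * τ) • r • ζ ∈ Bn n :=
    fun t ht ζ hζ ↦ mem_Bn.2 ((hmem t ht ζ hζ).trans_lt hρ1)
  have h0 : (0 : ℝ) ∈ s := mem_of_mem_nhds hs
  have hmeas : ∀ V : En n → ℂ, ContinuousOn V (Bn n) → ∀ t ∈ s,
      AEStronglyMeasurable (fun ζ ↦ V (Complex.exp (t * τ) • r • ζ)) (sigmaS n) := by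
    intro V hV t ht
    refine aestronglyMeasurable_comp_of_mem_Bn hV (by fun_prop) ?_
    filter_upwards [ae_norm_eq_one_sigmaS] with ζ hζ using hB' t ht ζ hζ
  have key := (hasDerivAt_integral_of_dominated_loc_of_deriv_le (μ := sigmaS n) (𝕜 := ℝ)
    (F := fun t ζ ↦ U (Complex.exp (t * τ) • r • ζ)) (x₀ := 0) (s := s)
    (F' := fun t ζ ↦ A (Complex.exp (t * τ) • r • ζ) * τ +
      B (Complex.exp (t * τ) • r • ζ) * (starRingEnd ℂ) τ)
    (bound := fun _ ↦ C * ‖τ‖ + C' * ‖τ‖) hs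
    (Filter.eventually_of_mem hs fun t ht ↦ hmeas U hU t ht)
    (by simpa using integrable_sigmaS_smul hU hr)
    (((hmeas A hA 0 h0).mul_const _).add ((hmeas B hB 0 h0).mul_const _))
    (by
      filter_upwards [ae_norm_eq_one_sigmaS] with ζ hζ t ht
      refine (norm_add_le _ _).trans ?_
      rw [norm_mul, norm_mul, RCLike.norm_conj]
      gcongr
      · exact hC _ (hmem t ht ζ hζ)
      · exact hC' _ (hmem t ht ζ hζ))
    (integrable_const _)
    (by
      filter_upwards [ae_norm_eq_one_sigmaS] with ζ hζ t ht
      exact h.hasDerivAt (hB' t ht ζ hζ))).2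
  refine key.congr_deriv ?_
  simp only [Complex.ofReal_zero, zero_mul, Complex.exp_zero, one_smul]
  rw [integral_add ((integrable_sigmaS_smul hA hr).mul_const _)
    ((integrable_sigmaS_smul hB hr).mul_const _), integral_mul_const, integral_mul_const]

lemma integral_slice_eq {U A B : En n → ℂ} (hU : ContinuousOn U (Bn n))
    (hA : ContinuousOn A (Bn n)) (hB : ContinuousOn B (Bn n)) (h : HasSliceDeriv U A B)
    {r : ℝ} (hr : r ∈ Ico (0 : ℝ) 1) :
    ∫ ζ, A (r • ζ) ∂sigmaS n = ∫ ζ, B (r • ζ) ∂sigmaS n := by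
  have h1 := hasDerivAt_integral_slice hU hA hB h hr Complex.I
  have h2 : (fun t : ℝ ↦ ∫ ζ, U (Complex.exp (t * Complex.I) • r • ζ) ∂sigmaS n) =
      fun _ ↦ ∫ ζ, U (r • ζ) ∂sigmaS n := by
    ext t
    have := integral_sigmaS_smul (n := n) (Complex.norm_exp_ofReal_mul_I t) (fun ζ ↦ U (r • ζ))
    rw [← this]
    congr 1
    ext ζ
    rw [smul_comm]
  rw [h2] at h1
  have h3 := h1.unique (hasDerivAt_const _ _)
  rw [Complex.conj_I] at h3
  have h4 : (∫ ζ, A (r • ζ) ∂sigmaS n - ∫ ζ, B (r • ζ) ∂sigmaS n) * Complex.I = 0 := by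
    rw [← h3]; ring
  exact sub_eq_zero.1 ((mul_eq_zero.1 h4).resolve_right Complex.I_ne_zero)

lemma hasDerivAt_integral_radial {U A B : En n → ℂ} (hU : ContinuousOn U (Bn n))
    (hA : ContinuousOn A (Bn n)) (hB : ContinuousOn B (Bn n)) (h : HasSliceDeriv U A B)
    {r : ℝ} (hr : r ∈ Ioo (0 : ℝ) 1) :
    HasDerivAt (fun r : ℝ ↦ ∫ ζ, U (r • ζ) ∂sigmaS n)
      ((2 / r : ℝ) * ∫ ζ, B (r • ζ) ∂sigmaS n) r := by
  have hr' : r ∈ Ico (0 : ℝ) 1 := ⟨hr.1.le, hr.2⟩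
  have h1 := hasDerivAt_integral_slice hU hA hB h hr' 1
  rw [integral_slice_eq hU hA hB h hr'] at h1
  have h2 : HasDerivAt (fun x : ℝ ↦ Real.log (x / r)) (1 / r) r := by
    have h3 : HasDerivAt (fun x : ℝ ↦ x / r) (1 / r) r := (hasDerivAt_id r).div_const r
    convert h3.log (by simp [hr.1.ne']) using 1
    field_simp [hr.1.ne']
  have h0 : Real.log (r / r) = 0 := by rw [div_self hr.1.ne', Real.log_one]
  rw [← h0] at h1
  have h4 := h1.scomp r h2
  refine (h4.congr_of_eventuallyEq ?_).congr_deriv ?_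
  · filter_upwards [lt_mem_nhds hr.1] with x hx
    simp only [Function.comp]
    congr 1
    ext ζ
    congr 1
    rw [mul_one, ← Complex.ofReal_exp, Real.exp_log (div_pos hx hr.1), Complex.coe_smul, smul_smul,
      div_mul_cancel₀ _ hr.1.ne']
  · simp only [map_one, mul_one, Complex.real_smul]
    push_cast
    ring

lemma continuousWithinAt_integral_sigmaS_smul {U : En n → ℝ} (hU : ContinuousOn U (Bn n)) :
    ContinuousWithinAt (fun r : ℝ ↦ ∫ ζ, U (r • ζ) ∂sigmaS n) (Ici 0) 0 := by
  obtain ⟨C, -, hC⟩ := exists_norm_le_of_continuousOn_Bn hU (show (1 / 2 : ℝ) < 1 by norm_num)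
  have hnear : ∀ᶠ r : ℝ in 𝓝[Ici 0] 0, r ∈ Icc (0 : ℝ) (1 / 2) := by
    have h1 : ∀ᶠ r : ℝ in 𝓝[Ici 0] 0, r < 1 / 2 :=
      mem_nhdsWithin_of_mem_nhds (Iio_mem_nhds (by norm_num))
    filter_upwards [self_mem_nhdsWithin, h1] with r h1 h2 using ⟨h1, h2.le⟩
  refine continuousWithinAt_of_dominated (bound := fun _ ↦ C) ?_ ?_ (integrable_const _) ?_
  · filter_upwards [hnear] with r hr
    exact (integrable_sigmaS_smul hU ⟨hr.1, by linarith [hr.2]⟩).aestronglyMeasurable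
  · filter_upwards [hnear] with r hr
    filter_upwards [ae_norm_eq_one_sigmaS] with ζ hζ
    exact hC _ ((norm_real_smul_eq hr.1 hζ).le.trans hr.2)
  · filter_upwards with ζ
    have h0 : ContinuousAt U ((0 : ℝ) • ζ) := by
      rw [zero_smul]
      exact hU.continuousAt (isOpen_Bn.mem_nhds (by simp [mem_Bn]))
    have h1 : ContinuousAt (fun r : ℝ ↦ r • ζ) 0 := by fun_prop
    exact (ContinuousAt.comp (f := fun r : ℝ ↦ r • ζ) h0 h1).continuousWithinAt

/-- The one-dimensional form of Green's formula for integrals over spheres. -/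
lemma lintegral_log_mul_laplacian {Φ D : En n → ℝ} {A B A' : En n → ℂ}
    (hΦ : ContinuousOn Φ (Bn n)) (hA : ContinuousOn A (Bn n)) (hB : ContinuousOn B (Bn n))
    (hA' : ContinuousOn A' (Bn n)) (hD : ContinuousOn D (Bn n))
    (h1 : HasSliceDeriv (fun z ↦ (Φ z : ℂ)) A B) (h2 : HasSliceDeriv A A' (fun z ↦ (D z : ℂ)))
    (hD0 : ∀ z ∈ Bn n, 0 ≤ D z) {R C : ℝ} (hR : R ∈ Ioo (0 : ℝ) 1)
    (hC : ∀ z : En n, ‖z‖ ≤ R → ‖A z‖ ≤ C * ‖z‖) :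
    Φ 0 ≤ ∫ ζ, Φ (R • ζ) ∂sigmaS n ∧
      ∫⁻ r in Ioo 0 R, ENNReal.ofReal (Real.log (R / r) * (4 / r) * ∫ ζ, D (r • ζ) ∂sigmaS n) =
        ENNReal.ofReal (∫ ζ, Φ (R • ζ) ∂sigmaS n - Φ 0) := by
  set m : ℝ → ℝ := fun r ↦ ∫ ζ, Φ (r • ζ) ∂sigmaS n
  set k : ℝ → ℝ := fun r ↦ (∫ ζ, A (r • ζ) ∂sigmaS n).re
  set d : ℝ → ℝ := fun r ↦ ∫ ζ, D (r • ζ) ∂sigmaS n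
  have hΦc : ContinuousOn (fun z ↦ (Φ z : ℂ)) (Bn n) := Complex.continuous_ofReal.comp_continuousOn hΦ
  have hDc : ContinuousOn (fun z ↦ (D z : ℂ)) (Bn n) := Complex.continuous_ofReal.comp_continuousOn hD
  have hm : ∀ r ∈ Ioo (0 : ℝ) 1, HasDerivAt m (2 / r * k r) r := by
    intro r hr
    have h3 := hasDerivAt_integral_radial hΦc hA hB h1 hr
    rw [← integral_slice_eq hΦc hA hB h1 ⟨hr.1.le, hr.2⟩] at h3
    refine (Complex.reCLM.hasFDerivAt.comp_hasDerivAt r h3).congr_of_eventuallyEq ?_ |>.congr_deriv ?_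
    · refine Eventually.of_forall fun x ↦ ?_
      simp only [m, Function.comp, integral_complex_ofReal, Complex.reCLM_apply, Complex.ofReal_re]
    · simp only [k, Complex.reCLM_apply, Complex.re_ofReal_mul]
  have hk : ∀ r ∈ Ioo (0 : ℝ) 1, HasDerivAt k (2 / r * d r) r := by
    intro r hr
    have h3 := hasDerivAt_integral_radial hA hA' hDc h2 hr
    refine (Complex.reCLM.hasFDerivAt.comp_hasDerivAt r h3).congr_deriv ?_
    simp only [d, integral_complex_ofReal, Complex.reCLM_apply, Complex.re_ofReal_mul,
      Complex.ofReal_re]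
  set N : ℝ → ℝ := fun r ↦ m r + Real.log (R / r) * (2 * k r)
  have hN : ∀ r ∈ Ioo (0 : ℝ) 1, HasDerivAt N (Real.log (R / r) * (4 / r) * d r) r := by
    intro r hr
    have hlog : HasDerivAt (fun x : ℝ ↦ Real.log (R / x)) (-1 / r) r := by
      have h3 : HasDerivAt (fun x : ℝ ↦ R / x) (-R / r ^ 2) r := by
        simpa [div_eq_mul_inv, neg_mul] using (hasDerivAt_inv hr.1.ne').const_mul R
      refine (h3.log (div_pos hR.1 hr.1).ne').congr_deriv ?_
      field_simp [hR.1.ne', hr.1.ne']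
    refine ((hm r hr).add (hlog.mul ((hk r hr).const_mul 2))).congr_deriv ?_
    field_simp [hr.1.ne']
    ring
  have hkbound : ∀ r ∈ Icc (0 : ℝ) R, |k r| ≤ C * r := by
    intro r hr
    refine (Complex.abs_re_le_norm _).trans ?_
    refine (norm_integral_le_of_norm_le_const (C := C * r) ?_).trans (by simp)
    filter_upwards [ae_norm_eq_one_sigmaS] with ζ hζ
    have := hC (r • ζ)
    rw [norm_real_smul_eq hr.1 hζ] at this
    exact this hr.2
  have hcont : ContinuousOn N (Icc 0 R) := by
    intro x hx
    rcases hx.1.eq_or_lt with rfl | hx0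
    · have hN0 : N 0 = m 0 + 0 := by simp [N]
      rw [ContinuousWithinAt, hN0]
      refine Tendsto.add ((continuousWithinAt_integral_sigmaS_smul hΦ).mono Icc_subset_Ici_self) ?_
      have h0 : Tendsto (fun r : ℝ ↦ 2 * C * (|Real.log R * r| + |r * Real.log r|))
          (𝓝[Icc 0 R] 0) (𝓝 0) := by
        have : Continuous (fun r : ℝ ↦ 2 * C * (|Real.log R * r| + |r * Real.log r|)) := by
          have := Real.continuous_mul_log
          fun_prop
        have h3 := this.tendsto 0
        simp only [mul_zero, zero_mul, abs_zero, add_zero] at h3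
        exact h3.mono_left nhdsWithin_le_nhds
      refine squeeze_zero_norm' ?_ h0
      filter_upwards [self_mem_nhdsWithin] with r hr
      rcases hr.1.eq_or_lt with rfl | hr0
      · simp
      rw [Real.norm_eq_abs, abs_mul, abs_mul, abs_two, Real.log_div hR.1.ne' hr0.ne']
      calc |Real.log R - Real.log r| * (2 * |k r|)
          ≤ (|Real.log R| + |Real.log r|) * (2 * (C * r)) := by
            gcongr
            · exact abs_sub _ _
            · exact hkbound r hr
        _ = _ := by rw [abs_mul, abs_mul, abs_of_pos hr0]; ring
    · exact (hN x ⟨hx0, hx.2.trans_lt hR.2⟩).continuousAt.continuousWithinAt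
  have hsub : ∀ r ∈ Ioo (0 : ℝ) R, r ∈ Ioo (0 : ℝ) 1 := fun r hr ↦ ⟨hr.1, hr.2.trans hR.2⟩
  have hpos : ∀ r ∈ Ioo (0 : ℝ) R, 0 ≤ Real.log (R / r) * (4 / r) * d r := by
    intro r hr
    have h3 : 0 ≤ Real.log (R / r) := Real.log_nonneg ((one_le_div hr.1).2 hr.2.le)
    have h4 : 0 ≤ d r := by
      refine integral_nonneg_of_ae ?_
      filter_upwards [ae_norm_eq_one_sigmaS] with ζ hζ
      exact hD0 _ (mem_Bn.2 ((norm_real_smul_eq hr.1.le hζ).le.trans_lt (hsub r hr).2))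
    have := hr.1
    positivity
  have hint := intervalIntegral.integrableOn_deriv_of_nonneg hcont (fun r hr ↦ hN r (hsub r hr)) hpos
  have h3 := intervalIntegral.integral_eq_sub_of_hasDerivAt_of_le hR.1.le hcont
    (fun r hr ↦ hN r (hsub r hr)) ((intervalIntegrable_iff_integrableOn_Ioc_of_le hR.1.le).2 hint)
  rw [intervalIntegral.integral_of_le hR.1.le, integral_Ioc_eq_integral_Ioo] at h3
  have h4 : N R = m R := by simp [N, div_self hR.1.ne']
  have h5 : N 0 = Φ 0 := by simp [N, m]
  rw [h4, h5] at h3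
  refine ⟨sub_nonneg.1 (h3 ▸ setIntegral_nonneg measurableSet_Ioo hpos), ?_⟩
  rw [← h3]
  exact (ofReal_integral_eq_lintegral_ofReal (hint.mono_set Ioo_subset_Ioc_self)
    ((ae_restrict_mem measurableSet_Ioo).mono hpos)).symm

end Green

section GreenPowers

variable {n : ℕ}

/-- The Green kernel of the ball of radius `R`, with pole at the origin, up to normalization;
it vanishes off that ball. -/
def greenW (n : ℕ) (R : ℝ) (z : En n) : ℝ≥0∞ :=
  ENNReal.ofReal (2 / n * (Real.log (R / ‖z‖) / ‖z‖ ^ (2 * n)))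

lemma measurable_greenW (R : ℝ) : Measurable (greenW n R) := by
  unfold greenW
  fun_prop

lemma ae_mem_Bn_volN : ∀ᵐ z ∂volN n, z ∈ Bn n :=
  Measure.ae_smul_measure (ae_restrict_mem isOpen_Bn.measurableSet) _

lemma real_smul_mem_Bn_of_norm_eq_one {r : ℝ} (hr : r ∈ Ico (0 : ℝ) 1) {ζ : En n} (hζ : ‖ζ‖ = 1) :
    r • ζ ∈ Bn n :=
  mem_Bn.2 ((norm_real_smul_eq hr.1 hζ).le.trans_lt hr.2)

variable [NeZero n]

/-- Green's formula for integrals over spheres. -/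
lemma lintegral_greenW_mul {Φ D : En n → ℝ} {A B A' : En n → ℂ}
    (hΦ : ContinuousOn Φ (Bn n)) (hA : ContinuousOn A (Bn n)) (hB : ContinuousOn B (Bn n))
    (hA' : ContinuousOn A' (Bn n)) (hD : ContinuousOn D (Bn n))
    (h1 : HasSliceDeriv (fun z ↦ (Φ z : ℂ)) A B) (h2 : HasSliceDeriv A A' (fun z ↦ (D z : ℂ)))
    (hΦ0 : ∀ z ∈ Bn n, 0 ≤ Φ z) (hD0 : ∀ z ∈ Bn n, 0 ≤ D z) {R C : ℝ} (hR : R ∈ Ioo (0 : ℝ) 1)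
    (hC : ∀ z : En n, ‖z‖ ≤ R → ‖A z‖ ≤ C * ‖z‖) :
    ∫⁻ ζ, ENNReal.ofReal (Φ (R • ζ)) ∂sigmaS n =
      ENNReal.ofReal (Φ 0) + ∫⁻ z, greenW n R z * ENNReal.ofReal (D z) ∂volN n := by
  have hn : (0 : ℝ) < n := Nat.cast_pos.2 (NeZero.pos n)
  obtain ⟨hmono, hlog⟩ := lintegral_log_mul_laplacian hΦ hA hB hA' hD h1 h2 hD0 hR hC
  set φ : En n → ℝ≥0∞ := fun z ↦ greenW n R z * ENNReal.ofReal ((Bn n).indicator D z)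
  have hφ : Measurable φ :=
    (measurable_greenW R).mul (measurable_indicator_Bn hD).ennreal_ofReal
  have hcongr : ∫⁻ z, greenW n R z * ENNReal.ofReal (D z) ∂volN n = ∫⁻ z, φ z ∂volN n := by
    refine lintegral_congr_ae ?_
    filter_upwards [ae_mem_Bn_volN] with z hz
    simp [φ, hz]
  have hinner : ∀ r ∈ Ioo (0 : ℝ) 1,
      ENNReal.ofReal (2 * n * r ^ (2 * n - 1)) * ∫⁻ ζ, φ (r • ζ) ∂sigmaS n =
        ENNReal.ofReal (Real.log (R / r) * (4 / r) * ∫ ζ, D (r • ζ) ∂sigmaS n) := by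
    intro r hr
    have h3 : ∫⁻ ζ, φ (r • ζ) ∂sigmaS n =
        ENNReal.ofReal (2 / n * (Real.log (R / r) / r ^ (2 * n))) *
          ENNReal.ofReal (∫ ζ, D (r • ζ) ∂sigmaS n) := by
      rw [ofReal_integral_eq_lintegral_ofReal (integrable_sigmaS_smul hD ⟨hr.1.le, hr.2⟩),
        ← lintegral_const_mul' _ _ ENNReal.ofReal_ne_top]
      · refine lintegral_congr_ae ?_
        filter_upwards [ae_norm_eq_one_sigmaS] with ζ hζ
        simp [φ, greenW, norm_real_smul_eq hr.1.le hζ,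
          real_smul_mem_Bn_of_norm_eq_one ⟨hr.1.le, hr.2⟩ hζ]
      · filter_upwards [ae_norm_eq_one_sigmaS] with ζ hζ
        exact hD0 _ (real_smul_mem_Bn_of_norm_eq_one ⟨hr.1.le, hr.2⟩ hζ)
    have h4 : 0 ≤ ∫ ζ, D (r • ζ) ∂sigmaS n := by
      refine integral_nonneg_of_ae ?_
      filter_upwards [ae_norm_eq_one_sigmaS] with ζ hζ
      exact hD0 _ (real_smul_mem_Bn_of_norm_eq_one ⟨hr.1.le, hr.2⟩ hζ)
    have hr0 := hr.1
    rw [h3, ← mul_assoc, ← ENNReal.ofReal_mul (by positivity), ← ENNReal.ofReal_mul' h4]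
    congr 2
    obtain ⟨k, rfl⟩ : ∃ k, n = k + 1 := ⟨n - 1, by have := NeZero.pos n; omega⟩
    have h5 : 2 * (k + 1) - 1 = 2 * k + 1 := by omega
    rw [h5]
    field_simp
    ring
  have hpolar : ∫⁻ z, φ z ∂volN n = ENNReal.ofReal (∫ ζ, Φ (R • ζ) ∂sigmaS n - Φ 0) := by
    rw [lintegral_volN_eq_lintegral_sigmaS hφ,
      setLIntegral_congr_fun measurableSet_Ioo hinner,
      ← hlog,
      ← lintegral_indicator measurableSet_Ioo, ← lintegral_indicator measurableSet_Ioo]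
    refine lintegral_congr fun r ↦ ?_
    by_cases hr : r ∈ Ioo (0 : ℝ) R
    · have hr1 : r ∈ Ioo (0 : ℝ) 1 := ⟨hr.1, hr.2.trans hR.2⟩
      rw [indicator_of_mem hr, indicator_of_mem hr1]
    rw [indicator_of_notMem hr]
    by_cases hr1 : r ∈ Ioo (0 : ℝ) 1
    · rw [indicator_of_mem hr1]
      have h3 : R ≤ r := not_lt.1 fun h ↦ hr ⟨hr1.1, h⟩
      have h4 : Real.log (R / r) ≤ 0 :=
        Real.log_nonpos (div_pos hR.1 hr1.1).le ((div_le_one hr1.1).2 h3)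
      have h5 : 0 ≤ ∫ ζ, D (r • ζ) ∂sigmaS n := by
        refine integral_nonneg_of_ae ?_
        filter_upwards [ae_norm_eq_one_sigmaS] with ζ hζ
        exact hD0 _ (real_smul_mem_Bn_of_norm_eq_one ⟨hr1.1.le, hr1.2⟩ hζ)
      have := hr1.1
      exact ENNReal.ofReal_eq_zero.2
        (mul_nonpos_of_nonpos_of_nonneg (mul_nonpos_of_nonpos_of_nonneg h4 (by positivity)) h5)
    · rw [indicator_of_notMem hr1]
  rw [hcongr, hpolar, ← ENNReal.ofReal_add (hΦ0 0 (by simp [mem_Bn])) (sub_nonneg.2 hmono),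
    add_sub_cancel, ofReal_integral_eq_lintegral_ofReal
      (integrable_sigmaS_smul hΦ ⟨hR.1.le, hR.2⟩)]
  filter_upwards [ae_norm_eq_one_sigmaS] with ζ hζ
  exact hΦ0 _ (real_smul_mem_Bn_of_norm_eq_one ⟨hR.1.le, hR.2⟩ hζ)

end GreenPowers

section GreenHolomorphic

variable {n : ℕ} {f f₁ f₂ : En n → ℂ}

lemma hasDerivAt_exp_slice (hf : DifferentiableOn ℂ f (Bn n)) {z : En n} (hz : z ∈ Bn n) (τ : ℂ) :
    HasDerivAt (fun t : ℝ ↦ f (Complex.exp (t * τ) • z)) (τ * radD f z) 0 := by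
  have h1 : HasDerivAt (fun w : ℂ ↦ Complex.exp (w * τ)) τ ((0 : ℝ) : ℂ) := by
    have := ((hasDerivAt_id ((0 : ℝ) : ℂ)).mul_const τ).cexp
    simpa using this
  have h2 : HasDerivAt (fun l : ℂ ↦ f (l • z)) (radD f z)
      (Complex.exp (((0 : ℝ) : ℂ) * τ)) := by
    have := hasDerivAt_slice hf (z := z) (l := 1) (by simpa using hz)
    simpa [radD] using this
  have h3 := (h2.comp ((0 : ℝ) : ℂ) h1).comp_ofReal
  rw [mul_comm] at h3
  exact h3

/-- The squared norm of the pair `(f₁, f₂)`, shifted by `ε`. -/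
def sqSum (f₁ f₂ : En n → ℂ) (ε : ℝ) (z : En n) : ℝ := ‖f₁ z‖ ^ 2 + ‖f₂ z‖ ^ 2 + ε

/-- The `(1, 0)`-part of the radial derivative of `sqSum f₁ f₂ ε`. -/
def sqSumD (f₁ f₂ : En n → ℂ) (z : En n) : ℂ :=
  (starRingEnd ℂ) (f₁ z) * radD f₁ z + (starRingEnd ℂ) (f₂ z) * radD f₂ z

lemma sqSum_pos {ε : ℝ} (hε : 0 < ε) (z : En n) : 0 < sqSum f₁ f₂ ε z := by
  unfold sqSum
  positivity

lemma continuousOn_sqSum (h₁ : ContinuousOn f₁ (Bn n)) (h₂ : ContinuousOn f₂ (Bn n)) (ε : ℝ) :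
    ContinuousOn (sqSum f₁ f₂ ε) (Bn n) := by
  unfold sqSum
  fun_prop

lemma continuousOn_sqSum_rpow (h₁ : ContinuousOn f₁ (Bn n)) (h₂ : ContinuousOn f₂ (Bn n)) {ε : ℝ}
    (hε : 0 < ε) (s : ℝ) : ContinuousOn (fun z ↦ sqSum f₁ f₂ ε z ^ s) (Bn n) :=
  (continuousOn_sqSum h₁ h₂ ε).rpow_const fun z _ ↦ Or.inl (sqSum_pos hε z).ne'

lemma norm_sqSumD_sq_le {ε : ℝ} (hε : 0 ≤ ε) (z : En n) :
    ‖sqSumD f₁ f₂ z‖ ^ 2 ≤ sqSum f₁ f₂ ε z * (‖radD f₁ z‖ ^ 2 + ‖radD f₂ z‖ ^ 2) := by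
  have h : ‖sqSumD f₁ f₂ z‖ ≤ ‖f₁ z‖ * ‖radD f₁ z‖ + ‖f₂ z‖ * ‖radD f₂ z‖ := by
    refine (norm_add_le _ _).trans_eq ?_
    simp
  calc ‖sqSumD f₁ f₂ z‖ ^ 2 ≤ (‖f₁ z‖ * ‖radD f₁ z‖ + ‖f₂ z‖ * ‖radD f₂ z‖) ^ 2 := by gcongr
    _ ≤ (‖f₁ z‖ ^ 2 + ‖f₂ z‖ ^ 2) * (‖radD f₁ z‖ ^ 2 + ‖radD f₂ z‖ ^ 2) := by
      nlinarith [sq_nonneg (‖f₁ z‖ * ‖radD f₂ z‖ - ‖f₂ z‖ * ‖radD f₁ z‖)]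
    _ ≤ _ := by
      unfold sqSum
      exact mul_le_mul_of_nonneg_right (by linarith) (by positivity)

lemma hasDerivAt_sqSum_slice (h₁ : DifferentiableOn ℂ f₁ (Bn n))
    (h₂ : DifferentiableOn ℂ f₂ (Bn n)) (ε : ℝ) {z : En n} (hz : z ∈ Bn n) (τ : ℂ) :
    HasDerivAt (fun t : ℝ ↦ sqSum f₁ f₂ ε (Complex.exp (t * τ) • z))
      (2 * (sqSumD f₁ f₂ z * τ).re) 0 := by
  have key : ∀ {f : En n → ℂ}, DifferentiableOn ℂ f (Bn n) →
      HasDerivAt (fun t : ℝ ↦ ‖f (Complex.exp (t * τ) • z)‖ ^ 2)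
        (2 * ((starRingEnd ℂ) (f z) * radD f z * τ).re) 0 := by
    intro f hf
    refine (hasDerivAt_exp_slice hf hz τ).norm_sq.congr_deriv ?_
    simp [Complex.inner]
    ring
  refine (((key h₁).add (key h₂)).add_const ε).congr_deriv ?_
  rw [← mul_add, ← Complex.add_re, sqSumD, add_mul]

/-- The `(1, 0)`-part of the radial derivative of `sqSum f₁ f₂ ε ^ s`. -/
def powD (f₁ f₂ : En n → ℂ) (ε s : ℝ) (z : En n) : ℂ :=
  (s * sqSum f₁ f₂ ε z ^ (s - 1) : ℝ) * sqSumD f₁ f₂ z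

/-- The radial part of the complex Hessian of `sqSum f₁ f₂ ε ^ s`. -/
def powDD (f₁ f₂ : En n → ℂ) (ε s : ℝ) (z : En n) : ℝ :=
  s * (s - 1) * sqSum f₁ f₂ ε z ^ (s - 2) * ‖sqSumD f₁ f₂ z‖ ^ 2 +
    s * sqSum f₁ f₂ ε z ^ (s - 1) * (‖radD f₁ z‖ ^ 2 + ‖radD f₂ z‖ ^ 2)

lemma sq_mul_rpow_le_powDD {ε s : ℝ} (hε : 0 < ε) (hs : 0 < s) (z : En n) :
    min s (s ^ 2) * (sqSum f₁ f₂ ε z ^ (s - 1) * (‖radD f₁ z‖ ^ 2 + ‖radD f₂ z‖ ^ 2)) ≤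
      powDD f₁ f₂ ε s z ∧ powDD f₁ f₂ ε s z ≤
    max s (s ^ 2) * (sqSum f₁ f₂ ε z ^ (s - 1) * (‖radD f₁ z‖ ^ 2 + ‖radD f₂ z‖ ^ 2)) := by
  have hX := sqSum_pos (f₁ := f₁) (f₂ := f₂) hε z
  have hY := norm_sqSumD_sq_le (f₁ := f₁) (f₂ := f₂) hε.le z
  unfold powDD
  set X := sqSum f₁ f₂ ε z
  set T := ‖radD f₁ z‖ ^ 2 + ‖radD f₂ z‖ ^ 2
  have hT : 0 ≤ T := by positivity
  set Y := ‖sqSumD f₁ f₂ z‖ ^ 2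
  have hpow : X ^ (s - 1) = X ^ (s - 2) * X := by
    rw [← Real.rpow_add_one hX.ne']
    ring_nf
  have hle : X ^ (s - 2) * Y ≤ X ^ (s - 1) * T := by
    rw [hpow, mul_assoc]
    gcongr
  have hY0 : 0 ≤ X ^ (s - 2) * Y := by positivity
  have hT0 : 0 ≤ X ^ (s - 1) * T := by positivity
  generalize hP : X ^ (s - 1) * T = P at *
  generalize hQ : X ^ (s - 2) * Y = Q at *
  have e : s * (s - 1) * X ^ (s - 2) * Y + s * X ^ (s - 1) * T = s * (s - 1) * Q + s * P := by
    rw [← hP, ← hQ]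
    ring
  rw [e]
  rcases le_total s 1 with h | h
  · rw [min_eq_right (by nlinarith), max_eq_left (by nlinarith)]
    have h3 : 0 ≤ s * (1 - s) := mul_nonneg hs.le (by linarith)
    constructor <;> nlinarith [mul_le_mul_of_nonneg_left hle h3, mul_nonneg h3 hY0]
  · rw [min_eq_left (by nlinarith), max_eq_right (by nlinarith)]
    have h3 : 0 ≤ s * (s - 1) := mul_nonneg hs.le (by linarith)
    constructor <;> nlinarith [mul_le_mul_of_nonneg_left hle h3, mul_nonneg h3 hY0]

lemma hasSliceDeriv_rpow (h₁ : DifferentiableOn ℂ f₁ (Bn n)) (h₂ : DifferentiableOn ℂ f₂ (Bn n))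
    {ε : ℝ} (hε : 0 < ε) (s : ℝ) :
    HasSliceDeriv (fun z ↦ ((sqSum f₁ f₂ ε z ^ s : ℝ) : ℂ)) (powD f₁ f₂ ε s)
      (fun z ↦ (starRingEnd ℂ) (powD f₁ f₂ ε s z)) := by
  intro z hz τ
  have h := (hasDerivAt_sqSum_slice h₁ h₂ ε hz τ).rpow_const (p := s)
    (Or.inl (sqSum_pos hε _).ne')
  refine h.ofReal_comp.congr_deriv ?_
  simp only [Complex.ofReal_zero, zero_mul, Complex.exp_zero, one_smul, powD, map_mul,
    Complex.conj_ofReal]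
  have e : ((2 * (sqSumD f₁ f₂ z * τ).re : ℝ) : ℂ) =
      sqSumD f₁ f₂ z * τ + (starRingEnd ℂ) (sqSumD f₁ f₂ z) * (starRingEnd ℂ) τ := by
    rw [← map_mul, Complex.add_conj]
  rw [mul_assoc (_ * _ : ℝ), Complex.ofReal_mul, e]
  push_cast
  ring

lemma hasSliceDeriv_powD (h₁ : DifferentiableOn ℂ f₁ (Bn n)) (h₂ : DifferentiableOn ℂ f₂ (Bn n))
    {ε : ℝ} (hε : 0 < ε) (s : ℝ) :
    HasSliceDeriv (powD f₁ f₂ ε s)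
      (fun z ↦ (s * (s - 1) * sqSum f₁ f₂ ε z ^ (s - 2) : ℝ) * sqSumD f₁ f₂ z ^ 2 +
        (s * sqSum f₁ f₂ ε z ^ (s - 1) : ℝ) *
          ((starRingEnd ℂ) (f₁ z) * radD (radD f₁) z + (starRingEnd ℂ) (f₂ z) * radD (radD f₂) z))
      (fun z ↦ (powDD f₁ f₂ ε s z : ℂ)) := by
  intro z hz τ
  have h := ((hasDerivAt_sqSum_slice h₁ h₂ ε hz τ).rpow_const (p := s - 1)
    (Or.inl (sqSum_pos hε _).ne')).const_mul s |>.ofReal_comp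
  have key : ∀ {f : En n → ℂ}, DifferentiableOn ℂ f (Bn n) →
      HasDerivAt (fun t : ℝ ↦ (starRingEnd ℂ) (f (Complex.exp (t * τ) • z)) *
        radD f (Complex.exp (t * τ) • z))
        ((starRingEnd ℂ) (τ * radD f z) * radD f z +
          (starRingEnd ℂ) (f z) * (τ * radD (radD f) z)) 0 := by
    intro f hf
    have h3 := Complex.conjCLE.toContinuousLinearMap.hasFDerivAt.comp_hasDerivAt (0 : ℝ)
      (hasDerivAt_exp_slice hf hz τ)
    refine (h3.mul (hasDerivAt_exp_slice (differentiableOn_radD hf) hz τ)).congr_deriv ?_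
    simp
  refine (h.mul ((key h₁).fun_add (key h₂))).congr_deriv ?_
  have e : ((2 * (sqSumD f₁ f₂ z * τ).re : ℝ) : ℂ) =
      sqSumD f₁ f₂ z * τ + (starRingEnd ℂ) (sqSumD f₁ f₂ z) * (starRingEnd ℂ) τ := by
    rw [← map_mul, Complex.add_conj]
  have e2 : s - 1 - 1 = s - 2 := by ring
  have e3 : ∀ w : ℂ, ((‖w‖ ^ 2 : ℝ) : ℂ) = w * (starRingEnd ℂ) w := fun w ↦ by
    rw [Complex.mul_conj, Complex.normSq_eq_norm_sq]
  simp only [Complex.ofReal_zero, zero_mul, Complex.exp_zero, one_smul, powDD, e2]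
  have e4 : ((s * (2 * (sqSumD f₁ f₂ z * τ).re * (s - 1) * sqSum f₁ f₂ ε z ^ (s - 2)) : ℝ) : ℂ) =
      (s * (s - 1) * sqSum f₁ f₂ ε z ^ (s - 2) : ℝ) * (sqSumD f₁ f₂ z * τ +
        (starRingEnd ℂ) (sqSumD f₁ f₂ z) * (starRingEnd ℂ) τ) := by
    rw [← e]
    push_cast
    ring
  rw [e4, Complex.ofReal_add, Complex.ofReal_mul _ (‖sqSumD f₁ f₂ z‖ ^ 2),
    Complex.ofReal_mul _ (‖radD f₁ z‖ ^ 2 + ‖radD f₂ z‖ ^ 2), Complex.ofReal_add, e3, e3, e3]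
  rw [← sqSumD]
  simp only [map_mul]
  ring

variable [NeZero n]

/-- Green's formula for powers of `|f₁|² + |f₂|² + ε`. -/
lemma lintegral_sqSum_rpow (h₁ : DifferentiableOn ℂ f₁ (Bn n))
    (h₂ : DifferentiableOn ℂ f₂ (Bn n)) {ε s R : ℝ} (hε : 0 < ε) (hs : 0 < s)
    (hR : R ∈ Ioo (0 : ℝ) 1) :
    ∫⁻ ζ, ENNReal.ofReal (sqSum f₁ f₂ ε (R • ζ) ^ s) ∂sigmaS n =
      ENNReal.ofReal (sqSum f₁ f₂ ε 0 ^ s) +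
        ∫⁻ z, greenW n R z * ENNReal.ofReal (powDD f₁ f₂ ε s z) ∂volN n := by
  have hr₁ := differentiableOn_radD h₁
  have hr₂ := differentiableOn_radD h₂
  have c₁ := h₁.continuousOn
  have c₂ := h₂.continuousOn
  have cr₁ := hr₁.continuousOn
  have cr₂ := hr₂.continuousOn
  have crr₁ := (differentiableOn_radD hr₁).continuousOn
  have crr₂ := (differentiableOn_radD hr₂).continuousOn
  have hY : ContinuousOn (sqSumD f₁ f₂) (Bn n) := by
    have s₁ := Complex.continuous_conj.comp_continuousOn c₁
    have s₂ := Complex.continuous_conj.comp_continuousOn c₂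
    exact (s₁.mul cr₁).add (s₂.mul cr₂)
  have hpow := fun a ↦ continuousOn_sqSum_rpow c₁ c₂ hε a
  have hpowC : ∀ a b : ℝ,
      ContinuousOn (fun z ↦ ((b * sqSum f₁ f₂ ε z ^ a : ℝ) : ℂ)) (Bn n) := fun a b ↦
    Complex.continuous_ofReal.comp_continuousOn ((hpow a).const_smul b)
  have hA : ContinuousOn (powD f₁ f₂ ε s) (Bn n) := (hpowC _ _).mul hY
  obtain ⟨C, hC0, hC⟩ := exists_norm_le_of_continuousOn_Bn
    ((hpow (s - 1)).const_smul s) hR.2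
  obtain ⟨K₁, hK₁0, hK₁⟩ := exists_norm_le_of_continuousOn_Bn c₁ hR.2
  obtain ⟨K₂, hK₂0, hK₂⟩ := exists_norm_le_of_continuousOn_Bn c₂ hR.2
  obtain ⟨L₁, hL₁0, hL₁⟩ := exists_norm_le_mul_norm hr₁ (radD_zero _) hR.2
  obtain ⟨L₂, hL₂0, hL₂⟩ := exists_norm_le_mul_norm hr₂ (radD_zero _) hR.2
  refine lintegral_greenW_mul (hpow s) hA (Complex.continuous_conj.comp_continuousOn hA) ?_ ?_
    (hasSliceDeriv_rpow h₁ h₂ hε s) (hasSliceDeriv_powD h₁ h₂ hε s)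
    (fun z _ ↦ (Real.rpow_pos_of_pos (sqSum_pos hε z) _).le) (fun z _ ↦ ?_) hR
    (C := C * (K₁ * L₁ + K₂ * L₂)) ?_
  · have s₁ := Complex.continuous_conj.comp_continuousOn c₁
    have s₂ := Complex.continuous_conj.comp_continuousOn c₂
    exact ((hpowC _ _).mul (hY.pow 2)).add
      ((hpowC _ _).mul ((s₁.mul crr₁).add (s₂.mul crr₂)))
  · have := hpow (s - 1)
    have := hpow (s - 2)
    unfold powDD
    fun_prop
  · refine le_trans ?_ (sq_mul_rpow_le_powDD hε hs z).1
    have := sqSum_pos (f₁ := f₁) (f₂ := f₂) hε z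
    positivity
  · intro z hz
    have := hC z hz
    rw [powD, norm_mul, Complex.norm_real]
    calc _ ≤ C * (K₁ * (L₁ * ‖z‖) + K₂ * (L₂ * ‖z‖)) := by
          refine mul_le_mul (hC z hz) ((norm_add_le _ _).trans ?_) (norm_nonneg _) hC0
          rw [norm_mul, norm_mul, RCLike.norm_conj, RCLike.norm_conj]
          gcongr
          exacts [hK₁ z hz, hL₁ z hz, hK₂ z hz, hL₂ z hz]
      _ = _ := by ring

end GreenHolomorphic

section Means

variable {n : ℕ} {f f₁ f₂ : En n → ℂ}

lemma ENNReal_add_add_rpow_le (a b c : ℝ≥0∞) {s : ℝ} (hs : 0 < s) :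
    (a + b + c) ^ s ≤ 3 ^ s * (a ^ s + b ^ s + c ^ s) := by
  have h : ∃ m : ℝ≥0∞, a + b + c ≤ 3 * m ∧ m ^ s ≤ a ^ s + b ^ s + c ^ s := by
    refine ⟨max (max a b) c, ?_, ?_⟩
    · calc a + b + c ≤ max (max a b) c + max (max a b) c + max (max a b) c := by
            gcongr
            exacts [(le_max_left a b).trans (le_max_left _ _),
              (le_max_right a b).trans (le_max_left _ _), le_max_right _ _]
        _ = _ := by ring
    · rcases max_cases (max a b) c with ⟨h, -⟩ | ⟨h, -⟩
      · rcases max_cases a b with ⟨h', -⟩ | ⟨h', -⟩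
        · rw [h, h', add_assoc]; exact le_self_add
        · rw [h, h', add_right_comm]; exact le_add_self
      · rw [h]; exact le_add_self
  obtain ⟨m, h1, h2⟩ := h
  calc (a + b + c) ^ s ≤ (3 * m) ^ s := ENNReal.rpow_le_rpow h1 hs.le
    _ = 3 ^ s * m ^ s := ENNReal.mul_rpow_of_nonneg _ _ hs.le
    _ ≤ _ := by gcongr

lemma ofReal_sqSum {ε : ℝ} (hε : 0 < ε) (z : En n) :
    ENNReal.ofReal (sqSum f₁ f₂ ε z) = ‖f₁ z‖ₑ ^ 2 + ‖f₂ z‖ₑ ^ 2 + ENNReal.ofReal ε := by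
  unfold sqSum
  rw [ENNReal.ofReal_add (by positivity) hε.le, ENNReal.ofReal_add (by positivity) (by positivity),
    ENNReal.ofReal_pow (norm_nonneg _), ENNReal.ofReal_pow (norm_nonneg _), ofReal_norm, ofReal_norm]

lemma ofReal_sqSum_rpow_le {ε : ℝ} (hε : 0 < ε) {q : ℝ} (hq : 0 < q) (z : En n) :
    ENNReal.ofReal (sqSum f₁ f₂ ε z ^ (q / 2)) ≤
      3 ^ (q / 2) * (‖f₁ z‖ₑ ^ q + ‖f₂ z‖ₑ ^ q + ENNReal.ofReal ε ^ (q / 2)) := by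
  have e : ∀ a : ℝ≥0∞, (a ^ 2) ^ (q / 2) = a ^ q := fun a ↦ by
    rw [← ENNReal.rpow_natCast_mul]
    congr 1
    push_cast
    ring
  rw [← ENNReal.ofReal_rpow_of_pos (sqSum_pos hε z), ofReal_sqSum hε]
  refine (ENNReal_add_add_rpow_le _ _ _ (half_pos hq)).trans_eq ?_
  rw [e, e]

lemma enorm_rpow_le_ofReal_sqSum_rpow {ε : ℝ} (hε : 0 < ε) {q : ℝ} (hq : 0 < q) (z : En n) :
    ‖f₁ z‖ₑ ^ q ≤ ENNReal.ofReal (sqSum f₁ f₂ ε z ^ (q / 2)) := by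
  have e : ∀ a : ℝ≥0∞, a ^ q = (a ^ 2) ^ (q / 2) := fun a ↦ by
    rw [← ENNReal.rpow_natCast_mul]
    congr 1
    push_cast
    ring
  rw [← ENNReal.ofReal_rpow_of_pos (sqSum_pos hε z), ofReal_sqSum hε, e, add_assoc]
  exact ENNReal.rpow_le_rpow le_self_add (half_pos hq).le

/-- If `a ≤ b + K ε ^ s` for all positive `ε`, then `a ≤ b`. -/
lemma ENNReal_le_of_forall_ofReal_rpow {a b K : ℝ≥0∞} {s : ℝ} (hs : 0 < s) (hK : K ≠ ⊤)
    (h : ∀ ε : ℝ, 0 < ε → a ≤ b + K * ENNReal.ofReal ε ^ s) : a ≤ b := by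
  have h1 : Tendsto (fun ε : ℝ ↦ b + K * ENNReal.ofReal ε ^ s) (𝓝[>] 0) (𝓝 (b + K * 0 ^ s)) := by
    have h2 : Tendsto (fun ε : ℝ ↦ ENNReal.ofReal ε) (𝓝[>] 0) (𝓝 0) := by
      have := (ENNReal.continuous_ofReal.tendsto 0).mono_left (nhdsWithin_le_nhds (s := Ioi 0))
      simpa using this
    have h3 := ENNReal.Tendsto.const_mul (a := K)
      (((ENNReal.continuous_rpow_const (y := s)).tendsto 0).comp h2) (Or.inr hK)
    exact h3.const_add b
  rw [ENNReal.zero_rpow_of_pos hs, mul_zero, add_zero] at h1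
  exact ge_of_tendsto h1 (by filter_upwards [self_mem_nhdsWithin] with ε hε using h ε hε)

lemma greenW_mono {r R : ℝ} (hr : 0 < r) (hrR : r ≤ R) (z : En n) : greenW n r z ≤ greenW n R z := by
  unfold greenW
  rcases eq_or_ne z 0 with rfl | hz
  · simp
  have := norm_pos_iff.2 hz
  gcongr

variable [NeZero n]

lemma lintegral_ofReal_sqSum_rpow_le (h₁ : ContinuousOn f₁ (Bn n)) (_ : ContinuousOn f₂ (Bn n))
    {ε : ℝ} (hε : 0 < ε) {q : ℝ} (hq : 0 < q) {R : ℝ} (hR : R ∈ Ico (0 : ℝ) 1) :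
    ∫⁻ ζ, ENNReal.ofReal (sqSum f₁ f₂ ε (R • ζ) ^ (q / 2)) ∂sigmaS n ≤
      3 ^ (q / 2) * (∫⁻ ζ, ‖f₁ (R • ζ)‖ₑ ^ q ∂sigmaS n + ∫⁻ ζ, ‖f₂ (R • ζ)‖ₑ ^ q ∂sigmaS n +
        ENNReal.ofReal ε ^ (q / 2)) := by
  have hm : ∀ {f : En n → ℂ}, ContinuousOn f (Bn n) →
      AEMeasurable (fun ζ ↦ ‖f (R • ζ)‖ₑ ^ q) (sigmaS n) := fun hf ↦
    ((integrable_sigmaS_smul hf hR).aestronglyMeasurable.enorm).pow_const q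
  refine (lintegral_mono fun ζ ↦ ofReal_sqSum_rpow_le hε hq (R • ζ)).trans_eq ?_
  rw [lintegral_const_mul' _ _ (ENNReal.rpow_ne_top_of_nonneg (half_pos hq).le (by simp)),
    lintegral_add_right' _ aemeasurable_const, lintegral_add_left' (hm h₁), lintegral_const,
    measure_univ, mul_one]

lemma le_lintegral_sqSum_rpow (h₁ : DifferentiableOn ℂ f₁ (Bn n))
    (h₂ : DifferentiableOn ℂ f₂ (Bn n)) {ε s R : ℝ} (hε : 0 < ε) (hs : 0 < s)
    (hR : R ∈ Ioo (0 : ℝ) 1) :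
    ENNReal.ofReal (sqSum f₁ f₂ ε 0 ^ s) + ENNReal.ofReal (min s (s ^ 2)) *
      ∫⁻ z, greenW n R z * ENNReal.ofReal
        (sqSum f₁ f₂ ε z ^ (s - 1) * (‖radD f₁ z‖ ^ 2 + ‖radD f₂ z‖ ^ 2)) ∂volN n ≤
    ∫⁻ ζ, ENNReal.ofReal (sqSum f₁ f₂ ε (R • ζ) ^ s) ∂sigmaS n := by
  rw [lintegral_sqSum_rpow h₁ h₂ hε hs hR, ← lintegral_const_mul' _ _ ENNReal.ofReal_ne_top]
  refine add_le_add le_rfl (lintegral_mono fun z ↦ ?_)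
  rw [mul_left_comm, ← ENNReal.ofReal_mul (by positivity)]
  gcongr
  exact (sq_mul_rpow_le_powDD hε hs z).1

lemma lintegral_sqSum_rpow_le (h₁ : DifferentiableOn ℂ f₁ (Bn n))
    (h₂ : DifferentiableOn ℂ f₂ (Bn n)) {ε s R : ℝ} (hε : 0 < ε) (hs : 0 < s)
    (hR : R ∈ Ioo (0 : ℝ) 1) :
    ∫⁻ ζ, ENNReal.ofReal (sqSum f₁ f₂ ε (R • ζ) ^ s) ∂sigmaS n ≤
    ENNReal.ofReal (sqSum f₁ f₂ ε 0 ^ s) + ENNReal.ofReal (max s (s ^ 2)) *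
      ∫⁻ z, greenW n R z * ENNReal.ofReal
        (sqSum f₁ f₂ ε z ^ (s - 1) * (‖radD f₁ z‖ ^ 2 + ‖radD f₂ z‖ ^ 2)) ∂volN n := by
  rw [lintegral_sqSum_rpow h₁ h₂ hε hs hR, ← lintegral_const_mul' _ _ ENNReal.ofReal_ne_top]
  refine add_le_add le_rfl (lintegral_mono fun z ↦ ?_)
  rw [mul_left_comm, ← ENNReal.ofReal_mul (by positivity)]
  gcongr
  exact (sq_mul_rpow_le_powDD hε hs z).2

/-- The integral means of `|f|^q` increase with the radius, up to a constant. -/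
lemma lintegral_sphere_le (hf : DifferentiableOn ℂ f (Bn n)) {q : ℝ} (hq : 0 < q) {r R : ℝ}
    (hr : 0 < r) (hrR : r ≤ R) (hR : R < 1) :
    ∫⁻ ζ, ‖f (r • ζ)‖ₑ ^ q ∂sigmaS n ≤
      3 ^ (q / 2) * ∫⁻ ζ, ‖f (R • ζ)‖ₑ ^ q ∂sigmaS n := by
  have h0 : DifferentiableOn ℂ (fun _ : En n ↦ (0 : ℂ)) (Bn n) := differentiableOn_const 0
  refine ENNReal_le_of_forall_ofReal_rpow (half_pos hq) (K := 3 ^ (q / 2))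
    (ENNReal.rpow_ne_top_of_nonneg (half_pos hq).le (by simp)) fun ε hε ↦ ?_
  have h1 : ∫⁻ ζ, ENNReal.ofReal (sqSum f (fun _ ↦ 0) ε (r • ζ) ^ (q / 2)) ∂sigmaS n ≤
      ∫⁻ ζ, ENNReal.ofReal (sqSum f (fun _ ↦ 0) ε (R • ζ) ^ (q / 2)) ∂sigmaS n := by
    rw [lintegral_sqSum_rpow hf h0 hε (half_pos hq) ⟨hr, hrR.trans_lt hR⟩,
      lintegral_sqSum_rpow hf h0 hε (half_pos hq) ⟨hr.trans_le hrR, hR⟩]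
    gcongr with z
    exact greenW_mono hr hrR z
  refine (lintegral_mono fun ζ ↦ enorm_rpow_le_ofReal_sqSum_rpow hε hq (r • ζ)).trans (h1.trans ?_)
  refine (lintegral_ofReal_sqSum_rpow_le hf.continuousOn h0.continuousOn hε hq
    ⟨(hr.trans_le hrR).le, hR⟩).trans_eq ?_
  simp [ENNReal.zero_rpow_of_pos hq, mul_add]

lemma enorm_zero_rpow_le (hf : DifferentiableOn ℂ f (Bn n)) {q : ℝ} (hq : 0 < q) {R : ℝ}
    (hR : R ∈ Ioo (0 : ℝ) 1) :
    ‖f 0‖ₑ ^ q ≤ 3 ^ (q / 2) * ∫⁻ ζ, ‖f (R • ζ)‖ₑ ^ q ∂sigmaS n := by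
  have h0 : DifferentiableOn ℂ (fun _ : En n ↦ (0 : ℂ)) (Bn n) := differentiableOn_const 0
  refine ENNReal_le_of_forall_ofReal_rpow (half_pos hq) (K := 3 ^ (q / 2))
    (ENNReal.rpow_ne_top_of_nonneg (half_pos hq).le (by simp)) fun ε hε ↦ ?_
  refine (enorm_rpow_le_ofReal_sqSum_rpow hε hq 0).trans
    ((le_self_add.trans (le_lintegral_sqSum_rpow hf h0 hε (half_pos hq) hR)).trans ?_)
  refine (lintegral_ofReal_sqSum_rpow_le hf.continuousOn h0.continuousOn hε hq
    ⟨hR.1.le, hR.2⟩).trans_eq ?_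
  simp [ENNReal.zero_rpow_of_pos hq, mul_add]

end Means

section Automorphisms

variable {n : ℕ} {a w : En n}

lemma herm_eq_inner (z w : En n) : herm z w = inner ℂ w z := by
  simp [herm, PiLp.inner_apply]

lemma norm_herm_le (z w : En n) : ‖herm z w‖ ≤ ‖z‖ * ‖w‖ := by
  rw [herm_eq_inner, mul_comm]
  exact norm_inner_le_norm _ _

lemma norm_herm_lt_one {z w : En n} (hz : ‖z‖ ≤ 1) (hw : ‖w‖ < 1) : ‖herm z w‖ < 1 :=
  (norm_herm_le z w).trans_lt (by nlinarith [norm_nonneg z, norm_nonneg w])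

lemma one_sub_herm_ne_zero {z w : En n} (hz : ‖z‖ ≤ 1) (hw : ‖w‖ < 1) : 1 - herm z w ≠ 0 := by
  intro h
  have := norm_herm_lt_one hz hw
  rw [← sub_eq_zero.1 h, norm_one] at this
  exact lt_irrefl _ this

lemma herm_comm (z w : En n) : herm z w = (starRingEnd ℂ) (herm w z) := by
  rw [herm_eq_inner, herm_eq_inner, inner_conj_symm]

lemma herm_self (z : En n) : herm z z = (‖z‖ ^ 2 : ℝ) := by
  rw [herm_eq_inner, inner_self_eq_norm_sq_to_K]
  norm_cast

/-- `√(1 - |a|²)`. -/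
def autS (a : En n) : ℝ := Real.sqrt (1 - ‖a‖ ^ 2)

lemma autS_pos (ha : ‖a‖ < 1) : 0 < autS a :=
  Real.sqrt_pos.2 (by nlinarith [norm_nonneg a])

lemma autS_sq (ha : ‖a‖ < 1) : autS a ^ 2 = 1 - ‖a‖ ^ 2 :=
  Real.sq_sqrt (by nlinarith [norm_nonneg a])

/-- The self-adjoint operator equal to `1` on `ℂ a` and to `√(1 - |a|²)` on its complement. -/
def autOp (a : En n) : En n →L[ℂ] En n :=
  (autS a : ℂ) • ContinuousLinearMap.id ℂ (En n) +
    (((1 + autS a)⁻¹ : ℝ) : ℂ) • (innerSL ℂ a).smulRight a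

lemma autOp_apply (a w : En n) :
    autOp a w = (autS a : ℂ) • w + ((((1 + autS a)⁻¹ : ℝ) : ℂ) * herm w a) • a := by
  simp [autOp, herm_eq_inner, smul_smul]

/-- The involutive automorphism of the ball exchanging `0` and `a`. -/
def aut (a w : En n) : En n := (1 - herm w a)⁻¹ • (a - autOp a w)

lemma herm_sub_left (x y z : En n) : herm (x - y) z = herm x z - herm y z := by
  simp [herm_eq_inner]

lemma herm_add_left (x y z : En n) : herm (x + y) z = herm x z + herm y z := by
  simp [herm_eq_inner]

lemma herm_smul_left (c : ℂ) (x z : En n) : herm (c • x) z = c * herm x z := by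
  simp [herm_eq_inner]

lemma autOp_self (ha : ‖a‖ < 1) : autOp a a = a := by
  have h1 := autS_pos ha
  have h2 := autS_sq ha
  rw [autOp_apply, herm_self, ← add_smul]
  have : (autS a : ℂ) + ((1 + autS a)⁻¹ : ℝ) * (‖a‖ ^ 2 : ℝ) = 1 := by
    norm_cast
    field_simp
    nlinarith
  rw [this, one_smul]

lemma herm_autOp (ha : ‖a‖ < 1) (w : En n) : herm (autOp a w) a = herm w a := by
  have h1 := autS_pos ha
  have h2 := autS_sq ha
  rw [autOp_apply, herm_add_left, herm_smul_left, herm_smul_left, herm_self]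
  have : (autS a : ℂ) + ((1 + autS a)⁻¹ : ℝ) * (‖a‖ ^ 2 : ℝ) = 1 := by
    norm_cast
    field_simp
    nlinarith
  linear_combination herm w a * this

lemma autOp_autOp (ha : ‖a‖ < 1) (w : En n) :
    autOp a (autOp a w) = ((autS a ^ 2 : ℝ) : ℂ) • w + herm w a • a := by
  have h1 := autS_pos ha
  rw [autOp_apply a (autOp a w), herm_autOp ha, autOp_apply, smul_add, smul_smul, smul_smul,
    add_assoc, ← add_smul]
  congr 2
  · push_cast
    ring
  · have : ((autS a : ℂ) + 1) * ((1 + autS a)⁻¹ : ℝ) = 1 := by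
      norm_cast
      field_simp
      ring
    linear_combination herm w a * this

lemma one_sub_herm_aut (ha : ‖a‖ < 1) (hw : ‖w‖ ≤ 1) :
    1 - herm (aut a w) a = (autS a ^ 2 : ℝ) / (1 - herm w a) := by
  have h := one_sub_herm_ne_zero hw ha
  rw [aut, herm_smul_left, herm_sub_left, herm_autOp ha, herm_self, autS_sq ha]
  field_simp
  push_cast
  ring

lemma aut_aut (ha : ‖a‖ < 1) (hw : ‖w‖ ≤ 1) : aut a (aut a w) = w := by
  have h := one_sub_herm_ne_zero hw ha
  have h1 : ((autS a ^ 2 : ℝ) : ℂ) ≠ 0 := by exact_mod_cast (pow_pos (autS_pos ha) 2).ne'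
  rw [aut, one_sub_herm_aut ha hw, aut, map_smul, map_sub, autOp_self ha, autOp_autOp ha]
  have e : a - (1 - herm w a)⁻¹ • (a - (((autS a ^ 2 : ℝ) : ℂ) • w + herm w a • a)) =
      ((autS a ^ 2 : ℝ) / (1 - herm w a) : ℂ) • w := by
    rw [div_eq_inv_mul, ← smul_smul]
    nth_rw 1 [← inv_smul_smul₀ h a]
    rw [← smul_sub, sub_smul, one_smul]
    congr 1
    abel
  rw [e, smul_smul, inv_mul_cancel₀ (div_ne_zero h1 h), one_smul]

lemma one_sub_norm_aut_sq (ha : ‖a‖ < 1) (hw : ‖w‖ ≤ 1) :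
    1 - ‖aut a w‖ ^ 2 = (1 - ‖w‖ ^ 2) * ((1 - ‖a‖ ^ 2) / ‖1 - herm w a‖ ^ 2) := by
  have h := norm_ne_zero_iff.2 (one_sub_herm_ne_zero hw ha)
  have h1 : ‖autOp a w‖ ^ 2 = autS a ^ 2 * ‖w‖ ^ 2 + ‖herm w a‖ ^ 2 := by
    have e1 : herm (autOp a w) (autOp a w) = herm (autOp a (autOp a w)) w := by
      nth_rw 2 [autOp_apply]
      rw [autOp_apply a (autOp a w), herm_autOp ha, herm_comm _ (_ + _), herm_add_left,
        herm_add_left, herm_smul_left, herm_smul_left, herm_smul_left, herm_smul_left]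
      simp only [map_add, map_mul, Complex.conj_ofReal]
      rw [← herm_comm, herm_comm a (autOp a w), herm_autOp ha, ← herm_comm, herm_comm a w, Complex.conj_conj]
      ring
    rw [autOp_autOp ha, herm_add_left, herm_smul_left, herm_smul_left, herm_self, herm_self,
      herm_comm a w, Complex.mul_conj, Complex.normSq_eq_norm_sq] at e1
    exact_mod_cast e1
  have h2 : ‖a - autOp a w‖ ^ 2 = ‖a‖ ^ 2 - 2 * (herm w a).re + ‖autOp a w‖ ^ 2 := by
    rw [← herm_autOp ha w, herm_eq_inner]
    exact norm_sub_sq (𝕜 := ℂ) a (autOp a w)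
  have h3 : ‖1 - herm w a‖ ^ 2 = 1 - 2 * (herm w a).re + ‖herm w a‖ ^ 2 := by
    rw [← Complex.normSq_eq_norm_sq, ← Complex.normSq_eq_norm_sq, Complex.normSq_sub]
    simp
    ring
  rw [aut, norm_smul, norm_inv, mul_pow, h2, h1, autS_sq ha]
  field_simp
  rw [h3]
  ring

lemma aut_mem_Bn (ha : ‖a‖ < 1) (hw : w ∈ Bn n) : aut a w ∈ Bn n := by
  have hw' := mem_Bn.1 hw
  have h := norm_pos_iff.2 (one_sub_herm_ne_zero hw'.le ha)
  have h1 := one_sub_norm_aut_sq ha hw'.le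
  have h2 : 0 < (1 - ‖w‖ ^ 2) * ((1 - ‖a‖ ^ 2) / ‖1 - herm w a‖ ^ 2) := by
    have : 0 < 1 - ‖w‖ ^ 2 := by nlinarith [norm_nonneg w]
    have : 0 < 1 - ‖a‖ ^ 2 := by nlinarith [norm_nonneg a]
    positivity
  rw [mem_Bn]
  nlinarith [norm_nonneg (aut a w)]

lemma aut_zero (a : En n) : aut a 0 = a := by simp [aut, herm]

lemma image_aut (ha : ‖a‖ < 1) : aut a '' Bn n = Bn n := by
  refine Subset.antisymm (image_subset_iff.2 fun w hw ↦ aut_mem_Bn ha hw) fun w hw ↦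
    ⟨aut a w, aut_mem_Bn ha hw, aut_aut ha (mem_Bn.1 hw).le⟩

lemma injOn_aut (ha : ‖a‖ < 1) : InjOn (aut a) (Bn n) := fun x hx y hy h ↦ by
  rw [← aut_aut ha (mem_Bn.1 hx).le, h, aut_aut ha (mem_Bn.1 hy).le]

/-- The complex derivative of `aut a` at `w`. -/
def autD (a w : En n) : En n →L[ℂ] En n :=
  (1 - herm w a)⁻¹ • (-autOp a) + (((1 - herm w a) ^ 2)⁻¹ • innerSL ℂ a).smulRight (a - autOp a w)

lemma hasFDerivAt_aut (ha : ‖a‖ < 1) (hw : w ∈ Bn n) : HasFDerivAt (aut a) (autD a w) w := by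
  have h := one_sub_herm_ne_zero (mem_Bn.1 hw).le ha
  have h1 : HasFDerivAt (fun w : En n ↦ 1 - herm w a) (-innerSL ℂ a) w := by
    simp only [herm_eq_inner]
    exact ((innerSL ℂ a).hasFDerivAt (x := w)).const_sub 1
  have h2 : HasFDerivAt (fun w : En n ↦ (1 - herm w a)⁻¹)
      (((1 - herm w a) ^ 2)⁻¹ • innerSL ℂ a) w := by
    refine ((hasDerivAt_inv h).comp_hasFDerivAt w h1).congr_fderiv ?_
    simp
  have h3 : HasFDerivAt (fun w : En n ↦ a - autOp a w) (-autOp a) w :=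
    (autOp a).hasFDerivAt.const_sub a
  exact h2.smul h3

lemma det_autOp [NeZero n] (ha : ‖a‖ < 1) :
    (autOp a : En n →ₗ[ℂ] En n).det = (autS a : ℂ) ^ (n - 1) := by
  have h1 := autS_pos ha
  have h2 := autS_sq ha
  have h1' : (autS a : ℂ) ≠ 0 := by exact_mod_cast h1.ne'
  have h : (autOp a : En n →ₗ[ℂ] En n) = (autS a : ℂ) • LinearMap.transvection
      ((((autS a * (1 + autS a))⁻¹ : ℝ) : ℂ) • (innerSL ℂ a : En n →ₗ[ℂ] ℂ)) a := by
    ext1 v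
    simp only [LinearMap.smul_apply, LinearMap.transvection.apply, ContinuousLinearMap.coe_coe,
      autOp_apply, smul_add, smul_smul, innerSL_apply_apply, herm_eq_inner, smul_eq_mul]
    congr 2
    push_cast
    field_simp
  rw [h, LinearMap.det_smul, LinearMap.transvection.det, finrank_euclideanSpace_fin]
  obtain ⟨k, rfl⟩ : ∃ k, n = k + 1 := ⟨n - 1, by have := NeZero.pos n; omega⟩
  have e : (1 : ℂ) + ((((autS a * (1 + autS a))⁻¹ : ℝ) : ℂ) •
      (innerSL ℂ a : En (k + 1) →ₗ[ℂ] ℂ)) a = (autS a : ℂ)⁻¹ := by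
    simp only [LinearMap.smul_apply, ContinuousLinearMap.coe_coe, innerSL_apply_apply, smul_eq_mul,
      ← herm_eq_inner, herm_self]
    norm_cast
    field_simp
    nlinarith
  rw [e, add_tsub_cancel_right, pow_succ, mul_assoc, mul_inv_cancel₀ h1', mul_one]

lemma abs_det_autD [NeZero n] (ha : ‖a‖ < 1) (hw : w ∈ Bn n) :
    |((autD a w).restrictScalars ℝ).det| = ((1 - ‖a‖ ^ 2) / ‖1 - herm w a‖ ^ 2) ^ (n + 1) := by
  have h := one_sub_herm_ne_zero (mem_Bn.1 hw).le ha
  have hS := autS_pos ha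
  have e : (autD a w : En n →ₗ[ℂ] En n) = (-(1 - herm w a)⁻¹) • ((autOp a : En n →ₗ[ℂ] En n) ∘ₗ
      LinearMap.transvection ((-(1 - herm w a)⁻¹) • (innerSL ℂ a : En n →ₗ[ℂ] ℂ)) (a - w)) := by
    ext1 v
    rw [LinearMap.smul_apply, LinearMap.comp_apply, LinearMap.transvection.apply,
      LinearMap.smul_apply]
    simp only [ContinuousLinearMap.coe_coe, map_add, map_smul, map_sub, autOp_self ha, autD,
      add_apply, smul_apply, neg_apply, ContinuousLinearMap.smulRight_apply, smul_eq_mul]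
    generalize innerSL ℂ a v = c
    generalize (1 - herm w a) = d at *
    module
  have hdet : (autD a w : En n →ₗ[ℂ] En n).det =
      (-(1 - herm w a)⁻¹) ^ n * ((autS a : ℂ) ^ (n - 1) * ((autS a ^ 2 : ℝ) / (1 - herm w a))) := by
    rw [e, LinearMap.det_smul, LinearMap.det_comp, det_autOp ha, LinearMap.transvection.det,
      finrank_euclideanSpace_fin]
    congr 2
    simp only [LinearMap.smul_apply, ContinuousLinearMap.coe_coe, innerSL_apply_apply, smul_eq_mul,
      ← herm_eq_inner, herm_sub_left, herm_self, autS_sq ha]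
    field_simp
    push_cast
    ring
  have h1 : ((autD a w).restrictScalars ℝ).det =
      Complex.normSq (autD a w : En n →ₗ[ℂ] En n).det := by
    rw [← Algebra.norm_complex_apply, ← LinearMap.det_restrictScalars]
    rfl
  obtain ⟨k, rfl⟩ : ∃ k, n = k + 1 := ⟨n - 1, by have := NeZero.pos n; omega⟩
  rw [h1, abs_of_nonneg (Complex.normSq_nonneg _), hdet, Complex.normSq_eq_norm_sq, ← autS_sq ha]
  simp only [norm_mul, norm_pow, norm_neg, norm_inv, norm_div, Complex.norm_real,
    Real.norm_of_nonneg hS.le, add_tsub_cancel_right]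
  have := norm_ne_zero_iff.2 h
  simp only [div_pow, inv_pow]
  field_simp
  ring

/-- The change of variables `w = aut a u` in the ball. -/
lemma lintegral_volN_aut [NeZero n] (ha : ‖a‖ < 1) (φ : En n → ℝ≥0∞) :
    ∫⁻ w, φ w ∂volN n = ∫⁻ u, ENNReal.ofReal
      (((1 - ‖a‖ ^ 2) / ‖1 - herm u a‖ ^ 2) ^ (n + 1)) * φ (aut a u) ∂volN n := by
  rw [volN, lintegral_smul_measure, lintegral_smul_measure]
  congr 1
  have h := lintegral_image_eq_lintegral_abs_det_fderiv_mul (volume : Measure (En n))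
    (f' := fun w ↦ (autD a w).restrictScalars ℝ) isOpen_Bn.measurableSet
    (fun w hw ↦ ((hasFDerivAt_aut ha hw).restrictScalars ℝ).hasFDerivWithinAt) (injOn_aut ha) φ
  rw [image_aut ha] at h
  rw [h]
  refine setLIntegral_congr_fun isOpen_Bn.measurableSet fun w hw ↦ ?_
  rw [abs_det_autD ha hw]

end Automorphisms

section PoissonKernel

variable {n : ℕ}

lemma measurable_indicator_Bn_ennreal {φ : En n → ℝ≥0∞} (hφ : ContinuousOn φ (Bn n)) :
    Measurable ((Bn n).indicator φ) := by
  classical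
  rw [← Set.piecewise_eq_indicator]
  exact hφ.measurable_piecewise continuousOn_const isOpen_Bn.measurableSet

lemma continuousOn_enorm_rpow {f : En n → ℂ} (hf : ContinuousOn f (Bn n)) (q : ℝ) :
    ContinuousOn (fun z ↦ ‖f z‖ₑ ^ q) (Bn n) :=
  (ENNReal.continuous_rpow_const (y := q)).comp_continuousOn hf.enorm

/-- The density of the weight `(1 - |z|²)^(β-1)` in polar coordinates. -/
def radW (n : ℕ) (β r : ℝ) : ℝ≥0∞ := ENNReal.ofReal (2 * n * r ^ (2 * n - 1) * (1 - r ^ 2) ^ (β - 1))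

lemma measurable_radW (β : ℝ) : Measurable (radW n β) := by
  unfold radW
  fun_prop

lemma lintegral_weight_mul [NeZero n] {φ : En n → ℝ≥0∞} (hφ : Measurable ((Bn n).indicator φ))
    (β : ℝ) :
    ∫⁻ w, ENNReal.ofReal ((1 - ‖w‖ ^ 2) ^ (β - 1)) * φ w ∂volN n =
      ∫⁻ r in Ioo (0 : ℝ) 1, radW n β r * ∫⁻ ζ, φ (r • ζ) ∂sigmaS n := by
  have h1 : ∫⁻ w, ENNReal.ofReal ((1 - ‖w‖ ^ 2) ^ (β - 1)) * φ w ∂volN n =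
      ∫⁻ w, ENNReal.ofReal ((1 - ‖w‖ ^ 2) ^ (β - 1)) * (Bn n).indicator φ w ∂volN n := by
    refine lintegral_congr_ae ?_
    filter_upwards [ae_mem_Bn_volN] with w hw
    rw [indicator_of_mem hw]
  rw [h1, lintegral_volN_eq_lintegral_sigmaS (by fun_prop)]
  refine setLIntegral_congr_fun measurableSet_Ioo fun r hr ↦ ?_
  have hr2 : 0 ≤ 2 * n * r ^ (2 * n - 1) := by have := hr.1; positivity
  have h2 : ∫⁻ ζ, ENNReal.ofReal ((1 - ‖r • ζ‖ ^ 2) ^ (β - 1)) * (Bn n).indicator φ (r • ζ)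
      ∂sigmaS n = ENNReal.ofReal ((1 - r ^ 2) ^ (β - 1)) * ∫⁻ ζ, φ (r • ζ) ∂sigmaS n := by
    rw [← lintegral_const_mul' _ _ ENNReal.ofReal_ne_top]
    refine lintegral_congr_ae ?_
    filter_upwards [ae_norm_eq_one_sigmaS] with ζ hζ
    rw [indicator_of_mem (real_smul_mem_Bn_of_norm_eq_one ⟨hr.1.le, hr.2⟩ hζ),
      norm_real_smul_eq hr.1.le hζ]
  simp only [h2, radW]
  rw [ENNReal.ofReal_mul hr2, mul_assoc (ENNReal.ofReal _)]

lemma lintegral_two_mul_rpow {r₀ β : ℝ} (hr₀ : 0 ≤ r₀) (hr₀' : r₀ ≤ 1) (hβ : 0 < β) :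
    ∫⁻ r in Ioo r₀ 1, ENNReal.ofReal (2 * r * (1 - r ^ 2) ^ (β - 1)) =
      ENNReal.ofReal ((1 - r₀ ^ 2) ^ β / β) := by
  have hc : ContinuousOn (fun r : ℝ ↦ -((1 - r ^ 2) ^ β / β)) (Icc r₀ 1) :=
    (((continuous_const.sub (continuous_pow 2)).rpow_const fun _ ↦ Or.inr hβ.le).div_const
      _).neg.continuousOn
  have hd : ∀ r ∈ Ioo r₀ 1, HasDerivAt (fun r : ℝ ↦ -((1 - r ^ 2) ^ β / β))
      (2 * r * (1 - r ^ 2) ^ (β - 1)) r := by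
    intro r hr
    have hr1 : 0 < 1 - r ^ 2 := by nlinarith [hr.1, hr.2]
    have h1 : HasDerivAt (fun r : ℝ ↦ 1 - r ^ 2) (-(2 * r)) r := by
      simpa using (hasDerivAt_pow 2 r).const_sub 1
    refine (((h1.rpow_const (p := β) (Or.inl hr1.ne')).div_const β).neg).congr_deriv ?_
    field_simp
  have hpos : ∀ r ∈ Ioo r₀ 1, 0 ≤ 2 * r * (1 - r ^ 2) ^ (β - 1) := by
    intro r hr
    have hr1 : 0 < 1 - r ^ 2 := by nlinarith [hr.1, hr.2]
    have := hr₀.trans hr.1.le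
    positivity
  have hi := intervalIntegral.integrableOn_deriv_of_nonneg hc hd hpos
  have hI := intervalIntegral.integral_eq_sub_of_hasDerivAt_of_le hr₀' hc hd
    ((intervalIntegrable_iff_integrableOn_Ioc_of_le hr₀').2 hi)
  rw [intervalIntegral.integral_of_le hr₀', integral_Ioc_eq_integral_Ioo] at hI
  rw [← ofReal_integral_eq_lintegral_ofReal (hi.mono_set Ioo_subset_Ioc_self)
    ((ae_restrict_mem measurableSet_Ioo).mono hpos), hI]
  simp [Real.zero_rpow hβ.ne']

lemma lintegral_radW_le [NeZero n] {β : ℝ} (hβ : 0 < β) :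
    ∫⁻ r in Ioo (0 : ℝ) 1, radW n β r ≤ ENNReal.ofReal (n / β) := by
  have h := lintegral_two_mul_rpow le_rfl zero_le_one hβ
  calc ∫⁻ r in Ioo (0 : ℝ) 1, radW n β r
      ≤ ∫⁻ r in Ioo (0 : ℝ) 1, ENNReal.ofReal n *
          ENNReal.ofReal (2 * r * (1 - r ^ 2) ^ (β - 1)) := by
        refine setLIntegral_mono' measurableSet_Ioo fun r hr ↦ ?_
        rw [radW, ← ENNReal.ofReal_mul (by positivity)]
        refine ENNReal.ofReal_le_ofReal ?_
        have h1 : 0 < 1 - r ^ 2 := by nlinarith [hr.1, hr.2]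
        have h2 : r ^ (2 * n - 1) ≤ r := by
          have := NeZero.pos n
          exact (pow_le_pow_of_le_one hr.1.le hr.2.le (by omega)).trans_eq (pow_one r)
        calc 2 * n * r ^ (2 * n - 1) * (1 - r ^ 2) ^ (β - 1)
            ≤ 2 * n * r * (1 - r ^ 2) ^ (β - 1) := by gcongr
          _ = _ := by ring
    _ = _ := by
        rw [lintegral_const_mul' _ _ ENNReal.ofReal_ne_top, h, ← ENNReal.ofReal_mul (by positivity)]
        congr 1
        simp
        ring

lemma le_lintegral_radW [NeZero n] {r₀ β : ℝ} (hr₀ : 0 ≤ r₀) (hr₀' : r₀ ≤ 1) (hβ : 0 < β) :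
    ENNReal.ofReal (n * (r₀ ^ 2) ^ (n - 1) * ((1 - r₀ ^ 2) ^ β / β)) ≤
      ∫⁻ r in Ioo r₀ 1, radW n β r := by
  rw [ENNReal.ofReal_mul (by positivity), ← lintegral_two_mul_rpow hr₀ hr₀' hβ,
    ← lintegral_const_mul' _ _ ENNReal.ofReal_ne_top]
  refine setLIntegral_mono' measurableSet_Ioo fun r hr ↦ ?_
  rw [radW, ← ENNReal.ofReal_mul (by positivity)]
  refine ENNReal.ofReal_le_ofReal ?_
  have hr0 : 0 ≤ r := hr₀.trans hr.1.le
  have h1 : 0 < 1 - r ^ 2 := by nlinarith [hr.1, hr.2]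
  have h2 : (r₀ ^ 2) ^ (n - 1) * r ≤ r ^ (2 * n - 1) := by
    have e : 2 * n - 1 = 2 * (n - 1) + 1 := by have := NeZero.pos n; omega
    rw [e, pow_succ _ (2 * (n - 1)), pow_mul r]
    have := hr.1.le
    gcongr
  calc n * (r₀ ^ 2) ^ (n - 1) * (2 * r * (1 - r ^ 2) ^ (β - 1))
      = 2 * n * ((r₀ ^ 2) ^ (n - 1) * r) * (1 - r ^ 2) ^ (β - 1) := by ring
    _ ≤ _ := by gcongr

lemma exists_rpow_le_two {K : ℝ} (hK : 1 ≤ K) : ∃ β : ℝ, 0 < β ∧ K ^ β ≤ 2 := by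
  have hl := Real.log_nonneg hK
  refine ⟨Real.log 2 / (Real.log K + 1), div_pos (Real.log_pos one_lt_two) (by linarith), ?_⟩
  rw [Real.rpow_def_of_pos (by linarith), ← Real.le_log_iff_exp_le two_pos]
  rw [mul_div_assoc', div_le_iff₀ (by linarith)]
  nlinarith [Real.log_pos one_lt_two]

/-- The ratio `(1 - |aut a u|²) / (1 - |u|²)`. -/
def autK (a u : En n) : ℝ := (1 - ‖a‖ ^ 2) / ‖1 - herm u a‖ ^ 2

variable {a : En n}

lemma autK_bounds (ha : ‖a‖ < 1) {u : En n} (hu : ‖u‖ ≤ 1) :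
    (4 / (1 - ‖a‖) ^ 2)⁻¹ ≤ autK a u ∧ autK a u ≤ 4 / (1 - ‖a‖) ^ 2 := by
  have h0 := norm_nonneg a
  have h1 : ‖herm u a‖ ≤ ‖a‖ := (norm_herm_le u a).trans (by nlinarith)
  have h2 : ‖1 - herm u a‖ ≤ 2 := (norm_sub_le _ _).trans (by rw [norm_one]; linarith)
  have h3 : 1 - ‖a‖ ≤ ‖1 - herm u a‖ := by
    have := norm_sub_norm_le (1 : ℂ) (herm u a)
    rw [norm_one] at this
    linarith
  have h4 : 0 < 1 - ‖a‖ := by linarith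
  have h5 : 0 < ‖1 - herm u a‖ := h4.trans_le h3
  rw [autK, inv_div]
  constructor
  · rw [div_le_div_iff₀ (by norm_num) (by positivity)]
    have : ‖1 - herm u a‖ ^ 2 ≤ 4 := by nlinarith
    have : (1 - ‖a‖) ^ 2 ≤ 1 - ‖a‖ ^ 2 := by nlinarith
    nlinarith [sq_nonneg (1 - ‖a‖)]
  · have : (1 - ‖a‖) ^ 2 ≤ ‖1 - herm u a‖ ^ 2 := by gcongr
    gcongr
    nlinarith

lemma autK_pos (ha : ‖a‖ < 1) {u : En n} (hu : ‖u‖ ≤ 1) : 0 < autK a u :=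
  have : 0 < 1 - ‖a‖ := by linarith
  lt_of_lt_of_le (by positivity) (autK_bounds ha hu).1

lemma autK_rpow_bounds (ha : ‖a‖ < 1) {β : ℝ} (hβ : 0 < β) (h : (4 / (1 - ‖a‖) ^ 2) ^ β ≤ 2)
    {u : En n} (hu : ‖u‖ ≤ 1) : 1 / 2 ≤ autK a u ^ β ∧ autK a u ^ β ≤ 2 := by
  have h0 : 0 < 4 / (1 - ‖a‖) ^ 2 := by
    have : 0 < 1 - ‖a‖ := by linarith
    positivity
  obtain ⟨h1, h2⟩ := autK_bounds ha hu
  refine ⟨?_, (Real.rpow_le_rpow (autK_pos ha hu).le h2 hβ.le).trans h⟩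
  refine le_trans ?_ (Real.rpow_le_rpow (inv_nonneg.2 h0.le) h1 hβ.le)
  rw [Real.inv_rpow h0.le, one_div]
  exact inv_anti₀ (by positivity) h

lemma lintegral_weight_aut [NeZero n] (ha : ‖a‖ < 1) (β : ℝ) (G : En n → ℝ≥0∞) :
    ∫⁻ w, ENNReal.ofReal ((1 - ‖w‖ ^ 2) ^ (β - 1)) * G (aut a w) ∂volN n =
      ∫⁻ u, ENNReal.ofReal ((1 - ‖u‖ ^ 2) ^ (β - 1)) *
        (ENNReal.ofReal (autK a u ^ n * autK a u ^ β) * G u) ∂volN n := by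
  rw [lintegral_volN_aut ha]
  refine lintegral_congr_ae ?_
  filter_upwards [ae_mem_Bn_volN] with u hu
  have hu' := (mem_Bn.1 hu)
  have hk := autK_pos ha hu'.le
  have hu2 : 0 < 1 - ‖u‖ ^ 2 := by nlinarith [norm_nonneg u]
  rw [aut_aut ha hu'.le, one_sub_norm_aut_sq ha hu'.le, ← mul_assoc, ← mul_assoc]
  change ENNReal.ofReal (autK a u ^ (n + 1)) *
    ENNReal.ofReal (((1 - ‖u‖ ^ 2) * autK a u) ^ (β - 1)) * G u = _
  rw [← ENNReal.ofReal_mul (by positivity), ← ENNReal.ofReal_mul (by positivity),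
    Real.mul_rpow hu2.le hk.le, Real.rpow_sub_one hk.ne']
  congr 2
  field_simp
  ring

end PoissonKernel

section PoissonBounds

variable {n : ℕ} {a b : En n} {f : En n → ℂ}

/-- The holomorphic function `(1 - ⟨v, b⟩)^c`. -/
def powK (b : En n) (c : ℝ) (v : En n) : ℂ := (1 - herm v b) ^ (c : ℂ)

lemma norm_powK (b : En n) (c : ℝ) (v : En n) : ‖powK b c v‖ = ‖1 - herm v b‖ ^ c :=
  Complex.norm_cpow_real _ _

lemma differentiableOn_powK (hb : ‖b‖ ≤ 1) (c : ℝ) : DifferentiableOn ℂ (powK b c) (Bn n) := by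
  refine DifferentiableOn.cpow_const ?_ fun v hv ↦ ?_
  · simp only [herm_eq_inner]
    exact ((innerSL ℂ b).differentiable.const_sub 1).differentiableOn
  · have h1 : ‖herm v b‖ < 1 := (norm_herm_le v b).trans_lt (by
      nlinarith [norm_nonneg v, norm_nonneg b, mem_Bn.1 hv])
    refine Or.inl ?_
    have h2 := (Complex.abs_re_le_norm (herm v b)).trans_lt h1
    rw [Complex.sub_re, Complex.one_re]
    linarith [(abs_lt.1 h2).2]

lemma enorm_powK_rpow (ha : ‖a‖ < 1) {u : En n} (hu : ‖u‖ ≤ 1) {q : ℝ} (hq : 0 < q) {v : En n}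
    (h : herm v b = herm u a) :
    ENNReal.ofReal ((1 - ‖a‖ ^ 2) ^ n) * ‖powK b (-(2 * n / q)) v‖ₑ ^ q =
      ENNReal.ofReal (autK a u ^ n) := by
  have h1 : 0 < 1 - ‖a‖ ^ 2 := by nlinarith [norm_nonneg a]
  have h2 := norm_pos_iff.2 (one_sub_herm_ne_zero hu ha)
  rw [← ofReal_norm, ENNReal.ofReal_rpow_of_nonneg (norm_nonneg _) hq.le, norm_powK, h,
    ← ENNReal.ofReal_mul (by positivity), ← Real.rpow_mul (norm_nonneg _)]
  have e : -(2 * n / q) * q = -((2 * n : ℕ) : ℝ) := by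
    push_cast
    field_simp
  rw [e, Real.rpow_neg h2.le, Real.rpow_natCast, autK, div_pow, pow_mul, div_eq_mul_inv]

variable [NeZero n]

/-- A weighted form of the monotonicity of integral means. -/
lemma lintegral_autK_mul_le (hf : DifferentiableOn ℂ f (Bn n)) {q : ℝ} (hq : 0 < q) {ρ : ℝ}
    (hρ : ρ < 1) (ha : ‖a‖ < ρ) {r : ℝ} (hr : r ∈ Ioo (0 : ℝ) 1) :
    ∫⁻ ζ, ENNReal.ofReal (autK a (r • ζ) ^ n) * ‖f (ρ • r • ζ)‖ₑ ^ q ∂sigmaS n ≤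
      3 ^ (q / 2) * ∫⁻ ζ, ENNReal.ofReal (autK a ζ ^ n) * ‖f (ρ • ζ)‖ₑ ^ q ∂sigmaS n := by
  have hρ0 : 0 < ρ := (norm_nonneg a).trans_lt ha
  have ha1 : ‖a‖ < 1 := ha.trans hρ
  set b : En n := (ρ⁻¹ : ℝ) • a with hb
  have hb1 : ‖b‖ ≤ 1 := by
    rw [hb, norm_smul, Real.norm_of_nonneg (inv_nonneg.2 hρ0.le), inv_mul_le_iff₀ hρ0]
    linarith
  have hH := hf.mul (differentiableOn_powK hb1 (-(2 * n / q)))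
  have hherm (u : En n) : herm (ρ • u) b = herm u a := by
    rw [herm_eq_inner, herm_eq_inner, hb, ← Complex.coe_smul, ← Complex.coe_smul, inner_smul_left,
      inner_smul_right, Complex.conj_ofReal, ← mul_assoc]
    norm_cast
    rw [inv_mul_cancel₀ hρ0.ne']
    simp
  have key : ∀ t : ℝ, 0 < t → t ≤ 1 →
      ∫⁻ ζ, ENNReal.ofReal (autK a (t • ζ) ^ n) * ‖f (ρ • t • ζ)‖ₑ ^ q ∂sigmaS n =
      ENNReal.ofReal ((1 - ‖a‖ ^ 2) ^ n) *
        ∫⁻ ζ, ‖(f * powK b (-(2 * n / q))) ((ρ * t) • ζ)‖ₑ ^ q ∂sigmaS n := by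
    intro t ht0 ht1
    rw [← lintegral_const_mul' _ _ ENNReal.ofReal_ne_top]
    refine lintegral_congr_ae ?_
    filter_upwards [ae_norm_eq_one_sigmaS] with ζ hζ
    rw [← enorm_powK_rpow ha1 (u := t • ζ) ((norm_real_smul_eq ht0.le hζ).le.trans ht1) hq (hherm _),
      Pi.mul_apply, enorm_mul, ENNReal.mul_rpow_of_nonneg _ _ hq.le, smul_smul]
    ring
  have h1 := key 1 one_pos le_rfl
  simp only [one_smul, mul_one] at h1
  rw [key r hr.1 hr.2.le, h1, mul_left_comm]
  gcongr
  exact lintegral_sphere_le hH hq (mul_pos hρ0 hr.1) (by nlinarith [hr.2]) hρ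

lemma two_mul_ofReal (x : ℝ) : 2 * ENNReal.ofReal x = ENNReal.ofReal (2 * x) := by
  rw [ENNReal.ofReal_mul zero_le_two, ENNReal.ofReal_ofNat]

lemma ofReal_mul_le_two_mul {c x : ℝ} (hx : 0 ≤ x) (hc : c ≤ 2) :
    ENNReal.ofReal (x * c) ≤ 2 * ENNReal.ofReal x := by
  rw [two_mul_ofReal]
  exact ENNReal.ofReal_le_ofReal (by nlinarith)

/-- `|f|^q` is dominated by a multiple of its invariant Poisson integral. -/
lemma enorm_rpow_le_poisson (hf : DifferentiableOn ℂ f (Bn n)) {q : ℝ} (hq : 0 < q) {ρ : ℝ}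
    (hρ : ρ < 1) (ha : ‖a‖ < ρ) :
    ‖f (ρ • a)‖ₑ ^ q ≤ 3 ^ (q / 2) * (2 * (3 ^ (q / 2) *
      ∫⁻ ζ, ENNReal.ofReal (autK a ζ ^ n) * ‖f (ρ • ζ)‖ₑ ^ q ∂sigmaS n)) := by
  have hρ0 : 0 < ρ := (norm_nonneg a).trans_lt ha
  have ha1 : ‖a‖ < 1 := ha.trans hρ
  have h3 : (3 : ℝ≥0∞) ^ (q / 2) ≠ ⊤ := ENNReal.rpow_ne_top_of_nonneg (half_pos hq).le (by simp)
  obtain ⟨β, hβ, hKβ⟩ := exists_rpow_le_two (K := 4 / (1 - ‖a‖) ^ 2) (by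
    rw [one_le_div (by nlinarith)]
    nlinarith [norm_nonneg a])
  set W := ∫⁻ r in Ioo (0 : ℝ) 1, radW n β r with hW
  have hWtop : W ≠ ⊤ := ((lintegral_radW_le hβ).trans_lt ENNReal.ofReal_lt_top).ne
  have hW0 : W ≠ 0 := by
    have h := le_lintegral_radW (n := n) (r₀ := 1 / 2) (by norm_num) (by norm_num) hβ
    have h' : 0 < W := by
      refine (ENNReal.ofReal_pos.2 ?_).trans_le
        (h.trans (lintegral_mono_set (Ioo_subset_Ioo_left (by norm_num))))
      have := NeZero.pos n
      have : (0 : ℝ) < 1 - (1 / 2) ^ 2 := by norm_num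
      positivity
    exact h'.ne'
  set Ψ := ∫⁻ ζ, ENNReal.ofReal (autK a ζ ^ n) * ‖f (ρ • ζ)‖ₑ ^ q ∂sigmaS n with hΨ
  have hmap : MapsTo (fun u : En n ↦ ρ • u) (Bn n) (Bn n) :=
    fun u hu ↦ real_smul_mem_Bn hu ⟨hρ0.le, hρ.le⟩
  have hfρ : DifferentiableOn ℂ (fun u ↦ f (ρ • u)) (Bn n) :=
    hf.comp (by fun_prop) hmap
  have hh : DifferentiableOn ℂ (fun w ↦ f (ρ • aut a w)) (Bn n) :=
    hfρ.comp (fun w hw ↦ (hasFDerivAt_aut ha1 hw).differentiableAt.differentiableWithinAt)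
      fun w hw ↦ aut_mem_Bn ha1 hw
  have hk : ContinuousOn (fun u ↦ autK a u ^ n) (Bn n) := by
    unfold autK
    simp only [herm_eq_inner]
    refine (continuousOn_const.div (by fun_prop) fun u hu ↦ ?_).pow n
    have := one_sub_herm_ne_zero (mem_Bn.1 hu).le ha1
    rw [herm_eq_inner] at this
    exact pow_ne_zero _ (norm_ne_zero_iff.2 this)
  have step1 : W * ‖f (ρ • a)‖ₑ ^ q ≤ 3 ^ (q / 2) *
      ∫⁻ w, ENNReal.ofReal ((1 - ‖w‖ ^ 2) ^ (β - 1)) * ‖f (ρ • aut a w)‖ₑ ^ q ∂volN n := by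
    rw [lintegral_weight_mul (measurable_indicator_Bn_ennreal (continuousOn_enorm_rpow
      hh.continuousOn q)), ← lintegral_const_mul' _ _ h3, hW,
      ← lintegral_mul_const _ (measurable_radW β)]
    refine setLIntegral_mono' measurableSet_Ioo fun r hr ↦ ?_
    rw [mul_left_comm]
    gcongr
    simpa only [aut_zero] using enorm_zero_rpow_le hh hq hr
  have step2 : ∫⁻ w, ENNReal.ofReal ((1 - ‖w‖ ^ 2) ^ (β - 1)) * ‖f (ρ • aut a w)‖ₑ ^ q ∂volN n ≤
      W * (2 * (3 ^ (q / 2) * Ψ)) := by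
    rw [lintegral_weight_aut ha1 β fun u ↦ ‖f (ρ • u)‖ₑ ^ q]
    have hle : ∫⁻ u, ENNReal.ofReal ((1 - ‖u‖ ^ 2) ^ (β - 1)) *
        (ENNReal.ofReal (autK a u ^ n * autK a u ^ β) * ‖f (ρ • u)‖ₑ ^ q) ∂volN n ≤
        2 * ∫⁻ u, ENNReal.ofReal ((1 - ‖u‖ ^ 2) ^ (β - 1)) *
          (ENNReal.ofReal (autK a u ^ n) * ‖f (ρ • u)‖ₑ ^ q) ∂volN n := by
      rw [← lintegral_const_mul' _ _ (by simp)]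
      refine lintegral_mono_ae ?_
      filter_upwards [ae_mem_Bn_volN] with u hu
      rw [mul_left_comm 2, ← mul_assoc 2]
      gcongr
      exact ofReal_mul_le_two_mul (pow_nonneg (autK_pos ha1 (mem_Bn.1 hu).le).le n)
        (autK_rpow_bounds ha1 hβ hKβ (mem_Bn.1 hu).le).2
    refine hle.trans ?_
    have hmeas : Measurable ((Bn n).indicator fun u ↦
        ENNReal.ofReal (autK a u ^ n) * ‖f (ρ • u)‖ₑ ^ q) := by
      rw [Set.indicator_mul]
      exact (measurable_indicator_Bn_ennreal (ENNReal.continuous_ofReal.comp_continuousOn hk)).mul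
        (measurable_indicator_Bn_ennreal (continuousOn_enorm_rpow hfρ.continuousOn q))
    rw [lintegral_weight_mul hmeas, mul_left_comm, hW, ← lintegral_mul_const _ (measurable_radW β)]
    gcongr 2 * ?_
    refine setLIntegral_mono' measurableSet_Ioo fun r hr ↦ ?_
    gcongr
    exact lintegral_autK_mul_le hf hq hρ ha hr
  have := step1.trans (mul_le_mul_right step2 _)
  rw [mul_left_comm] at this
  exact (ENNReal.mul_le_mul_iff_right hW0 hWtop).1 this

/-- Integral means of the Poisson kernel are bounded. -/
lemma lintegral_autK_smul_le (ha : ‖a‖ < 1) {r₀ : ℝ} (hr₀ : 0 < r₀) (hr₀' : r₀ < 1)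
    (hr₂ : 1 / 2 ≤ r₀ ^ 2) :
    ∫⁻ ζ, ENNReal.ofReal (autK a (r₀ • ζ) ^ n) ∂sigmaS n ≤ ENNReal.ofReal (6 * 2 ^ n) := by
  have h1a : 0 < 1 - ‖a‖ := by linarith
  have h1r : 0 < 1 - r₀ ^ 2 := by nlinarith
  have hK1 : 1 ≤ 4 / (1 - ‖a‖) ^ 2 := by
    rw [one_le_div (by positivity)]
    nlinarith [norm_nonneg a]
  obtain ⟨β, hβ, hKβ⟩ := exists_rpow_le_two (K := 4 / (1 - ‖a‖) ^ 2 + (1 - r₀ ^ 2)⁻¹)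
    (hK1.trans (by simpa using h1r.le))
  have hKβ1 : (4 / (1 - ‖a‖) ^ 2) ^ β ≤ 2 :=
    (Real.rpow_le_rpow (by positivity) (by simpa using h1r.le) hβ.le).trans hKβ
  have hKβ2 : 1 / 2 ≤ (1 - r₀ ^ 2) ^ β := by
    have := (Real.rpow_le_rpow (inv_nonneg.2 h1r.le)
      (le_add_of_nonneg_left (zero_le_one.trans hK1)) hβ.le).trans hKβ
    rw [Real.inv_rpow h1r.le] at this
    rw [one_div]
    exact inv_le_of_inv_le₀ (by positivity) this
  set ψ := fun r : ℝ ↦ ∫⁻ ζ, ENNReal.ofReal (autK a (r • ζ) ^ n) ∂sigmaS n with hψ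
  have hmono : ∀ r ∈ Ioo r₀ 1, ψ r₀ ≤ 3 * ψ r := by
    intro r hr
    have key : ∀ t : ℝ, 0 < t → t < 1 → ψ t = ENNReal.ofReal ((1 - ‖a‖ ^ 2) ^ n) *
        ∫⁻ ζ, ‖powK a (-(2 * n / (2 : ℝ))) (t • ζ)‖ₑ ^ (2 : ℝ) ∂sigmaS n := by
      intro t ht0 ht1
      rw [← lintegral_const_mul' _ _ ENNReal.ofReal_ne_top, hψ]
      refine lintegral_congr_ae ?_
      filter_upwards [ae_norm_eq_one_sigmaS] with ζ hζ
      rw [enorm_powK_rpow ha ((norm_real_smul_eq ht0.le hζ).le.trans ht1.le) two_pos rfl]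
    rw [key _ hr₀ hr₀', key _ (hr₀.trans hr.1) hr.2, mul_left_comm]
    gcongr
    have := lintegral_sphere_le (differentiableOn_powK ha.le (-(2 * n / (2 : ℝ)))) two_pos hr₀
      hr.1.le hr.2
    simpa using this
  have hk : ContinuousOn (fun u ↦ autK a u ^ n * autK a u ^ β) (Bn n) := by
    have hk1 : ContinuousOn (fun u ↦ autK a u) (Bn n) := by
      unfold autK
      simp only [herm_eq_inner]
      refine continuousOn_const.div (by fun_prop) fun u hu ↦ ?_
      have := one_sub_herm_ne_zero (mem_Bn.1 hu).le ha
      rw [herm_eq_inner] at this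
      exact pow_ne_zero _ (norm_ne_zero_iff.2 this)
    exact (hk1.pow n).mul (hk1.rpow_const fun _ _ ↦ Or.inr hβ.le)
  have hk' : Measurable ((Bn n).indicator fun u ↦ ENNReal.ofReal (autK a u ^ n * autK a u ^ β)) :=
    measurable_indicator_Bn_ennreal (ENNReal.continuous_ofReal.comp_continuousOn hk)
  have hW := lintegral_weight_aut ha β fun _ ↦ 1
  rw [lintegral_weight_mul (by simpa using measurable_const.indicator isOpen_Bn.measurableSet),
    lintegral_weight_mul (by simpa only [mul_one] using hk')] at hW
  simp only [lintegral_const, measure_univ, mul_one] at hW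
  have hlow : (∫⁻ r in Ioo r₀ 1, radW n β r) * ψ r₀ ≤ 6 * ENNReal.ofReal (n / β) := by
    rw [← lintegral_mul_const _ (measurable_radW β)]
    refine le_trans ?_ (mul_le_mul_right (hW.symm.le.trans (lintegral_radW_le hβ)) 6)
    rw [← lintegral_const_mul' _ _ (by simp)]
    refine (setLIntegral_mono' measurableSet_Ioo fun r hr ↦ ?_).trans
      (lintegral_mono_set (Ioo_subset_Ioo_left hr₀.le))
    rw [mul_left_comm]
    gcongr
    refine (hmono r hr).trans ?_
    rw [show (6 : ℝ≥0∞) = 3 * 2 by norm_num, mul_assoc]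
    gcongr
    rw [← lintegral_const_mul' _ _ (by simp)]
    refine lintegral_mono_ae ?_
    filter_upwards [ae_norm_eq_one_sigmaS] with ζ hζ
    have hr' : r ∈ Ico (0 : ℝ) 1 := ⟨hr₀.le.trans hr.1.le, hr.2⟩
    have hm := (mem_Bn.1 (real_smul_mem_Bn_of_norm_eq_one hr' hζ)).le
    rw [two_mul_ofReal]
    refine ENNReal.ofReal_le_ofReal ?_
    nlinarith [(autK_rpow_bounds ha hβ hKβ1 hm).1, pow_pos (autK_pos ha hm) n]
  have hn := NeZero.pos n
  have hlow2 : ENNReal.ofReal (n / β) * (ENNReal.ofReal ((1 / 2) ^ n) * ψ r₀) ≤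
      ENNReal.ofReal (n / β) * 6 := by
    rw [← mul_assoc, ← ENNReal.ofReal_mul (by positivity), mul_comm _ (6 : ℝ≥0∞)]
    refine (mul_le_mul_left ((ENNReal.ofReal_le_ofReal ?_).trans
      (le_lintegral_radW hr₀.le hr₀'.le hβ)) _).trans hlow
    have e1 : ((1 : ℝ) / 2) ^ n = (1 / 2) ^ (n - 1) * (1 / 2) := by
      rw [← pow_succ]
      congr 1
      omega
    calc (n : ℝ) / β * (1 / 2) ^ n = n * (1 / 2) ^ (n - 1) * ((1 / 2) / β) := by
          rw [e1]
          ring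
      _ ≤ _ := by gcongr
  have h6 := (ENNReal.mul_le_mul_iff_right (ENNReal.ofReal_pos.2 (by positivity)).ne'
    ENNReal.ofReal_ne_top).1 hlow2
  calc ψ r₀ = ENNReal.ofReal (2 ^ n) * (ENNReal.ofReal ((1 / 2) ^ n) * ψ r₀) := by
        rw [← mul_assoc, ← ENNReal.ofReal_mul (by positivity), ← mul_pow]
        norm_num
    _ ≤ ENNReal.ofReal (2 ^ n) * 6 := by gcongr
    _ = _ := by
        rw [ENNReal.ofReal_mul (by norm_num), mul_comm]
        norm_num

/-- The Poisson kernel has bounded integral over the sphere. -/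
lemma lintegral_poisson_le {z : En n} (hz : ‖z‖ < 1) :
    ∫⁻ ζ, ENNReal.ofReal (autK z ζ ^ n) ∂sigmaS n ≤ ENNReal.ofReal (6 * 4 ^ n) := by
  set t := ‖z‖ ^ 2 with ht
  have ht0 : 0 ≤ t := sq_nonneg _
  have ht1 : t < 1 := by nlinarith [norm_nonneg z]
  set r₀ := Real.sqrt ((1 + t) / 2) with hr
  have hr2 : r₀ ^ 2 = (1 + t) / 2 := Real.sq_sqrt (by linarith)
  have hr0 : 0 < r₀ := Real.sqrt_pos.2 (by linarith)
  have hr1 : r₀ < 1 := by nlinarith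
  set a : En n := (r₀⁻¹ : ℝ) • z with ha
  have ha2 : ‖a‖ ^ 2 = t / r₀ ^ 2 := by
    rw [ha, norm_smul, Real.norm_of_nonneg (inv_nonneg.2 hr0.le), mul_pow, ← ht, inv_pow]
    field_simp
  have ha3 : t / r₀ ^ 2 ≤ (1 + t) / 2 := by
    rw [hr2, div_le_iff₀ (by linarith)]
    nlinarith [sq_nonneg (1 - t)]
  have ha1 : ‖a‖ < 1 := by nlinarith [norm_nonneg a]
  have hherm (ζ : En n) : herm (r₀ • ζ) a = herm ζ z := by
    rw [herm_eq_inner, herm_eq_inner, ha, ← Complex.coe_smul, ← Complex.coe_smul, inner_smul_left,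
      inner_smul_right, Complex.conj_ofReal, ← mul_assoc]
    norm_cast
    rw [inv_mul_cancel₀ hr0.ne']
    simp
  calc ∫⁻ ζ, ENNReal.ofReal (autK z ζ ^ n) ∂sigmaS n
      ≤ ∫⁻ ζ, ENNReal.ofReal (2 ^ n) * ENNReal.ofReal (autK a (r₀ • ζ) ^ n) ∂sigmaS n := by
        refine lintegral_mono fun ζ ↦ ?_
        rw [← ENNReal.ofReal_mul (by positivity), ← mul_pow]
        refine ENNReal.ofReal_le_ofReal ?_
        rw [autK, autK, hherm, ← mul_div_assoc]
        have : 0 ≤ 1 - ‖z‖ ^ 2 := by linarith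
        gcongr
        rw [ha2]
        linarith
    _ ≤ ENNReal.ofReal (2 ^ n) * ENNReal.ofReal (6 * 2 ^ n) := by
        rw [lintegral_const_mul' _ _ ENNReal.ofReal_ne_top]
        gcongr
        exact lintegral_autK_smul_le ha1 hr0 hr1 (by linarith)
    _ = _ := by
        rw [← ENNReal.ofReal_mul (by positivity), mul_left_comm, ← mul_pow]
        norm_num

end PoissonBounds

section WeakType

variable {n : ℕ}

lemma norm_one_sub_herm_comm (z w : En n) : ‖1 - herm z w‖ = ‖1 - herm w z‖ := by
  rw [herm_comm z w, ← Complex.norm_conj (1 - herm w z)]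
  simp

/-- The quasi-triangle inequality for `|1 - ⟨z, w⟩|`. -/
lemma norm_one_sub_herm_le {z η ζ : En n} (hz : ‖z‖ ≤ 1) (hη : ‖η‖ ≤ 1) (hζ : ‖ζ‖ = 1) :
    ‖1 - herm z η‖ ≤ 2 * (‖1 - herm z ζ‖ + ‖1 - herm ζ η‖) := by
  set α := herm z ζ with hα
  set β := herm ζ η with hβ
  have hβ' : herm η ζ = starRingEnd ℂ β := herm_comm _ _
  have hα1 : ‖α‖ ≤ 1 := (norm_herm_le z ζ).trans (by rw [hζ, mul_one]; exact hz)
  have hβ1 : ‖β‖ ≤ 1 := (norm_herm_le ζ η).trans (by rw [hζ, one_mul]; exact hη)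
  have hζζ : herm ζ ζ = 1 := by simp [herm_self, hζ]
  have key : ∀ x : En n, ‖x‖ ≤ 1 → ‖x - herm x ζ • ζ‖ ^ 2 ≤ 2 * ‖1 - herm x ζ‖ := by
    intro x hx
    have h1 : ‖x - herm x ζ • ζ‖ ^ 2 = ‖x‖ ^ 2 - ‖herm x ζ‖ ^ 2 := by
      have h2 := norm_sub_sq (𝕜 := ℂ) x (herm x ζ • ζ)
      have h3 : RCLike.re (inner ℂ x (herm x ζ • ζ)) = ‖herm x ζ‖ ^ 2 := by
        rw [inner_smul_right, ← herm_eq_inner, herm_comm ζ x, Complex.mul_conj,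
          Complex.normSq_eq_norm_sq]
        exact Complex.ofReal_re _
      rw [h2, h3, norm_smul, hζ]
      ring
    have h4 : ‖herm x ζ‖ ≤ 1 := (norm_herm_le x ζ).trans (by rw [hζ, mul_one]; exact hx)
    have h5 := norm_sub_norm_le (1 : ℂ) (herm x ζ)
    rw [norm_one] at h5
    rw [h1]
    nlinarith [norm_nonneg x, norm_nonneg (herm x ζ)]
  have hinner : herm z η = α * β + herm (z - α • ζ) (η - herm η ζ • ζ) := by
    rw [hβ', herm_sub_left, herm_smul_left, herm_comm z (_ - _), herm_comm ζ (_ - _),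
      herm_sub_left, herm_sub_left, herm_smul_left, herm_smul_left, map_sub, map_sub, map_mul,
      map_mul, Complex.conj_conj, ← herm_comm, ← herm_comm, ← herm_comm, ← herm_comm, hζζ]
    ring
  have h1 := key z hz
  have h2 := key η hη
  rw [norm_one_sub_herm_comm η ζ] at h2
  have h3 := norm_herm_le (z - α • ζ) (η - herm η ζ • ζ)
  have h4 : ‖1 - α * β‖ ≤ ‖1 - α‖ + ‖1 - β‖ := by
    calc ‖1 - α * β‖ = ‖(1 - α) + α * (1 - β)‖ := by ring_nf
      _ ≤ ‖1 - α‖ + ‖α‖ * ‖1 - β‖ := (norm_add_le _ _).trans (by rw [norm_mul])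
      _ ≤ _ := by nlinarith [norm_nonneg (1 - β)]
  have h5 : ‖1 - herm z η‖ ≤ ‖1 - α * β‖ + ‖z - α • ζ‖ * ‖η - herm η ζ • ζ‖ := by
    calc ‖1 - herm z η‖ = ‖(1 - α * β) - herm (z - α • ζ) (η - herm η ζ • ζ)‖ := by
          rw [hinner]
          ring_nf
      _ ≤ _ := (norm_sub_le _ _).trans (by gcongr)
  nlinarith [sq_nonneg (‖z - α • ζ‖ - ‖η - herm η ζ • ζ‖)]

/-- The nonisotropic ball on the sphere. -/
def korQ (z : En n) (ρ : ℝ) : Set (En n) := {ζ ∈ Sn n | ‖1 - herm ζ z‖ < ρ}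

lemma measurableSet_korQ (z : En n) (ρ : ℝ) : MeasurableSet (korQ z ρ) := by
  have h : Continuous fun ζ : En n ↦ ‖1 - herm ζ z‖ := by
    simp only [herm_eq_inner]
    fun_prop
  exact isClosed_sphere.measurableSet.inter (isOpen_lt h continuous_const).measurableSet

lemma ofReal_autK_pow_le_tsum {z ζ : En n} (hz : ‖z‖ < 1) (hζ : ‖ζ‖ = 1) :
    ENNReal.ofReal (autK z ζ ^ n) ≤ ∑' k : ℕ, (korQ z (2 ^ (k + 1) * (1 - ‖z‖))).indicator
      (fun _ ↦ ENNReal.ofReal ((2 / (4 ^ k * (1 - ‖z‖))) ^ n)) ζ := by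
  have hd : 0 < 1 - ‖z‖ := by linarith
  have h1 : ‖herm ζ z‖ ≤ ‖z‖ := (norm_herm_le ζ z).trans_eq (by rw [hζ, one_mul])
  have h2 : 1 - ‖z‖ ≤ ‖1 - herm ζ z‖ := by
    have := norm_sub_norm_le (1 : ℂ) (herm ζ z)
    rw [norm_one] at this
    linarith
  obtain ⟨k, hk1, hk2⟩ := exists_nat_pow_near ((one_le_div hd).2 h2) one_lt_two
  rw [le_div_iff₀ hd] at hk1
  rw [div_lt_iff₀ hd] at hk2
  refine le_trans ?_ (ENNReal.le_tsum k)
  have hmem : ζ ∈ korQ z (2 ^ (k + 1) * (1 - ‖z‖)) := ⟨mem_sphere_zero_iff_norm.2 hζ, hk2⟩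
  rw [indicator_of_mem hmem]
  refine ENNReal.ofReal_le_ofReal (pow_le_pow_left₀ (autK_pos hz hζ.le).le ?_ n)
  rw [autK]
  calc (1 - ‖z‖ ^ 2) / ‖1 - herm ζ z‖ ^ 2 ≤ (2 * (1 - ‖z‖)) / (2 ^ k * (1 - ‖z‖)) ^ 2 := by
        gcongr
        nlinarith [norm_nonneg z]
    _ = _ := by
        rw [mul_pow, ← pow_mul, mul_comm k 2, pow_mul]
        field_simp
        norm_num

/-- Where the Poisson integral of `u` is large, some average of `u` is large. -/
lemma exists_lt_setLIntegral_korQ [NeZero n] {z : En n} (hz : ‖z‖ < 1) {u : En n → ℝ≥0∞}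
    (hu : Measurable u) {l : ℝ} (hl : 0 < l)
    (h : ENNReal.ofReal l < ∫⁻ ζ, ENNReal.ofReal (autK z ζ ^ n) * u ζ ∂sigmaS n) :
    ∃ ρ : ℝ, 2 * (1 - ‖z‖) ≤ ρ ∧
      ENNReal.ofReal (l / (2 * 4 ^ n) * ρ ^ n) < ∫⁻ ζ in korQ z ρ, u ζ ∂sigmaS n := by
  by_contra! hc
  have hd : 0 < 1 - ‖z‖ := by linarith
  refine h.not_ge ?_
  calc ∫⁻ ζ, ENNReal.ofReal (autK z ζ ^ n) * u ζ ∂sigmaS n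
      ≤ ∫⁻ ζ, ∑' k : ℕ, ENNReal.ofReal ((2 / (4 ^ k * (1 - ‖z‖))) ^ n) *
          (korQ z (2 ^ (k + 1) * (1 - ‖z‖))).indicator u ζ ∂sigmaS n := by
        refine lintegral_mono_ae ?_
        filter_upwards [ae_norm_eq_one_sigmaS] with ζ hζ
        refine (mul_le_mul_left (ofReal_autK_pow_le_tsum hz hζ) _).trans_eq ?_
        rw [← ENNReal.tsum_mul_right]
        refine tsum_congr fun k ↦ ?_
        by_cases hm : ζ ∈ korQ z (2 ^ (k + 1) * (1 - ‖z‖)) <;> simp [hm]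
    _ = ∑' k : ℕ, ENNReal.ofReal ((2 / (4 ^ k * (1 - ‖z‖))) ^ n) *
          ∫⁻ ζ in korQ z (2 ^ (k + 1) * (1 - ‖z‖)), u ζ ∂sigmaS n := by
        rw [lintegral_tsum fun k ↦
          ((hu.indicator (measurableSet_korQ _ _)).const_mul _).aemeasurable]
        refine tsum_congr fun k ↦ ?_
        rw [lintegral_const_mul' _ _ ENNReal.ofReal_ne_top,
          lintegral_indicator (measurableSet_korQ _ _)]
    _ ≤ ∑' k : ℕ, ENNReal.ofReal (l / 2 * (1 / 2) ^ k) := by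
        refine ENNReal.tsum_le_tsum fun k ↦ ?_
        refine (mul_le_mul_right (hc (2 ^ (k + 1) * (1 - ‖z‖)) ?_) _).trans ?_
        · have : (1 : ℝ) ≤ 2 ^ k := one_le_pow₀ one_le_two
          rw [pow_succ]
          nlinarith
        rw [← ENNReal.ofReal_mul (by positivity)]
        refine ENNReal.ofReal_le_ofReal ?_
        have e : (2 / (4 ^ k * (1 - ‖z‖))) ^ n * (l / (2 * 4 ^ n) * (2 ^ (k + 1) * (1 - ‖z‖)) ^ n) =
            l / 2 * ((1 / 2) ^ k) ^ n := by
          have e1 : (1 / 2 : ℝ) ^ k = 2 / (4 ^ k * (1 - ‖z‖)) * (2 ^ (k + 1) * (1 - ‖z‖)) / 4 := by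
            rw [show (4 : ℝ) = 2 ^ 2 by norm_num, ← pow_mul, one_div, inv_pow]
            field_simp
            ring
          rw [e1]
          generalize 2 / (4 ^ k * (1 - ‖z‖)) = x
          generalize 2 ^ (k + 1) * (1 - ‖z‖) = y
          rw [div_pow, mul_pow]
          ring
        rw [e]
        have h1 : ((1 / 2 : ℝ) ^ k) ^ n ≤ (1 / 2) ^ k :=
          pow_le_of_le_one (by positivity) (pow_le_one₀ (by norm_num) (by norm_num)) (NeZero.ne n)
        gcongr
    _ = ENNReal.ofReal l := by
        rw [← ENNReal.ofReal_tsum_of_nonneg (fun k ↦ by positivity)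
          (summable_geometric_two.mul_left _), tsum_mul_left, tsum_geometric_two]
        congr 1
        ring

lemma exists_norm_eq_one_norm_sub [NeZero n] {w : En n} (hw : ‖w‖ ≤ 1) :
    ∃ η : En n, ‖η‖ = 1 ∧ ‖w - η‖ ≤ 1 - ‖w‖ := by
  by_cases h : w = 0
  · exact ⟨EuclideanSpace.single 0 1, by simp, by simp [h]⟩
  · have h0 : 0 < ‖w‖ := norm_pos_iff.2 h
    refine ⟨(‖w‖⁻¹ : ℝ) • w, by rw [norm_smul, norm_inv, norm_norm, inv_mul_cancel₀ h0.ne'], ?_⟩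
    have e : w - (‖w‖⁻¹ : ℝ) • w = (1 - ‖w‖⁻¹) • w := by rw [sub_smul, one_smul]
    rw [e, norm_smul, Real.norm_eq_abs, abs_of_nonpos (by simpa using (one_le_inv₀ h0).2 hw)]
    field_simp
    linarith

/-- The weak type inequality for the Poisson integral and a Carleson measure. -/
lemma measure_poisson_gt_le [NeZero n] {ν : Measure (En n)} {N : ℝ≥0∞}
    (hν : ∀ ζ ∈ Sn n, ∀ δ : ℝ, 0 < δ → ν (cBox ζ δ) ≤ N * ENNReal.ofReal (δ ^ n))
    {u : En n → ℝ≥0∞} (hu : Measurable u) (hfin : ∫⁻ ζ, u ζ ∂sigmaS n ≠ ⊤) {l : ℝ} (hl : 0 < l) :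
    ν {z ∈ Bn n | ENNReal.ofReal l < ∫⁻ ζ, ENNReal.ofReal (autK z ζ ^ n) * u ζ ∂sigmaS n} ≤
      N * ENNReal.ofReal (7 ^ n * (2 * 4 ^ n) / l) * ∫⁻ ζ, u ζ ∂sigmaS n := by
  set E := {z ∈ Bn n | ENNReal.ofReal l < ∫⁻ ζ, ENNReal.ofReal (autK z ζ ^ n) * u ζ ∂sigmaS n}
  set τ := l / (2 * 4 ^ n) with hτ
  have hτ0 : 0 < τ := by positivity
  have hex : ∀ z : En n, ∃ ρ : ℝ, z ∈ E → 2 * (1 - ‖z‖) ≤ ρ ∧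
      ENNReal.ofReal (τ * ρ ^ n) < ∫⁻ ζ in korQ z ρ, u ζ ∂sigmaS n := by
    intro z
    by_cases hz : z ∈ E
    · obtain ⟨ρ, h⟩ := exists_lt_setLIntegral_korQ (mem_Bn.1 hz.1) hu hl hz.2
      exact ⟨ρ, fun _ ↦ h⟩
    · exact ⟨0, fun h ↦ (hz h).elim⟩
  choose ρ hρ using hex
  have hd : ∀ z ∈ E, 0 < 1 - ‖z‖ := fun z hz ↦ by linarith [mem_Bn.1 hz.1]
  have hρ0 : ∀ z ∈ E, 0 < ρ z := fun z hz ↦ by linarith [(hρ z hz).1, hd z hz]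
  have hρR : ∀ z ∈ E, ρ z ≤ max 1 ((∫⁻ ζ, u ζ ∂sigmaS n).toReal / τ) := by
    intro z hz
    by_contra! hc
    have h1 : ρ z ≤ ρ z ^ n := le_self_pow₀ ((le_max_left _ _).trans hc.le) (NeZero.ne n)
    have h2 := ((hρ z hz).2.trans_le (setLIntegral_le_lintegral _ _))
    rw [ENNReal.ofReal_lt_iff_lt_toReal (by have := hρ0 z hz; positivity) hfin] at h2
    have h3 := (le_max_right _ _).trans hc.le
    rw [div_le_iff₀ hτ0] at h3
    nlinarith
  have hne : ∀ z ∈ E, (korQ z (ρ z)).Nonempty := by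
    intro z hz
    by_contra hc
    have := (hρ z hz).2
    rw [not_nonempty_iff_eq_empty.1 hc] at this
    simp at this
  obtain ⟨T, hTE, hTd, hT⟩ := Vitali.exists_disjoint_subfamily_covering_enlargement
    (fun z ↦ korQ z (ρ z)) E ρ 2 one_lt_two (fun z hz ↦ (hρ0 z hz).le) _ hρR hne
  have hη : ∀ w : En n, ∃ η : En n, w ∈ E → ‖η‖ = 1 ∧ ‖w - η‖ ≤ 1 - ‖w‖ := by
    intro w
    by_cases hw : w ∈ E
    · obtain ⟨η, h⟩ := exists_norm_eq_one_norm_sub (mem_Bn.1 hw.1).le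
      exact ⟨η, fun _ ↦ h⟩
    · exact ⟨0, fun h ↦ (hw h).elim⟩
  choose η hη using hη
  have hcover : E ⊆ ⋃ w ∈ T, cBox (η w) (7 * ρ w) := by
    intro z hz
    obtain ⟨w, hwT, ⟨ζ, hζz, hζw⟩, hzw⟩ := hT z hz
    have hwE := hTE hwT
    obtain ⟨h1, h2⟩ := hη w hwE
    refine mem_iUnion₂.2 ⟨w, hwT, hz.1, ?_⟩
    have hζ : ‖ζ‖ = 1 := mem_sphere_zero_iff_norm.1 hζz.1
    refine (norm_one_sub_herm_le (mem_Bn.1 hz.1).le h1.le hζ).trans_lt ?_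
    have h3 : ‖1 - herm z ζ‖ < ρ z := by
      rw [norm_one_sub_herm_comm]
      exact hζz.2
    have h4 : ‖1 - herm ζ (η w)‖ ≤ ‖1 - herm ζ w‖ + ‖w - η w‖ := by
      have e : 1 - herm ζ (η w) = (1 - herm ζ w) + herm ζ (w - η w) := by
        rw [herm_comm ζ (w - η w), herm_sub_left, map_sub, ← herm_comm, ← herm_comm]
        ring
      rw [e]
      refine (norm_add_le _ _).trans ?_
      have := norm_herm_le ζ (w - η w)
      rw [hζ, one_mul] at this
      gcongr
    have h5 : ‖1 - herm ζ w‖ < ρ w := hζw.2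
    have h6 := (hρ w hwE).1
    linarith
  set κ := (sigmaS n).withDensity u with hκ
  have : IsFiniteMeasure κ := isFiniteMeasure_withDensity hfin
  have hκQ : ∀ w, κ (korQ w (ρ w)) = ∫⁻ ζ in korQ w (ρ w), u ζ ∂sigmaS n := fun w ↦
    withDensity_apply _ (measurableSet_korQ _ _)
  have hTd' : Pairwise (Function.onFun Disjoint fun w : T ↦ korQ (w : En n) (ρ w)) :=
    fun x y hxy ↦ hTd x.2 y.2 (Subtype.coe_injective.ne hxy)
  have hTc : T.Countable := by
    have := Measure.countable_meas_pos_of_disjoint_iUnion (μ := κ)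
      (As := fun w : T ↦ korQ (w : En n) (ρ w)) (fun w ↦ measurableSet_korQ _ _) hTd'
    refine countable_coe_iff.1 (countable_univ_iff.1 (this.mono fun w _ ↦ ?_))
    change 0 < κ _
    rw [hκQ]
    exact (zero_le).trans_lt (hρ w (hTE w.2)).2
  have := hTc.to_subtype
  calc ν E ≤ ν (⋃ w ∈ T, cBox (η w) (7 * ρ w)) := measure_mono hcover
    _ ≤ ∑' w : T, ν (cBox (η w) (7 * ρ w)) := measure_biUnion_le _ hTc _
    _ ≤ ∑' w : T, N * ENNReal.ofReal (7 ^ n * (2 * 4 ^ n) / l) * κ (korQ (w : En n) (ρ w)) := by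
        refine ENNReal.tsum_le_tsum fun w ↦ ?_
        have hwE := hTE w.2
        refine (hν _ (mem_sphere_zero_iff_norm.2 (hη w hwE).1) _
          (mul_pos (by norm_num) (hρ0 w hwE))).trans ?_
        rw [mul_assoc]
        gcongr
        rw [hκQ]
        refine le_trans ?_ (mul_le_mul_right (hρ w hwE).2.le _)
        rw [← ENNReal.ofReal_mul (by positivity)]
        refine ENNReal.ofReal_le_ofReal (le_of_eq ?_)
        rw [hτ, mul_pow]
        field_simp
    _ = N * ENNReal.ofReal (7 ^ n * (2 * 4 ^ n) / l) * κ (⋃ w : T, korQ (w : En n) (ρ w)) := by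
        rw [ENNReal.tsum_mul_left, measure_iUnion hTd' fun w ↦ measurableSet_korQ _ _]
    _ ≤ _ := by
        gcongr
        refine (measure_mono (subset_univ _)).trans_eq ?_
        rw [hκ, withDensity_apply _ MeasurableSet.univ, Measure.restrict_univ]

end WeakType

section CarlesonEmbedding

variable {n : ℕ} {f : En n → ℂ}

/-- The `q`-th power of the Hardy space quasinorm. -/
def hMean (n : ℕ) (q : ℝ) (f : En n → ℂ) : ℝ≥0∞ :=
  ⨆ r ∈ Ioo (0 : ℝ) 1, ∫⁻ ζ, ‖f (r • ζ)‖ₑ ^ q ∂sigmaS n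

lemma hNorm_eq (n : ℕ) (q : ℝ) (f : En n → ℂ) : hNorm n q f = hMean n q f ^ (1 / q) := rfl

lemma le_hMean {q r : ℝ} (hr : r ∈ Ioo (0 : ℝ) 1) :
    ∫⁻ ζ, ‖f (r • ζ)‖ₑ ^ q ∂sigmaS n ≤ hMean n q f :=
  le_iSup₂ (f := fun r (_ : r ∈ Ioo (0 : ℝ) 1) ↦ ∫⁻ ζ, ‖f (r • ζ)‖ₑ ^ q ∂sigmaS n) r hr

lemma volume_setOf_lt_le {c : ℝ} (hc : 0 < c) (x : ℝ≥0∞) :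
    (volume.restrict (Ioi 0)) {t : ℝ | ENNReal.ofReal (c * t) < x} ≤ ENNReal.ofReal c⁻¹ * x := by
  rcases eq_or_ne x ⊤ with rfl | hx
  · rw [ENNReal.mul_top (ENNReal.ofReal_pos.2 (inv_pos.2 hc)).ne']
    exact le_top
  rw [Measure.restrict_apply (measurableSet_lt (by fun_prop) measurable_const)]
  have hsub : {t : ℝ | ENNReal.ofReal (c * t) < x} ∩ Ioi 0 ⊆ Ioo 0 (c⁻¹ * x.toReal) := by
    rintro t ⟨h1, h2⟩
    have h2' : 0 < t := h2
    have h3 : c * t < x.toReal := (ENNReal.ofReal_lt_iff_lt_toReal (by positivity) hx).1 h1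
    exact ⟨h2, by rwa [inv_mul_eq_div, lt_div_iff₀' hc]⟩
  refine (measure_mono hsub).trans ?_
  rw [Real.volume_Ioo, sub_zero, ENNReal.ofReal_mul (inv_nonneg.2 hc.le), ENNReal.ofReal_toReal hx]

variable [NeZero n]

/-- The strong type inequality deduced from the weak type inequality by truncation. -/
lemma lintegral_sq_le_of_poisson_le {ν : Measure (En n)} {N : ℝ≥0∞}
    (hν : ∀ ζ ∈ Sn n, ∀ δ : ℝ, 0 < δ → ν (cBox ζ δ) ≤ N * ENNReal.ofReal (δ ^ n))
    {u : En n → ℝ≥0∞} (hu : Measurable u) (hfin : ∫⁻ ζ, u ζ ∂sigmaS n ≠ ⊤)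
    {F : En n → ℝ} (hF : Measurable F) (hF0 : ∀ z, 0 ≤ F z) {A : Set (En n)}
    (hAB : A ⊆ Bn n) {D : ℝ} (hD : 0 < D)
    (h : ∀ z ∈ A, ENNReal.ofReal (F z) ≤ ENNReal.ofReal D *
      ∫⁻ ζ, ENNReal.ofReal (autK z ζ ^ n) * u ζ ∂sigmaS n) :
    ∫⁻ z in A, ENNReal.ofReal (F z ^ (2 : ℝ)) ∂ν ≤
      ENNReal.ofReal (8 * D ^ 2 * (7 ^ n * (2 * 4 ^ n)) * (6 * 4 ^ n)) * N *
        ∫⁻ ζ, u ζ ^ 2 ∂sigmaS n := by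
  set CP : ℝ := 6 * 4 ^ n with hCP
  set CW : ℝ := 7 ^ n * (2 * 4 ^ n) with hCW
  have hCP0 : 0 < CP := by positivity
  have hCW0 : 0 < CW := by positivity
  set c : ℝ := (2 * D * CP)⁻¹ with hc
  have hc0 : 0 < c := by positivity
  set v : ℝ → En n → ℝ≥0∞ := fun t ↦ {ζ | ENNReal.ofReal (c * t) < u ζ}.indicator u with hv
  have hset : ∀ t : ℝ, MeasurableSet {ζ | ENNReal.ofReal (c * t) < u ζ} := fun t ↦
    measurableSet_lt measurable_const hu
  have hvm : ∀ t, Measurable (v t) := fun t ↦ hu.indicator (hset t)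
  have hvfin : ∀ t, ∫⁻ ζ, v t ζ ∂sigmaS n ≠ ⊤ := fun t ↦
    ((lintegral_mono fun ζ ↦ indicator_le_self _ _ ζ).trans_lt hfin.lt_top).ne
  have hkey : ∀ t : ℝ, 0 < t → (ν.restrict A) {z | t < F z} * ENNReal.ofReal (t ^ ((2 : ℝ) - 1)) ≤
      N * ENNReal.ofReal (2 * D * CW) * ∫⁻ ζ, v t ζ ∂sigmaS n := by
    intro t ht
    have hsub : {z | t < F z} ∩ A ⊆ {z ∈ Bn n | ENNReal.ofReal (t / (2 * D)) <
        ∫⁻ ζ, ENNReal.ofReal (autK z ζ ^ n) * v t ζ ∂sigmaS n} := by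
      rintro z ⟨hz1, hz2⟩
      have hzB := hAB hz2
      refine ⟨hzB, ?_⟩
      by_contra! hcon
      have h1 : ∫⁻ ζ, ENNReal.ofReal (autK z ζ ^ n) * u ζ ∂sigmaS n ≤
          ENNReal.ofReal (t / (2 * D)) + ENNReal.ofReal CP * ENNReal.ofReal (c * t) := by
        calc ∫⁻ ζ, ENNReal.ofReal (autK z ζ ^ n) * u ζ ∂sigmaS n
            ≤ ∫⁻ ζ, (ENNReal.ofReal (autK z ζ ^ n) * v t ζ +
                ENNReal.ofReal (autK z ζ ^ n) * ENNReal.ofReal (c * t)) ∂sigmaS n := by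
              refine lintegral_mono fun ζ ↦ ?_
              rw [← mul_add]
              gcongr
              by_cases hm : ENNReal.ofReal (c * t) < u ζ
              · rw [hv]
                simp [hm]
              · exact (not_lt.1 hm).trans le_add_self
          _ ≤ _ := by
              rw [lintegral_add_right', lintegral_mul_const' _ _ ENNReal.ofReal_ne_top]
              · gcongr
                exact lintegral_poisson_le (mem_Bn.1 hzB)
              · refine AEMeasurable.mul_const ?_ _
                unfold autK
                simp only [herm_eq_inner]
                fun_prop
      have h2 := (h z hz2).trans (mul_le_mul_right h1 _)
      rw [← ENNReal.ofReal_mul hCP0.le, ← ENNReal.ofReal_add (by positivity) (by positivity),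
        ← ENNReal.ofReal_mul hD.le] at h2
      have h3 : D * (t / (2 * D) + CP * (c * t)) = t := by
        rw [hc]
        field_simp
        norm_num
      rw [h3] at h2
      exact absurd ((ENNReal.ofReal_le_ofReal_iff ht.le).1 h2) (not_le.2 hz1)
    rw [Measure.restrict_apply (measurableSet_lt measurable_const hF)]
    have h1 := (measure_mono hsub).trans (measure_poisson_gt_le hν (hvm t) (hvfin t)
      (div_pos ht (by positivity : 0 < 2 * D)))
    refine (mul_le_mul_left h1 _).trans_eq ?_
    rw [mul_right_comm, mul_assoc N, ← ENNReal.ofReal_mul (by positivity)]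
    congr 3
    rw [show (2 : ℝ) - 1 = 1 by norm_num, Real.rpow_one]
    field_simp
    rw [hCW]
    ring
  rw [lintegral_rpow_eq_lintegral_meas_lt_mul _ (ae_of_all _ hF0) hF.aemeasurable two_pos]
  have hprod : Measurable fun p : ℝ × En n ↦ v p.1 p.2 := by
    have hS : MeasurableSet {p : ℝ × En n | ENNReal.ofReal (c * p.1) < u p.2} :=
      measurableSet_lt (by fun_prop) (by fun_prop)
    exact (hu.comp measurable_snd).indicator hS
  have hswap : ∫⁻ t in Ioi (0 : ℝ), ∫⁻ ζ, v t ζ ∂sigmaS n ≤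
      ENNReal.ofReal c⁻¹ * ∫⁻ ζ, u ζ ^ 2 ∂sigmaS n := by
    rw [lintegral_lintegral_swap hprod.aemeasurable,
      ← lintegral_const_mul' _ _ ENNReal.ofReal_ne_top]
    refine lintegral_mono fun ζ ↦ ?_
    have e : ∀ t, v t ζ = {t : ℝ | ENNReal.ofReal (c * t) < u ζ}.indicator (fun _ ↦ u ζ) t :=
      fun t ↦ rfl
    simp only [e]
    rw [lintegral_indicator_const (measurableSet_lt (by fun_prop) measurable_const)]
    refine (mul_le_mul_right (volume_setOf_lt_le hc0 (u ζ)) _).trans_eq ?_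
    ring
  calc ENNReal.ofReal 2 * ∫⁻ t in Ioi (0 : ℝ),
        (ν.restrict A) {z | t < F z} * ENNReal.ofReal (t ^ ((2 : ℝ) - 1))
      ≤ ENNReal.ofReal 2 * ∫⁻ t in Ioi (0 : ℝ),
          N * ENNReal.ofReal (2 * D * CW) * ∫⁻ ζ, v t ζ ∂sigmaS n := by
        gcongr 1
        exact setLIntegral_mono' measurableSet_Ioi hkey
    _ ≤ ENNReal.ofReal 2 * (N * ENNReal.ofReal (2 * D * CW) *
          (ENNReal.ofReal c⁻¹ * ∫⁻ ζ, u ζ ^ 2 ∂sigmaS n)) := by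
        rw [lintegral_const_mul _ hprod.lintegral_prod_right']
        gcongr
    _ = _ := by
        have e : 8 * D ^ 2 * CW * CP = 2 * (2 * D * CW) * c⁻¹ := by
          rw [hc, inv_inv]
          ring
        rw [e, ENNReal.ofReal_mul (p := 2 * (2 * D * CW)) (by positivity),
          ENNReal.ofReal_mul (p := 2) (q := 2 * D * CW) zero_le_two]
        ring

/-- The constant of the Carleson embedding theorem. -/
def carlC (n : ℕ) (q : ℝ) : ℝ :=
  8 * (2 * 3 ^ (q / 2)) ^ 2 * (7 ^ n * (2 * 4 ^ n)) * (6 * 4 ^ n)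

lemma lintegral_dilate_le {ν : Measure (En n)} {N : ℝ≥0∞}
    (hν : ∀ ζ ∈ Sn n, ∀ δ : ℝ, 0 < δ → ν (cBox ζ δ) ≤ N * ENNReal.ofReal (δ ^ n))
    (hf : DifferentiableOn ℂ f (Bn n)) {q : ℝ} (hq : 0 < q) {ρ : ℝ} (hρ : ρ ∈ Ioo (0 : ℝ) 1) :
    ∫⁻ z in ball 0 ρ, ‖f (ρ • z)‖ₑ ^ q ∂ν ≤
      ENNReal.ofReal (carlC n q) * N * ∫⁻ ζ, ‖f (ρ • ζ)‖ₑ ^ q ∂sigmaS n := by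
  have hq2 := half_pos hq
  set f' := (Bn n).indicator f with hf'
  have hfm : Measurable fun z ↦ f' (ρ • z) :=
    (measurable_indicator_Bn hf.continuousOn).comp (measurable_const_smul ρ)
  have hρB : ∀ z : En n, ‖z‖ ≤ 1 → f' (ρ • z) = f (ρ • z) := by
    intro z hz
    have hm : ρ • z ∈ Bn n := by
      rw [mem_Bn, norm_smul, Real.norm_of_nonneg hρ.1.le]
      nlinarith [norm_nonneg z, hρ.1, hρ.2]
    rw [hf', indicator_of_mem hm]
  have hball : ball (0 : En n) ρ ⊆ Bn n := ball_subset_ball hρ.2.le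
  have hS : ∀ r : ℝ, ∫⁻ ζ, ‖f' (ρ • ζ)‖ₑ ^ r ∂sigmaS n = ∫⁻ ζ, ‖f (ρ • ζ)‖ₑ ^ r ∂sigmaS n := by
    intro r
    refine lintegral_congr_ae ?_
    filter_upwards [ae_norm_eq_one_sigmaS] with ζ hζ
    rw [hρB ζ hζ.le]
  have hofReal : ∀ (x : ℂ) (r : ℝ), 0 ≤ r → ENNReal.ofReal (‖x‖ ^ r) = ‖x‖ₑ ^ r := by
    intro x r hr
    rw [← ENNReal.ofReal_rpow_of_nonneg (norm_nonneg x) hr, ofReal_norm]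
  have hfin : ∫⁻ ζ, ‖f' (ρ • ζ)‖ₑ ^ (q / 2) ∂sigmaS n ≠ ⊤ := by
    have h := (integrable_sigmaS_smul (U := fun z ↦ ‖f z‖ ^ (q / 2))
      (hf.continuousOn.norm.rpow_const fun _ _ ↦ Or.inr hq2.le) ⟨hρ.1.le, hρ.2⟩).lintegral_lt_top
    rw [hS]
    simp only [hofReal _ _ hq2.le] at h
    exact h.ne
  have h := lintegral_sq_le_of_poisson_le hν (u := fun ζ ↦ ‖f' (ρ • ζ)‖ₑ ^ (q / 2))
    (hfm.enorm.pow_const _)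
    hfin (F := fun z ↦ ‖f' (ρ • z)‖ ^ (q / 2)) (hfm.norm.pow_const _) (fun z ↦ by positivity)
    hball (D := 2 * 3 ^ (q / 2)) (by positivity) (fun z hz ↦ by
      rw [hofReal _ _ hq2.le, hρB z (mem_Bn.1 (hball hz)).le]
      refine (enorm_rpow_le_poisson hf hq2 hρ.2 (mem_ball_zero_iff.1 hz)).trans_eq ?_
      have e : ENNReal.ofReal (2 * 3 ^ (q / 2)) = 3 ^ (q / 2 / 2) * (2 * 3 ^ (q / 2 / 2)) := by
        rw [ENNReal.ofReal_mul zero_le_two, ← ENNReal.ofReal_rpow_of_nonneg (by norm_num) hq2.le,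
          mul_left_comm, ← ENNReal.rpow_add _ _ (by norm_num) (by norm_num), add_halves]
        norm_num
      rw [e, mul_assoc, mul_assoc]
      congr 3
      refine lintegral_congr_ae ?_
      filter_upwards [ae_norm_eq_one_sigmaS] with ζ hζ
      rw [hρB ζ hζ.le])
  have e1 : ∀ x : ℂ, ENNReal.ofReal ((‖x‖ ^ (q / 2)) ^ (2 : ℝ)) = ‖x‖ₑ ^ q := by
    intro x
    rw [← Real.rpow_mul (norm_nonneg x), div_mul_cancel₀ _ two_ne_zero, hofReal _ _ hq.le]
  have e2 : ∀ x : ℂ, (‖x‖ₑ ^ (q / 2)) ^ 2 = ‖x‖ₑ ^ q := by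
    intro x
    rw [← ENNReal.rpow_natCast, ← ENNReal.rpow_mul]
    norm_num
  simp only [e1, e2] at h
  rw [hS] at h
  refine le_trans (le_of_eq ?_) h
  refine setLIntegral_congr_fun measurableSet_ball fun z hz ↦ ?_
  rw [hρB z (mem_Bn.1 (hball hz)).le]

/-- The Carleson embedding theorem. -/
lemma lintegral_Bn_le_hMean {ν : Measure (En n)} {N : ℝ≥0∞}
    (hν : ∀ ζ ∈ Sn n, ∀ δ : ℝ, 0 < δ → ν (cBox ζ δ) ≤ N * ENNReal.ofReal (δ ^ n))
    (hf : DifferentiableOn ℂ f (Bn n)) {q : ℝ} (hq : 0 < q) :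
    ∫⁻ z in Bn n, ‖f z‖ₑ ^ q ∂ν ≤ ENNReal.ofReal (carlC n q) * N * hMean n q f := by
  set ρ : ℕ → ℝ := fun k ↦ 1 - 1 / ((k : ℝ) + 2) with hρ
  have hρmem : ∀ k, ρ k ∈ Ioo (0 : ℝ) 1 := by
    intro k
    have h1 : (0 : ℝ) < (k : ℝ) + 2 := by positivity
    have h2 : 1 / ((k : ℝ) + 2) < 1 := by
      rw [div_lt_one h1]
      have : (0 : ℝ) ≤ k := k.cast_nonneg
      linarith
    exact ⟨by simp only [hρ]; linarith, by simp only [hρ]; linarith [one_div_pos.2 h1]⟩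
  have hρlim : Tendsto ρ atTop (𝓝 1) := by
    have : Tendsto (fun k : ℕ ↦ 1 / ((k : ℝ) + 2)) atTop (𝓝 0) := by
      have h := (tendsto_const_div_atTop_nhds_zero_nat (1 : ℝ)).comp (tendsto_add_atTop_nat 2)
      refine h.congr fun k ↦ ?_
      simp
    have h := this.const_sub 1
    rw [sub_zero] at h
    exact h
  set G : ℕ → En n → ℝ≥0∞ := fun k ↦
    (ball 0 (ρ k)).indicator fun z ↦ ‖(Bn n).indicator f (ρ k • z)‖ₑ ^ q with hG
  have hGm : ∀ k, Measurable (G k) := fun k ↦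
    ((((measurable_indicator_Bn hf.continuousOn).comp
      (measurable_const_smul (ρ k))).enorm).pow_const q).indicator measurableSet_ball
  have hlim : ∀ z ∈ Bn n, Tendsto (fun k ↦ G k z) atTop (𝓝 (‖f z‖ₑ ^ q)) := by
    intro z hz
    have h1 : Tendsto (fun k ↦ ‖f (ρ k • z)‖ₑ ^ q) atTop (𝓝 (‖f z‖ₑ ^ q)) := by
      have hc := (continuousOn_enorm_rpow hf.continuousOn q).continuousAt (isOpen_Bn.mem_nhds hz)
      have h2 : Tendsto (fun k ↦ ρ k • z) atTop (𝓝 z) := by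
        simpa using hρlim.smul_const z
      exact hc.tendsto.comp h2
    refine h1.congr' ?_
    filter_upwards [hρlim.eventually (lt_mem_nhds (mem_Bn.1 hz))] with k hk
    have hm : ρ k • z ∈ Bn n := real_smul_mem_Bn hz ⟨(hρmem k).1.le, (hρmem k).2.le⟩
    have hm' : z ∈ ball (0 : En n) (ρ k) := mem_ball_zero_iff.2 hk
    simp only [hG]
    rw [indicator_of_mem hm', indicator_of_mem hm]
  calc ∫⁻ z in Bn n, ‖f z‖ₑ ^ q ∂ν = ∫⁻ z in Bn n, liminf (fun k ↦ G k z) atTop ∂ν :=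
        setLIntegral_congr_fun isOpen_Bn.measurableSet fun z hz ↦ (hlim z hz).liminf_eq.symm
    _ ≤ liminf (fun k ↦ ∫⁻ z in Bn n, G k z ∂ν) atTop := lintegral_liminf_le hGm
    _ ≤ ENNReal.ofReal (carlC n q) * N * hMean n q f := by
        refine liminf_le_of_le (by isBoundedDefault) fun b hb ↦ ?_
        obtain ⟨k, hk⟩ := hb.exists
        refine hk.trans ?_
        have hsub : ball (0 : En n) (ρ k) ⊆ Bn n := ball_subset_ball (hρmem k).2.le
        rw [hG, lintegral_indicator measurableSet_ball,
          Measure.restrict_restrict measurableSet_ball, inter_eq_left.2 hsub]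
        refine le_trans (le_of_eq ?_) ((lintegral_dilate_le hν hf hq (hρmem k)).trans
          (mul_le_mul_right (le_hMean (hρmem k)) _))
        refine setLIntegral_congr_fun measurableSet_ball fun z hz ↦ ?_
        have hm : ρ k • z ∈ Bn n := real_smul_mem_Bn (hsub hz) ⟨(hρmem k).1.le, (hρmem k).2.le⟩
        rw [indicator_of_mem hm]

end CarlesonEmbedding

section GreenMeasure

variable {n : ℕ} {f F g : En n → ℂ}

lemma measurable_radD (g : En n → ℂ) : Measurable (radD g) :=
  isBoundedBilinearMap_apply.continuous.measurable.comp
    ((measurable_fderiv ℂ g).prodMk measurable_id)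

/-- The measure `|Rg|² w_R dv`, where `w_R` is the Green kernel of the ball of radius `R`. -/
def nuW (n : ℕ) (g : En n → ℂ) (R : ℝ) : Measure (En n) :=
  (volN n).withDensity fun z ↦ greenW n R z * ‖radD g z‖ₑ ^ 2

lemma measurable_greenW_mul (g : En n → ℂ) (R : ℝ) :
    Measurable fun z ↦ greenW n R z * ‖radD g z‖ₑ ^ 2 :=
  (measurable_greenW R).mul ((measurable_radD g).enorm.pow_const 2)

lemma lintegral_nuW (g : En n → ℂ) (R : ℝ) (φ : En n → ℝ≥0∞) :
    ∫⁻ z, φ z ∂nuW n g R = ∫⁻ z, greenW n R z * ‖radD g z‖ₑ ^ 2 * φ z ∂volN n :=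
  lintegral_withDensity_eq_lintegral_mul_non_measurable _ (measurable_greenW_mul g R)
    (ae_of_all _ fun _ ↦ ENNReal.mul_lt_top ENNReal.ofReal_lt_top (by finiteness)) φ

lemma nuW_mono {r R : ℝ} (hr : 0 < r) (hrR : r ≤ R) : nuW n g r ≤ nuW n g R :=
  withDensity_mono (ae_of_all _ fun z ↦ mul_le_mul_left (greenW_mono hr hrR z) _)

lemma ae_mem_Bn_nuW (R : ℝ) : ∀ᵐ z ∂nuW n g R, z ∈ Bn n :=
  (withDensity_absolutelyContinuous _ _).ae_le ae_mem_Bn_volN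

lemma lintegral_nuW_one_le {φ : En n → ℝ≥0∞} (hφ : Measurable φ) (hφ' : ∀ z, φ z ≠ ⊤)
    {b : ℝ≥0∞}
    (h : ∀ R ∈ Ioo (0 : ℝ) 1, ∫⁻ z, φ z ∂nuW n g R ≤ b) : ∫⁻ z, φ z ∂nuW n g 1 ≤ b := by
  obtain ⟨R, -, hR, hRlim⟩ := exists_seq_strictMono_tendsto' (zero_lt_one (α := ℝ))
  have hlim : ∀ z : En n, Tendsto (fun k ↦ greenW n (R k) z * ‖radD g z‖ₑ ^ 2 * φ z) atTop
      (𝓝 (greenW n 1 z * ‖radD g z‖ₑ ^ 2 * φ z)) := by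
    intro z
    simp only [mul_assoc]
    refine ENNReal.Tendsto.mul_const ?_ (Or.inr (ENNReal.mul_ne_top (by finiteness) (hφ' z)))
    unfold greenW
    refine ENNReal.tendsto_ofReal (Tendsto.const_mul _ (Tendsto.div_const ?_ _))
    rcases eq_or_ne z 0 with rfl | hz
    · simp
    · have hz' := norm_pos_iff.2 hz
      exact (hRlim.div_const ‖z‖).log (by positivity)
  rw [lintegral_nuW]
  calc ∫⁻ z, greenW n 1 z * ‖radD g z‖ₑ ^ 2 * φ z ∂volN n
      = ∫⁻ z, liminf (fun k ↦ greenW n (R k) z * ‖radD g z‖ₑ ^ 2 * φ z) atTop ∂volN n :=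
        lintegral_congr fun z ↦ (hlim z).liminf_eq.symm
    _ ≤ liminf (fun k ↦ ∫⁻ z, greenW n (R k) z * ‖radD g z‖ₑ ^ 2 * φ z ∂volN n) atTop :=
        lintegral_liminf_le fun k ↦ (measurable_greenW_mul g (R k)).mul hφ
    _ ≤ b := by
        refine liminf_le_of_le (by isBoundedDefault) fun c hc ↦ ?_
        obtain ⟨k, hk⟩ := hc.exists
        refine hk.trans ?_
        rw [← lintegral_nuW]
        exact h _ (hR k)

lemma aemeasurable_volN (hf : ContinuousOn f (Bn n)) : AEMeasurable f (volN n) :=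
  (hf.aemeasurable isOpen_Bn.measurableSet).smul_measure _

variable [NeZero n]

lemma muJ_le_nuW (g : En n → ℂ) : muJ n g ≤ (n : ℝ≥0∞) • nuW n g 1 := by
  have hn : (0 : ℝ) < n := Nat.cast_pos.2 (NeZero.pos n)
  unfold muJ nuW
  rw [← withDensity_smul _ (measurable_greenW_mul g 1)]
  refine withDensity_mono ?_
  filter_upwards [ae_mem_Bn_volN] with z hz
  rcases eq_or_ne z 0 with rfl | hz0
  · simp [radD_zero]
  have hz1 := mem_Bn.1 hz
  have hx := norm_pos_iff.2 hz0
  have hlog := Real.log_le_sub_one_of_pos hx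
  have h1 : ENNReal.ofReal (1 - ‖z‖ ^ 2) ≤ n * greenW n 1 z := by
    rw [greenW, ← ENNReal.ofReal_natCast, ← ENNReal.ofReal_mul hn.le]
    refine ENNReal.ofReal_le_ofReal ?_
    rw [one_div, Real.log_inv]
    have h2 : 0 < ‖z‖ ^ (2 * n) := by positivity
    have h3 : ‖z‖ ^ (2 * n) ≤ 1 := pow_le_one₀ hx.le hz1.le
    have h4 : (n : ℝ) * (2 / n * (-Real.log ‖z‖ / ‖z‖ ^ (2 * n))) =
        2 * -Real.log ‖z‖ / ‖z‖ ^ (2 * n) := by field_simp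
    have h5 : 0 ≤ 1 - ‖z‖ ^ 2 := by nlinarith
    rw [h4, le_div_iff₀ h2]
    nlinarith [mul_le_mul_of_nonneg_left h3 h5]
  rw [Pi.smul_apply, smul_eq_mul]
  refine (mul_le_mul_right h1 _).trans_eq ?_
  change ‖radD g z‖ₑ ^ 2 * _ = _
  ring

lemma nuW_le_muJ {z : En n} (hz : 1 / 2 ≤ ‖z‖) :
    greenW n 1 z ≤ ENNReal.ofReal (4 * 4 ^ n) * ENNReal.ofReal (1 - ‖z‖ ^ 2) := by
  have hn : (1 : ℝ) ≤ n := Nat.one_le_cast.2 (NeZero.pos n)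
  rw [greenW, ← ENNReal.ofReal_mul (by positivity)]
  rcases le_or_gt 1 ‖z‖ with hz1 | hz1
  · have h : Real.log (1 / ‖z‖) ≤ 0 := Real.log_nonpos (by positivity)
      (by rw [div_le_one (by positivity)]; exact hz1)
    rw [ENNReal.ofReal_of_nonpos]
    · exact zero_le
    · exact mul_nonpos_of_nonneg_of_nonpos (by positivity)
        (div_nonpos_of_nonpos_of_nonneg h (by positivity))
  have hx : 0 < ‖z‖ := by linarith
  refine ENNReal.ofReal_le_ofReal ?_
  have h1 : Real.log (1 / ‖z‖) ≤ 2 * (1 - ‖z‖ ^ 2) := by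
    have h := Real.log_le_sub_one_of_pos (one_div_pos.2 hx)
    have h2 : 1 / ‖z‖ - 1 ≤ 2 * (1 - ‖z‖ ^ 2) := by
      rw [div_sub_one hx.ne', div_le_iff₀ hx]
      nlinarith
    exact h.trans h2
  have h2 : (1 : ℝ) / 4 ^ n ≤ ‖z‖ ^ (2 * n) := by
    rw [pow_mul, ← one_div_pow]
    gcongr
    nlinarith
  have h3 : 0 ≤ 1 - ‖z‖ ^ 2 := by nlinarith
  calc 2 / (n : ℝ) * (Real.log (1 / ‖z‖) / ‖z‖ ^ (2 * n))
      ≤ 2 * ((2 * (1 - ‖z‖ ^ 2)) / (1 / 4 ^ n)) := by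
        gcongr
        · exact div_nonneg (Real.log_nonneg (by rw [le_div_iff₀ hx]; linarith)) (by positivity)
        · exact div_le_self zero_le_two hn
    _ = 4 * 4 ^ n * (1 - ‖z‖ ^ 2) := by
        field_simp
        ring

lemma lintegral_enorm_rpow_sphere_lt_top (hf : ContinuousOn f (Bn n)) {q R : ℝ} (hq : 0 ≤ q)
    (hR : R ∈ Ico (0 : ℝ) 1) : ∫⁻ ζ, ‖f (R • ζ)‖ₑ ^ q ∂sigmaS n < ⊤ := by
  have h := (integrable_sigmaS_smul (U := fun z ↦ ‖f z‖ ^ q)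
    (hf.norm.rpow_const fun _ _ ↦ Or.inr hq) hR).lintegral_lt_top
  refine lt_of_eq_of_lt (lintegral_congr fun ζ ↦ ?_) h
  rw [← ENNReal.ofReal_rpow_of_nonneg (norm_nonneg _) hq, ofReal_norm]

lemma nuW_univ_lt_top (hg : DifferentiableOn ℂ g (Bn n)) {R : ℝ} (hR : R ∈ Ioo (0 : ℝ) 1) :
    nuW n g R univ < ⊤ := by
  have h := le_lintegral_sqSum_rpow hg (f₂ := fun _ ↦ 0) (differentiableOn_const _)
    zero_lt_one zero_lt_one hR
  have h2 := lintegral_ofReal_sqSum_rpow_le hg.continuousOn (f₂ := fun _ ↦ 0)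
    continuousOn_const zero_lt_one zero_lt_two ⟨hR.1.le, hR.2⟩
  have hfin := lintegral_enorm_rpow_sphere_lt_top hg.continuousOn zero_le_two ⟨hR.1.le, hR.2⟩
  rw [div_self two_ne_zero] at h2
  have h3 : nuW n g R univ ≤ ENNReal.ofReal (min 1 (1 ^ 2)) * ∫⁻ z, greenW n R z *
      ENNReal.ofReal (sqSum g (fun _ ↦ 0) 1 z ^ ((1 : ℝ) - 1) *
        (‖radD g z‖ ^ 2 + ‖radD (fun _ ↦ (0 : ℂ)) z‖ ^ 2)) ∂volN n := by
    rw [← lintegral_one, lintegral_nuW]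
    norm_num
    refine lintegral_mono fun z ↦ mul_le_mul_right ?_ _
    refine le_trans (le_of_eq ?_) (ENNReal.ofReal_le_ofReal (le_add_of_nonneg_right (sq_nonneg _)))
    rw [ENNReal.ofReal_pow (norm_nonneg _), ofReal_norm]
  refine (h3.trans (le_add_self.trans (h.trans h2))).trans_lt ?_
  have h4 : ∫⁻ ζ, ‖(fun _ : En n ↦ (0 : ℂ)) (R • ζ)‖ₑ ^ (2 : ℝ) ∂sigmaS n = 0 := by simp
  rw [h4]
  finiteness

lemma nuW_closedBall_lt_top (hg : DifferentiableOn ℂ g (Bn n)) {ρ : ℝ} (hρ : ρ ∈ Ioo (0 : ℝ) 1) :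
    nuW n g 1 (closedBall 0 ρ) < ⊤ := by
  obtain ⟨R, hρR, hR1⟩ := exists_between hρ.2
  have hR : R ∈ Ioo (0 : ℝ) 1 := ⟨hρ.1.trans hρR, hR1⟩
  set c : ℝ := Real.log (1 / ρ) / Real.log (R / ρ) with hc
  have hRρ : 0 < Real.log (R / ρ) := Real.log_pos (by rwa [one_lt_div hρ.1])
  have h1ρ : 0 < Real.log (1 / ρ) := Real.log_pos (by rw [one_lt_div hρ.1]; exact hρ.2)
  have hc0 : 0 < c := div_pos h1ρ hRρ
  have key : ∀ z ∈ closedBall (0 : En n) ρ, greenW n 1 z ≤ ENNReal.ofReal c * greenW n R z := by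
    intro z hz
    rcases eq_or_ne z 0 with rfl | hz0
    · simp [greenW]
    have hx := norm_pos_iff.2 hz0
    have hxρ := mem_closedBall_zero_iff.1 hz
    rw [greenW, greenW, ← ENNReal.ofReal_mul hc0.le]
    refine ENNReal.ofReal_le_ofReal ?_
    have h1 : Real.log (1 / ‖z‖) ≤ c * Real.log (R / ‖z‖) := by
      rw [hc, div_mul_eq_mul_div, le_div_iff₀ hRρ]
      rw [Real.log_div one_ne_zero hx.ne', Real.log_div one_ne_zero hρ.1.ne',
        Real.log_div hR.1.ne' hx.ne', Real.log_div hR.1.ne' hρ.1.ne', Real.log_one]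
      have h2 := Real.log_le_log hx hxρ
      have h3 := Real.log_neg hR.1 hR.2
      nlinarith
    calc 2 / (n : ℝ) * (Real.log (1 / ‖z‖) / ‖z‖ ^ (2 * n))
        ≤ 2 / (n : ℝ) * (c * Real.log (R / ‖z‖) / ‖z‖ ^ (2 * n)) := by gcongr
      _ = _ := by ring
  have hm : MeasurableSet (closedBall (0 : En n) ρ) := measurableSet_closedBall
  calc nuW n g 1 (closedBall 0 ρ)
      = ∫⁻ z in closedBall 0 ρ, greenW n 1 z * ‖radD g z‖ₑ ^ 2 ∂volN n := withDensity_apply _ hm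
    _ ≤ ∫⁻ z in closedBall 0 ρ, ENNReal.ofReal c * (greenW n R z * ‖radD g z‖ₑ ^ 2) ∂volN n := by
        refine setLIntegral_mono' hm fun z hz ↦ ?_
        rw [← mul_assoc]
        exact mul_le_mul_left (key z hz) _
    _ = ENNReal.ofReal c * nuW n g R (closedBall 0 ρ) := by
        rw [lintegral_const_mul' _ _ ENNReal.ofReal_ne_top, ← withDensity_apply _ hm]
        rfl
    _ < ⊤ := ENNReal.mul_lt_top ENNReal.ofReal_lt_top
        ((measure_mono (subset_univ _)).trans_lt (nuW_univ_lt_top hg hR))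

/-- A bound for the means of a primitive of `f Rg`. -/
lemma lintegral_primitive_le (hf : DifferentiableOn ℂ f (Bn n)) (hF : DifferentiableOn ℂ F (Bn n))
    (hF0 : F 0 = 0) (h : ∀ z ∈ Bn n, radD F z = f z * radD g z) {q η R : ℝ} (hq : 0 < q)
    (hq2 : q ≤ 2) (hη : 0 < η) (hR : R ∈ Ioo (0 : ℝ) 1) :
    ∫⁻ ζ, ‖F (R • ζ)‖ₑ ^ q ∂sigmaS n ≤
      ENNReal.ofReal (η ^ (q - 2)) * ∫⁻ z, ‖f z‖ₑ ^ q ∂nuW n g 1 +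
      ENNReal.ofReal (2 / q * 3 ^ (q / 2) * η ^ q) * ∫⁻ ζ, ‖f (R • ζ)‖ₑ ^ q ∂sigmaS n := by
  have hs : 0 < q / 2 := half_pos hq
  have hs1 : q / 2 ≤ 1 := by linarith
  set s := q / 2 with hsdef
  have hmin : min s (s ^ 2) = s ^ 2 := min_eq_right (by nlinarith)
  have hmax : max s (s ^ 2) = s := max_eq_left (by nlinarith)
  set f' : En n → ℂ := fun z ↦ (η : ℂ) * f z with hf'
  have hf'd : DifferentiableOn ℂ f' (Bn n) := hf.const_mul _
  have h0d : DifferentiableOn ℂ (fun _ : En n ↦ (0 : ℂ)) (Bn n) := differentiableOn_const _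
  have hRm : R ∈ Ico (0 : ℝ) 1 := ⟨hR.1.le, hR.2⟩
  have hηn : ‖(η : ℂ)‖ = η := by rw [Complex.norm_real, Real.norm_of_nonneg hη.le]
  have hKtop : ENNReal.ofReal (1 / s) * 3 ^ s ≠ ⊤ := by finiteness
  refine ENNReal_le_of_forall_ofReal_rpow hs hKtop fun ε hε ↦ ?_
  set Y : En n → ℝ := sqSum f' (fun _ ↦ 0) ε with hY
  have hYpos : ∀ z, 0 < Y z := fun z ↦ sqSum_pos hε z
  have hY_le : ∀ z, Y z ≤ sqSum F f' ε z := fun z ↦ by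
    simp only [hY, sqSum, norm_zero]
    nlinarith [sq_nonneg ‖F z‖]
  set I : ℝ≥0∞ := ∫⁻ z, greenW n R z * ENNReal.ofReal (Y z ^ (s - 1) * ‖radD f' z‖ ^ 2) ∂volN n
    with hI
  have hlow : ENNReal.ofReal (Y 0 ^ s) + ENNReal.ofReal s * I ≤
      ENNReal.ofReal (1 / s) * ∫⁻ ζ, ENNReal.ofReal (Y (R • ζ) ^ s) ∂sigmaS n := by
    have h1 := le_lintegral_sqSum_rpow hf'd h0d hε hs hR
    rw [hmin] at h1
    have h2 : ENNReal.ofReal (1 / s) * (ENNReal.ofReal (Y 0 ^ s) + ENNReal.ofReal (s ^ 2) * I) ≤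
        ENNReal.ofReal (1 / s) * ∫⁻ ζ, ENNReal.ofReal (Y (R • ζ) ^ s) ∂sigmaS n := by
      refine mul_le_mul_right (le_trans (add_le_add le_rfl (mul_le_mul_right
        (lintegral_mono fun z ↦ mul_le_mul_right (ENNReal.ofReal_le_ofReal ?_) _) _)) h1) _
      exact mul_le_mul_of_nonneg_left (le_add_of_nonneg_right (sq_nonneg _))
        (Real.rpow_nonneg (hYpos z).le _)
    refine le_trans ?_ h2
    rw [mul_add, ← mul_assoc, ← ENNReal.ofReal_mul (p := 1 / s) (q := s ^ 2) (by positivity),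
      show 1 / s * s ^ 2 = s by field_simp]
    refine add_le_add (le_mul_of_one_le_left zero_le ?_) le_rfl
    rw [ENNReal.one_le_ofReal, le_div_iff₀ hs]
    linarith
  have hYle : ∫⁻ ζ, ENNReal.ofReal (Y (R • ζ) ^ s) ∂sigmaS n ≤
      3 ^ s * (ENNReal.ofReal (η ^ q) * ∫⁻ ζ, ‖f (R • ζ)‖ₑ ^ q ∂sigmaS n +
        ENNReal.ofReal ε ^ s) := by
    refine (lintegral_ofReal_sqSum_rpow_le hf'd.continuousOn h0d.continuousOn hε hq
      hRm).trans_eq ?_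
    have h1 : ∀ ζ : En n, ‖f' (R • ζ)‖ₑ ^ q = ENNReal.ofReal (η ^ q) * ‖f (R • ζ)‖ₑ ^ q := by
      intro ζ
      rw [hf', enorm_mul, ENNReal.mul_rpow_of_nonneg _ _ hq.le, ← ofReal_norm (η : ℂ), hηn,
        ENNReal.ofReal_rpow_of_nonneg hη.le hq.le]
    simp only [h1]
    rw [lintegral_const_mul' _ _ ENNReal.ofReal_ne_top]
    simp [ENNReal.zero_rpow_of_pos hq, hsdef]
  set E : ℝ≥0∞ := ∫⁻ z, ‖f z‖ₑ ^ q ∂nuW n g 1 with hE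
  have hup : ∫⁻ z, greenW n R z * ENNReal.ofReal (sqSum F f' ε z ^ (s - 1) *
      (‖radD F z‖ ^ 2 + ‖radD f' z‖ ^ 2)) ∂volN n ≤ ENNReal.ofReal (η ^ (q - 2)) * E + I := by
    have h1 : ENNReal.ofReal (η ^ (q - 2)) * ∫⁻ z, ‖f z‖ₑ ^ q ∂nuW n g R ≤
        ENNReal.ofReal (η ^ (q - 2)) * E :=
      mul_le_mul_right (lintegral_mono' (nuW_mono hR.1 hR.2.le) le_rfl) _
    refine le_trans ?_ (add_le_add h1 le_rfl)
    rw [lintegral_nuW, ← lintegral_const_mul' _ _ ENNReal.ofReal_ne_top, hI,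
      ← lintegral_add_left']
    · refine lintegral_mono_ae ?_
      filter_upwards [ae_mem_Bn_volN] with z hz
      have h2 : sqSum F f' ε z ^ (s - 1) ≤ Y z ^ (s - 1) :=
        Real.rpow_le_rpow_of_nonpos (hYpos z) (hY_le z) (by linarith)
      have h3 : Y z ^ (s - 1) * ‖f z‖ ^ 2 ≤ η ^ (q - 2) * ‖f z‖ ^ q := by
        rcases eq_or_ne (f z) 0 with h0 | h0
        · rw [h0]
          simp [Real.zero_rpow hq.ne']
        have hfz := norm_pos_iff.2 h0
        have h4 : Y z ^ (s - 1) ≤ ((η * ‖f z‖) ^ 2) ^ (s - 1) := by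
          refine Real.rpow_le_rpow_of_nonpos (by positivity) ?_ (by linarith)
          simp only [hY, hf', sqSum, norm_mul, hηn, norm_zero]
          nlinarith
        refine (mul_le_mul_of_nonneg_right h4 (sq_nonneg _)).trans_eq ?_
        rw [← Real.rpow_natCast (η * ‖f z‖), ← Real.rpow_mul (by positivity),
          show ((2 : ℕ) : ℝ) * (s - 1) = q - 2 by rw [hsdef]; push_cast; ring,
          Real.mul_rpow hη.le hfz.le, mul_assoc, ← Real.rpow_natCast ‖f z‖, ← Real.rpow_add hfz]
        congr 2
        push_cast
        ring
      have h5 : sqSum F f' ε z ^ (s - 1) * (‖radD F z‖ ^ 2 + ‖radD f' z‖ ^ 2) ≤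
          η ^ (q - 2) * (‖radD g z‖ ^ 2 * ‖f z‖ ^ q) + Y z ^ (s - 1) * ‖radD f' z‖ ^ 2 := by
        rw [h z hz, norm_mul, mul_pow]
        have h6 := mul_le_mul_of_nonneg_right h2
          (by positivity : 0 ≤ ‖f z‖ ^ 2 * ‖radD g z‖ ^ 2 + ‖radD f' z‖ ^ 2)
        have h7 := mul_le_mul_of_nonneg_right h3 (sq_nonneg ‖radD g z‖)
        linarith
      refine (mul_le_mul_right (ENNReal.ofReal_le_ofReal h5) _).trans_eq ?_
      rw [ENNReal.ofReal_add (by positivity)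
        (mul_nonneg (Real.rpow_nonneg (hYpos z).le _) (sq_nonneg _)), mul_add,
        ENNReal.ofReal_mul (by positivity), ENNReal.ofReal_mul (by positivity),
        ENNReal.ofReal_pow (norm_nonneg _), ofReal_norm,
        ← ENNReal.ofReal_rpow_of_nonneg (norm_nonneg _) hq.le, ofReal_norm]
      ring
    · exact (((measurable_greenW_mul g R).aemeasurable).mul
        ((aemeasurable_volN hf.continuousOn).enorm.pow_const q)).const_mul _
  have hFle : ∫⁻ ζ, ‖F (R • ζ)‖ₑ ^ q ∂sigmaS n ≤
      ∫⁻ ζ, ENNReal.ofReal (sqSum F f' ε (R • ζ) ^ s) ∂sigmaS n :=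
    lintegral_mono fun ζ ↦ enorm_rpow_le_ofReal_sqSum_rpow hε hq _
  have hX0 : sqSum F f' ε 0 = Y 0 := by
    simp only [hY, sqSum, hF0, norm_zero]
    ring
  have hmain := hFle.trans (lintegral_sqSum_rpow_le hF hf'd hε hs hR)
  rw [hmax, hX0] at hmain
  calc ∫⁻ ζ, ‖F (R • ζ)‖ₑ ^ q ∂sigmaS n
      ≤ ENNReal.ofReal (Y 0 ^ s) + ENNReal.ofReal s * (ENNReal.ofReal (η ^ (q - 2)) * E + I) :=
        hmain.trans (add_le_add le_rfl (mul_le_mul_right hup _))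
    _ = ENNReal.ofReal s * (ENNReal.ofReal (η ^ (q - 2)) * E) +
          (ENNReal.ofReal (Y 0 ^ s) + ENNReal.ofReal s * I) := by ring
    _ ≤ ENNReal.ofReal (η ^ (q - 2)) * E + ENNReal.ofReal (1 / s) *
          (3 ^ s * (ENNReal.ofReal (η ^ q) * ∫⁻ ζ, ‖f (R • ζ)‖ₑ ^ q ∂sigmaS n +
            ENNReal.ofReal ε ^ s)) := by
        refine add_le_add (mul_le_of_le_one_left zero_le (ENNReal.ofReal_le_one.2 hs1)) ?_
        exact hlow.trans (mul_le_mul_right hYle _)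
    _ = _ := by
        have e : ENNReal.ofReal (2 / q * 3 ^ s * η ^ q) =
            ENNReal.ofReal (1 / s) * 3 ^ s * ENNReal.ofReal (η ^ q) := by
          rw [ENNReal.ofReal_mul (by positivity), ENNReal.ofReal_mul (by positivity),
            ← ENNReal.ofReal_rpow_of_nonneg (by norm_num) hs.le, hsdef, one_div_div]
          norm_num
        rw [e]
        ring

end GreenMeasure

section VanishingCarleson

variable {n : ℕ} {f F g : En n → ℂ}

/-- The vanishing Carleson condition. -/
def VanishingCarleson (μ : Measure (En n)) : Prop :=
  Tendsto (fun δ : ℝ ↦ ⨆ ζ ∈ Sn n, μ (cBox ζ δ) / ENNReal.ofReal (δ ^ n)) (𝓝[>] (0 : ℝ)) (𝓝 0)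

lemma muJ_compl_Bn (g : En n → ℂ) : muJ n g (Bn n)ᶜ = 0 :=
  withDensity_absolutelyContinuous _ _ (mem_ae_iff.1 ae_mem_Bn_volN)

lemma VanishingCarleson.exists_forall_le {μ : Measure (En n)} (h : VanishingCarleson μ) {τ : ℝ≥0∞}
    (hτ : τ ≠ 0) : ∃ δ₀ : ℝ, 0 < δ₀ ∧ ∀ δ ∈ Ioo 0 δ₀, ∀ ζ ∈ Sn n,
      μ (cBox ζ δ) ≤ τ * ENNReal.ofReal (δ ^ n) := by
  have h1 := ENNReal.tendsto_nhds_zero.1 h τ (pos_iff_ne_zero.2 hτ)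
  obtain ⟨δ₀, hδ₀, hsub⟩ := mem_nhdsGT_iff_exists_Ioo_subset.1 h1
  refine ⟨δ₀, hδ₀, fun δ hδ ζ hζ ↦ ?_⟩
  have h2 : (⨆ ζ ∈ Sn n, μ (cBox ζ δ) / ENNReal.ofReal (δ ^ n)) ≤ τ := hsub hδ
  have h3 : μ (cBox ζ δ) / ENNReal.ofReal (δ ^ n) ≤ τ :=
    (le_iSup₂ (f := fun ζ (_ : ζ ∈ Sn n) ↦ μ (cBox ζ δ) / ENNReal.ofReal (δ ^ n)) ζ hζ).trans h2
  have h4 : ENNReal.ofReal (δ ^ n) ≠ 0 := (ENNReal.ofReal_pos.2 (pow_pos hδ.1 n)).ne'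
  exact (ENNReal.div_le_iff h4 ENNReal.ofReal_ne_top).1 h3

/-- The part near the sphere of a vanishing Carleson measure has a small Carleson constant. -/
lemma VanishingCarleson.exists_restrict_le {μ : Measure (En n)} (h : VanishingCarleson μ)
    {τ : ℝ≥0∞} (hτ : τ ≠ 0) (hτ' : τ ≠ ⊤) : ∃ ρ ∈ Ioo (1 / 2 : ℝ) 1, ∀ ζ ∈ Sn n, ∀ δ : ℝ, 0 < δ →
      μ.restrict {z | ρ ≤ ‖z‖} (cBox ζ δ) ≤ τ * ENNReal.ofReal (δ ^ n) := by
  obtain ⟨δ₀, hδ₀, hsmall⟩ := h.exists_forall_le hτ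
  set d := δ₀ / 2 with hd
  have hd0 : 0 < d := half_pos hδ₀
  have hdI : d ∈ Ioo 0 δ₀ := ⟨hd0, half_lt_self hδ₀⟩
  set U : En n → Set (En n) := fun ζ ↦ {z | ‖1 - herm z ζ‖ < d} with hU
  have hUo : ∀ ζ, IsOpen (U ζ) := fun ζ ↦ by
    simp only [hU, herm_eq_inner]
    exact isOpen_lt (by fun_prop) continuous_const
  obtain ⟨t, htS, hcov⟩ := (isCompact_sphere (0 : En n) 1).elim_nhds_subcover U fun ζ hζ ↦ by
    refine (hUo ζ).mem_nhds ?_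
    change ‖1 - herm ζ ζ‖ < d
    rw [herm_self, mem_sphere_zero_iff_norm.1 hζ]
    simpa using hd0
  set V := ⋃ ζ ∈ t, U ζ with hV
  have hVo : IsOpen V := isOpen_biUnion fun ζ _ ↦ hUo ζ
  obtain ⟨ρ₀, hρ₀, hρV⟩ : ∃ ρ₀ < (1 : ℝ), ∀ z : En n, ρ₀ < ‖z‖ → ‖z‖ ≤ 1 → z ∈ V := by
    rcases (closedBall (0 : En n) 1 \ V).eq_empty_or_nonempty with he | hne
    · refine ⟨0, one_pos, fun z _ hz ↦ ?_⟩
      by_contra hzV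
      have hm : z ∈ closedBall (0 : En n) 1 \ V := ⟨mem_closedBall_zero_iff.2 hz, hzV⟩
      rw [he] at hm
      exact hm
    · obtain ⟨z₀, hz₀, hmax⟩ := ((isCompact_closedBall (0 : En n) 1).diff hVo).exists_isMaxOn hne
        continuous_norm.continuousOn
      refine ⟨‖z₀‖, lt_of_le_of_ne (mem_closedBall_zero_iff.1 hz₀.1) fun he ↦
        hz₀.2 (hcov (mem_sphere_zero_iff_norm.2 he)), fun z hz hz1 ↦ ?_⟩
      by_contra hzV
      exact absurd (hmax ⟨mem_closedBall_zero_iff.2 hz1, hzV⟩) (not_le.2 hz)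
  set A : ℝ → Set (En n) := fun ρ ↦ {z ∈ Bn n | ρ ≤ ‖z‖} with hA
  have hAm : ∀ ρ, MeasurableSet (A ρ) := fun ρ ↦
    isOpen_Bn.measurableSet.inter (measurableSet_le measurable_const measurable_norm)
  have hfin : ∀ ρ, ρ₀ < ρ → μ (A ρ) ≠ ⊤ := by
    intro ρ hρ
    have hsub : A ρ ⊆ ⋃ ζ ∈ t, cBox ζ d := by
      rintro z ⟨hz1, hz2⟩
      have h1 := hρV z (hρ.trans_le hz2) (mem_Bn.1 hz1).le
      simp only [hV, mem_iUnion] at h1 ⊢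
      obtain ⟨ζ, hζ, hz⟩ := h1
      exact ⟨ζ, hζ, hz1, hz⟩
    refine ((measure_mono hsub).trans (measure_biUnion_finset_le t _)).trans_lt ?_ |>.ne
    refine ENNReal.sum_lt_top.2 fun ζ hζ ↦ (hsmall d hdI ζ (htS ζ hζ)).trans_lt ?_
    finiteness
  obtain ⟨ρ, hρmono, hρI, hρlim⟩ := exists_seq_strictMono_tendsto' hρ₀
  have hlim : Tendsto (fun k ↦ μ (A (ρ k))) atTop (𝓝 0) := by
    have h1 := tendsto_measure_iInter_atTop (μ := μ) (s := fun k ↦ A (ρ k))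
      (fun k ↦ (hAm _).nullMeasurableSet)
      (fun i j hij z hz ↦ ⟨hz.1, (hρmono.monotone hij).trans hz.2⟩) ⟨0, hfin _ (hρI 0).1⟩
    have h2 : ⋂ k, A (ρ k) = ∅ := by
      refine eq_empty_of_forall_notMem fun z hz ↦ ?_
      have h3 := mem_iInter.1 hz
      exact absurd (le_of_tendsto hρlim (Eventually.of_forall fun k ↦ (h3 k).2))
        (not_le.2 (mem_Bn.1 (h3 0).1))
    rwa [h2, measure_empty] at h1
  have hpos : 0 < τ * ENNReal.ofReal (d ^ n) :=
    ENNReal.mul_pos hτ (ENNReal.ofReal_pos.2 (pow_pos hd0 n)).ne'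
  obtain ⟨k, hk1, hk2⟩ := ((ENNReal.tendsto_nhds_zero.1 hlim _ hpos).and
    (hρlim.eventually (lt_mem_nhds (by norm_num : (1 / 2 : ℝ) < 1)))).exists
  refine ⟨ρ k, ⟨hk2, (hρI k).2⟩, fun ζ hζ δ hδ ↦ ?_⟩
  rcases lt_or_ge δ δ₀ with hlt | hge
  · exact (Measure.restrict_apply_le _ _).trans (hsmall δ ⟨hδ, hlt⟩ ζ hζ)
  · rw [Measure.restrict_apply' (measurableSet_le measurable_const measurable_norm)]
    have hsub : cBox ζ δ ∩ {z | ρ k ≤ ‖z‖} ⊆ A (ρ k) := fun z hz ↦ ⟨hz.1.1, hz.2⟩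
    refine (measure_mono hsub).trans (hk1.trans (mul_le_mul_right (ENNReal.ofReal_le_ofReal ?_) _))
    exact pow_le_pow_left₀ hd0.le (by linarith) n

variable [NeZero n]

lemma nuW_restrict_le {ρ : ℝ} (hρ : 1 / 2 ≤ ρ) :
    (nuW n g 1).restrict {z | ρ ≤ ‖z‖} ≤
      ENNReal.ofReal (4 * 4 ^ n) • (muJ n g).restrict {z | ρ ≤ ‖z‖} := by
  have hm : MeasurableSet {z : En n | ρ ≤ ‖z‖} := measurableSet_le measurable_const measurable_norm
  have hmeas : Measurable fun z : En n ↦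
      (‖radD g z‖₊ : ℝ≥0∞) ^ 2 * ENNReal.ofReal (1 - ‖z‖ ^ 2) :=
    ((measurable_radD g).enorm.pow_const 2).mul (by fun_prop)
  unfold nuW muJ
  rw [restrict_withDensity hm, restrict_withDensity hm, ← withDensity_smul _ hmeas]
  refine withDensity_mono ?_
  filter_upwards [ae_restrict_mem hm] with z hz
  have h : 1 / 2 ≤ ‖z‖ := hρ.trans hz
  refine (mul_le_mul_left (nuW_le_muJ h) _).trans_eq ?_
  rw [Pi.smul_apply, smul_eq_mul]
  change _ = _ * (‖radD g z‖ₑ ^ 2 * _)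
  ring

lemma VanishingCarleson.exists_lintegral_nuW_le (hg : DifferentiableOn ℂ g (Bn n))
    (h : VanishingCarleson (muJ n g)) {q : ℝ} (hq : 0 < q) {τ : ℝ≥0∞} (hτ : τ ≠ 0) (hτ' : τ ≠ ⊤) :
    ∃ ρ ∈ Ioo (0 : ℝ) 1, ∃ A : ℝ≥0∞, A ≠ ⊤ ∧ ∀ f : En n → ℂ, DifferentiableOn ℂ f (Bn n) →
      ∀ b : ℝ≥0∞, (∀ z, ‖z‖ ≤ ρ → ‖f z‖ₑ ^ q ≤ b) →
        ∫⁻ z, ‖f z‖ₑ ^ q ∂nuW n g 1 ≤ A * b + τ * hMean n q f := by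
  have hC0 : 0 < carlC n q := by
    unfold carlC
    positivity
  set C : ℝ≥0∞ := ENNReal.ofReal (4 * 4 ^ n) * ENNReal.ofReal (carlC n q) with hC
  have hCpos : C ≠ 0 := (ENNReal.mul_pos (ENNReal.ofReal_pos.2 (by positivity)).ne'
    (ENNReal.ofReal_pos.2 hC0).ne').ne'
  have hCtop : C ≠ ⊤ := by finiteness
  obtain ⟨ρ, hρ, hN⟩ := h.exists_restrict_le (τ := τ / C) (ENNReal.div_pos hτ hCtop).ne'
    (ENNReal.div_ne_top hτ' hCpos)
  have hρ0 : ρ ∈ Ioo (0 : ℝ) 1 := ⟨by linarith [hρ.1], hρ.2⟩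
  refine ⟨ρ, hρ0, nuW n g 1 (closedBall 0 ρ), (nuW_closedBall_lt_top hg hρ0).ne,
    fun f hf b hb ↦ ?_⟩
  rw [← lintegral_add_compl _ (measurableSet_closedBall (x := (0 : En n)) (ε := ρ))]
  refine add_le_add ?_ ?_
  · refine (setLIntegral_mono' measurableSet_closedBall fun z hz ↦
      hb z (mem_closedBall_zero_iff.1 hz)).trans_eq ?_
    rw [setLIntegral_const, mul_comm]
  · have hsub : (closedBall (0 : En n) ρ)ᶜ ⊆ {z | ρ ≤ ‖z‖} := fun z hz ↦ by
      have h1 : ¬ ‖z‖ ≤ ρ := fun hle ↦ hz (mem_closedBall_zero_iff.2 hle)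
      exact (not_le.1 h1).le
    set μ := (muJ n g).restrict {z | ρ ≤ ‖z‖} with hμ
    have hμB : μ.restrict (Bn n) = μ := Measure.restrict_eq_self_of_ae_mem
      (Measure.absolutelyContinuous_of_le Measure.restrict_le_self
        |>.ae_le (mem_ae_iff.2 (muJ_compl_Bn g)))
    calc ∫⁻ z in (closedBall 0 ρ)ᶜ, ‖f z‖ₑ ^ q ∂nuW n g 1
        ≤ ∫⁻ z in {z | ρ ≤ ‖z‖}, ‖f z‖ₑ ^ q ∂nuW n g 1 := lintegral_mono_set hsub
      _ ≤ ∫⁻ z, ‖f z‖ₑ ^ q ∂(ENNReal.ofReal (4 * 4 ^ n) • μ) :=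
          lintegral_mono' (nuW_restrict_le hρ.1.le) le_rfl
      _ = ENNReal.ofReal (4 * 4 ^ n) * ∫⁻ z in Bn n, ‖f z‖ₑ ^ q ∂μ := by
          rw [lintegral_smul_measure, hμB, smul_eq_mul]
      _ ≤ ENNReal.ofReal (4 * 4 ^ n) * (ENNReal.ofReal (carlC n q) * (τ / C) * hMean n q f) :=
          mul_le_mul_right (lintegral_Bn_le_hMean hN hf hq) _
      _ = C * (τ / C) * hMean n q f := by
          rw [hC]
          ring
      _ = τ * hMean n q f := by rw [ENNReal.mul_div_cancel hCpos hCtop]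

lemma VanishingCarleson.exists_hMean_le (hg : DifferentiableOn ℂ g (Bn n))
    (h : VanishingCarleson (muJ n g)) {q : ℝ} (hq : 0 < q) (hq2 : q ≤ 2) {τ : ℝ≥0∞} (hτ : τ ≠ 0)
    (hτ' : τ ≠ ⊤) : ∃ ρ ∈ Ioo (0 : ℝ) 1, ∃ A : ℝ≥0∞, A ≠ ⊤ ∧ ∀ f F : En n → ℂ,
      DifferentiableOn ℂ f (Bn n) → DifferentiableOn ℂ F (Bn n) → F 0 = 0 →
      (∀ z ∈ Bn n, radD F z = f z * radD g z) → ∀ b : ℝ≥0∞, (∀ z, ‖z‖ ≤ ρ → ‖f z‖ₑ ^ q ≤ b) →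
        hMean n q F ≤ A * b + τ * hMean n q f := by
  have hτ2 : τ / 2 ≠ 0 := (ENNReal.half_pos hτ).ne'
  have hτ2' : τ / 2 ≠ ⊤ := ENNReal.div_ne_top hτ' two_ne_zero
  have ht : 0 < (τ / 2).toReal := ENNReal.toReal_pos hτ2 hτ2'
  set c : ℝ := 2 / q * 3 ^ (q / 2) with hc
  have hc0 : 0 < c := by positivity
  set η : ℝ := ((τ / 2).toReal / c) ^ q⁻¹ with hη
  have hη0 : 0 < η := by positivity
  have hηq : ENNReal.ofReal (c * η ^ q) = τ / 2 := by
    rw [hη, ← Real.rpow_mul (by positivity), inv_mul_cancel₀ hq.ne', Real.rpow_one,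
      mul_div_cancel₀ _ hc0.ne', ENNReal.ofReal_toReal hτ2']
  set B : ℝ≥0∞ := ENNReal.ofReal (η ^ (q - 2)) with hB
  have hB0 : B ≠ 0 := (ENNReal.ofReal_pos.2 (by positivity)).ne'
  have hBtop : B ≠ ⊤ := ENNReal.ofReal_ne_top
  obtain ⟨ρ, hρ, A, hA, hmain⟩ := h.exists_lintegral_nuW_le hg hq (τ := τ / 2 / B)
    (ENNReal.div_pos hτ2 hBtop).ne' (ENNReal.div_ne_top hτ2' hB0)
  refine ⟨ρ, hρ, B * A, ENNReal.mul_ne_top hBtop hA, fun f F hf hF hF0 hR b hb ↦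
    iSup₂_le fun R hRI ↦ ?_⟩
  refine (lintegral_primitive_le hf hF hF0 hR hq hq2 hη0 hRI).trans ?_
  rw [← hB, ← hc, hηq]
  calc B * ∫⁻ z, ‖f z‖ₑ ^ q ∂nuW n g 1 + τ / 2 * ∫⁻ ζ, ‖f (R • ζ)‖ₑ ^ q ∂sigmaS n
      ≤ B * (A * b + τ / 2 / B * hMean n q f) + τ / 2 * hMean n q f :=
        add_le_add (mul_le_mul_right (hmain f hf b hb) _) (mul_le_mul_right (le_hMean hRI) _)
    _ = B * A * b + (B * (τ / 2 / B) * hMean n q f + τ / 2 * hMean n q f) := by ring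
    _ = B * A * b + τ * hMean n q f := by
        rw [ENNReal.mul_div_cancel hB0 hBtop, ← add_mul, ENNReal.add_halves]

end VanishingCarleson

section Boundedness

variable {n : ℕ} {f F g : En n → ℂ}

lemma ENNReal_le_rpow_mul_of_le {X Y D : ℝ≥0∞} {t : ℝ} (ht : 0 < t) (hX : X ≠ ⊤)
    (h : X ≤ D * (X ^ (1 - t) * Y ^ t)) : X ≤ D ^ (1 / t) * Y := by
  rcases eq_or_ne X 0 with rfl | hX0
  · exact zero_le
  have h0 : X ^ (1 - t) ≠ 0 := (ENNReal.rpow_pos (pos_iff_ne_zero.2 hX0) hX).ne'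
  have h1 : X ^ (1 - t) ≠ ⊤ := ENNReal.rpow_ne_top_of_ne_zero hX0 hX
  have h2 : X ^ t ≤ D * Y ^ t := by
    rw [← ENNReal.mul_le_mul_iff_right h0 h1, ← ENNReal.rpow_add _ _ hX0 hX, sub_add_cancel,
      ENNReal.rpow_one]
    refine h.trans_eq ?_
    ring
  have h3 := ENNReal.rpow_le_rpow h2 (one_div_pos.2 ht).le
  rw [← ENNReal.rpow_mul, mul_one_div_cancel ht.ne', ENNReal.rpow_one,
    ENNReal.mul_rpow_of_nonneg _ _ (one_div_pos.2 ht).le, ← ENNReal.rpow_mul,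
    mul_one_div_cancel ht.ne', ENNReal.rpow_one] at h3
  exact h3

lemma aemeasurable_sphere [NeZero n] (hf : ContinuousOn f (Bn n)) {R : ℝ}
    (hR : R ∈ Ioo (0 : ℝ) 1) : AEMeasurable (fun ζ ↦ f (R • ζ)) (sigmaS n) := by
  refine (aestronglyMeasurable_comp_of_mem_Bn hf (measurable_const_smul R) ?_).aemeasurable
  filter_upwards [ae_norm_eq_one_sigmaS] with ζ hζ
  exact real_smul_mem_Bn_of_norm_eq_one ⟨hR.1.le, hR.2⟩ hζ

lemma hMean_le_of_norm_le [NeZero n] {c q : ℝ} (hc : 0 ≤ c) (hq : 0 ≤ q)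
    (h : ∀ z ∈ Bn n, ‖f z‖ ≤ c * ‖F z‖) :
    hMean n q f ≤ ENNReal.ofReal (c ^ q) * hMean n q F := by
  refine iSup₂_le fun R hR ↦ le_trans ?_ (mul_le_mul_right (le_hMean hR) _)
  rw [← lintegral_const_mul' _ _ ENNReal.ofReal_ne_top]
  refine lintegral_mono_ae ?_
  filter_upwards [ae_norm_eq_one_sigmaS] with ζ hζ
  rw [← ENNReal.ofReal_rpow_of_nonneg hc hq, ← ENNReal.mul_rpow_of_nonneg _ _ hq]
  refine ENNReal.rpow_le_rpow ?_ hq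
  rw [← ofReal_norm, ← ofReal_norm, ← ENNReal.ofReal_mul hc]
  exact ENNReal.ofReal_le_ofReal (h _ (real_smul_mem_Bn_of_norm_eq_one ⟨hR.1.le, hR.2⟩ hζ))

lemma hMean_pow {p : ℝ} {m : ℕ} (hm : m ≠ 0) (f : En n → ℂ) :
    hMean n (p / m) (fun z ↦ f z ^ m) = hMean n p f := by
  have hm' : (m : ℝ) ≠ 0 := Nat.cast_ne_zero.2 hm
  unfold hMean
  refine iSup_congr fun R ↦ iSup_congr fun _ ↦ lintegral_congr fun ζ ↦ ?_
  rw [enorm_pow, ← ENNReal.rpow_natCast, ← ENNReal.rpow_mul, mul_div_cancel₀ _ hm']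

lemma hMean_one [NeZero n] (q : ℝ) : hMean n q (fun _ ↦ 1) ≤ 1 := by
  refine iSup₂_le fun R _ ↦ ?_
  simp

lemma hMean_dilate_le {ρ : ℝ} (hρ : ρ ∈ Ioo (0 : ℝ) 1) (q : ℝ) :
    hMean n q (fun z ↦ f (ρ • z)) ≤ hMean n q f := by
  refine iSup₂_le fun R hR ↦ ?_
  simp only [smul_smul]
  exact le_hMean ⟨mul_pos hρ.1 hR.1, by nlinarith [hρ.1, hρ.2, hR.1, hR.2]⟩

lemma hMean_mul_pow_le [NeZero n] (hf : DifferentiableOn ℂ f (Bn n))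
    (hF : DifferentiableOn ℂ F (Bn n)) {p : ℝ} (hp : 0 < p) {m : ℕ} (hm : m ≠ 0) :
    hMean n (p / m) (fun z ↦ m * F z ^ (m - 1) * f z) ≤ ENNReal.ofReal ((m : ℝ) ^ (p / m)) *
      (hMean n p F ^ (1 - 1 / (m : ℝ)) * hMean n p f ^ (1 / (m : ℝ))) := by
  have hm0 : (0 : ℝ) < m := Nat.cast_pos.2 (Nat.pos_of_ne_zero hm)
  have hm1 : (1 : ℝ) ≤ m := Nat.one_le_cast.2 (Nat.pos_of_ne_zero hm)
  have h1 : 0 ≤ 1 - 1 / (m : ℝ) := by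
    rw [sub_nonneg, div_le_one hm0]
    exact hm1
  have h2 : 0 ≤ 1 / (m : ℝ) := by positivity
  have hq : 0 < p / m := by positivity
  refine iSup₂_le fun R hR ↦ ?_
  have h3 : ∀ z, ‖(m : ℂ) * F z ^ (m - 1) * f z‖ₑ ^ (p / m) = ENNReal.ofReal ((m : ℝ) ^ (p / m)) *
      ((‖F z‖ₑ ^ p) ^ (1 - 1 / (m : ℝ)) * (‖f z‖ₑ ^ p) ^ (1 / (m : ℝ))) := by
    intro z
    rw [enorm_mul, enorm_mul, enorm_pow, ENNReal.mul_rpow_of_nonneg _ _ hq.le,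
      ENNReal.mul_rpow_of_nonneg _ _ hq.le, ← ofReal_norm (m : ℂ), Complex.norm_natCast,
      ENNReal.ofReal_rpow_of_nonneg hm0.le hq.le, ← ENNReal.rpow_natCast, ← ENNReal.rpow_mul,
      ← ENNReal.rpow_mul, ← ENNReal.rpow_mul, mul_assoc, Nat.cast_sub (Nat.one_le_iff_ne_zero.2 hm)]
    congr 3
    · field_simp
      simp
    · field_simp
  simp only [h3]
  rw [lintegral_const_mul' _ _ ENNReal.ofReal_ne_top]
  refine mul_le_mul_right ((ENNReal.lintegral_mul_norm_pow_le
    ((aemeasurable_sphere hF.continuousOn hR).enorm.pow_const p)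
    ((aemeasurable_sphere hf.continuousOn hR).enorm.pow_const p) h1 h2 (by ring)).trans ?_) _
  gcongr
  · exact le_hMean hR
  · exact le_hMean hR

lemma exists_enorm_rpow_le_hMean [NeZero n] {q : ℝ} (hq : 0 < q) {ρ : ℝ} (hρ : ρ ∈ Ioo (0 : ℝ) 1) :
    ∃ K : ℝ≥0∞, K ≠ ⊤ ∧ ∀ f : En n → ℂ, DifferentiableOn ℂ f (Bn n) → ∀ z, ‖z‖ ≤ ρ →
      ‖f z‖ₑ ^ q ≤ K * hMean n q f := by
  set r := Real.sqrt ((1 + ρ) / 2) with hr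
  have hr2 : r ^ 2 = (1 + ρ) / 2 := Real.sq_sqrt (by linarith [hρ.1])
  have hr0 : 0 < r := Real.sqrt_pos.2 (by linarith [hρ.1])
  have hr1 : r < 1 := by nlinarith [hρ.2]
  refine ⟨3 ^ (q / 2) * (2 * (3 ^ (q / 2) * ENNReal.ofReal ((4 / (1 - r) ^ 2) ^ n))),
    by finiteness, fun f hf z hz ↦ ?_⟩
  set a := r⁻¹ • z with ha
  have hna : ‖a‖ = r⁻¹ * ‖z‖ := by rw [ha, norm_smul, Real.norm_of_nonneg (inv_nonneg.2 hr0.le)]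
  have har : ‖a‖ < r := by
    rw [hna, inv_mul_lt_iff₀ hr0]
    nlinarith [hρ.2]
  have hra : r • a = z := by rw [ha, smul_smul, mul_inv_cancel₀ hr0.ne', one_smul]
  have h := enorm_rpow_le_poisson hf hq hr1 har
  rw [hra] at h
  refine h.trans ?_
  have h2 : ∫⁻ ζ, ENNReal.ofReal (autK a ζ ^ n) * ‖f (r • ζ)‖ₑ ^ q ∂sigmaS n ≤
      ENNReal.ofReal ((4 / (1 - r) ^ 2) ^ n) * hMean n q f := by
    refine le_trans ?_ (mul_le_mul_right (le_hMean ⟨hr0, hr1⟩) _)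
    rw [← lintegral_const_mul' _ _ ENNReal.ofReal_ne_top]
    refine lintegral_mono_ae ?_
    filter_upwards [ae_norm_eq_one_sigmaS] with ζ hζ
    have ha1 : ‖a‖ < 1 := har.trans hr1
    refine mul_le_mul_left (ENNReal.ofReal_le_ofReal (pow_le_pow_left₀
      (autK_pos ha1 hζ.le).le ((autK_bounds ha1 hζ.le).2.trans ?_) n)) _
    have : 0 < 1 - r := by linarith
    gcongr
  refine (mul_le_mul_right (mul_le_mul_right (mul_le_mul_right h2 _) _) _).trans_eq ?_
  ring

lemma exists_norm_J_le (hg : DifferentiableOn ℂ g (Bn n)) {r : ℝ} (hr : r < 1) :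
    ∃ C, 0 ≤ C ∧ ∀ (f : En n → ℂ) (b : ℝ), (∀ w, ‖w‖ ≤ r → ‖f w‖ ≤ b) → ∀ z, ‖z‖ ≤ r →
      ‖J g f z‖ ≤ C * b := by
  obtain ⟨C, hC0, hC⟩ := exists_norm_le_mul_norm (differentiableOn_radD hg) (radD_zero g) hr
  refine ⟨C, hC0, fun f b hb z hz ↦ ?_⟩
  have hb0 : 0 ≤ b := (norm_nonneg _).trans (hb z hz)
  have h : ∀ t ∈ Ioo (0 : ℝ) 1, ‖f (t • z) * radD g (t • z) / (t : ℂ)‖ ≤ C * b := by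
    intro t ht
    have hn : ‖t • z‖ = t * ‖z‖ := by rw [norm_smul, Real.norm_of_nonneg ht.1.le]
    have hle : ‖t • z‖ ≤ r := by
      rw [hn]
      nlinarith [norm_nonneg z, ht.2]
    have hz1 : ‖z‖ ≤ 1 := hz.trans hr.le
    rw [norm_div, norm_mul, Complex.norm_real, Real.norm_of_nonneg ht.1.le, div_le_iff₀ ht.1]
    have h1 := hC _ hle
    rw [hn] at h1
    calc ‖f (t • z)‖ * ‖radD g (t • z)‖ ≤ b * (C * (t * ‖z‖)) := by
          gcongr
          exact hb _ hle
      _ ≤ b * (C * (t * 1)) := by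
          have := ht.1
          gcongr
      _ = C * b * t := by ring
  have h2 := norm_setIntegral_le_of_norm_le_const (μ := volume) (s := Ioo (0 : ℝ) 1) (by simp) h
  simpa [J] using h2

lemma J_sub (hg : DifferentiableOn ℂ g (Bn n)) (hf : DifferentiableOn ℂ f (Bn n))
    (hF : DifferentiableOn ℂ F (Bn n)) {z : En n} (hz : z ∈ Bn n) :
    J g (fun w ↦ f w - F w) z = J g f z - J g F z := by
  have h1 := differentiableOn_J hg hf
  have h2 := differentiableOn_J hg hF
  refine J_eq_of_radD_eq (G := fun z ↦ J g f z - J g F z) (h1.sub h2) (by simp [J_zero])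
    (fun w hw ↦ ?_) hz
  have e : radD (fun z ↦ J g f z - J g F z) w = radD (J g f) w - radD (J g F) w := by
    unfold radD
    rw [fderiv_fun_sub (h1.differentiableAt_of_mem_Bn hw) (h2.differentiableAt_of_mem_Bn hw)]
    rfl
  rw [e, radD_J hg hf hw, radD_J hg hF hw, sub_mul]

lemma differentiableOn_dilate (hf : DifferentiableOn ℂ f (Bn n)) {ρ : ℝ} (hρ : ρ ∈ Icc (0 : ℝ) 1) :
    DifferentiableOn ℂ (fun z ↦ f (ρ • z)) (Bn n) := by
  have h : DifferentiableOn ℂ (fun z : En n ↦ (ρ : ℂ) • z) (Bn n) :=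
    (differentiable_id.const_smul (ρ : ℂ)).differentiableOn
  exact hf.comp h fun z hz ↦ real_smul_mem_Bn hz hρ

lemma tendsto_J_dilate (hg : DifferentiableOn ℂ g (Bn n)) (hf : DifferentiableOn ℂ f (Bn n))
    {ρ : ℕ → ℝ} (hρ : ∀ k, ρ k ∈ Ioo (0 : ℝ) 1) (hlim : Tendsto ρ atTop (𝓝 1)) {z : En n}
    (hz : z ∈ Bn n) : Tendsto (fun k ↦ J g (fun w ↦ f (ρ k • w)) z) atTop (𝓝 (J g f z)) := by
  set r := ‖z‖ with hr
  have hr1 : r < 1 := mem_Bn.1 hz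
  obtain ⟨C, hC0, hC⟩ := exists_norm_J_le hg hr1
  have huc := (isCompact_closedBall (0 : En n) r).uniformContinuousOn_of_continuous
    (hf.continuousOn.mono (closedBall_subset_ball hr1))
  rw [Metric.tendsto_atTop']
  intro ε hε
  obtain ⟨δ, hδ, hd⟩ := Metric.uniformContinuousOn_iff.1 huc (ε / (C + 1)) (by positivity)
  obtain ⟨N, hN⟩ := Metric.tendsto_atTop'.1 hlim δ hδ
  refine ⟨N, fun k hk ↦ ?_⟩
  have hk' := hN k hk
  have hρI : ρ k ∈ Icc (0 : ℝ) 1 := ⟨(hρ k).1.le, (hρ k).2.le⟩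
  rw [dist_eq_norm, ← J_sub hg (differentiableOn_dilate hf hρI) hf hz]
  have hb : ∀ w : En n, ‖w‖ ≤ r → ‖f (ρ k • w) - f w‖ ≤ ε / (C + 1) := by
    intro w hw
    rw [← dist_eq_norm]
    have hρw : ‖ρ k • w‖ ≤ r := by
      rw [norm_smul, Real.norm_of_nonneg hρI.1]
      nlinarith [norm_nonneg w, hρI.2]
    refine (hd _ (mem_closedBall_zero_iff.2 hρw) _ (mem_closedBall_zero_iff.2 hw) ?_).le
    have e : ρ k • w - w = (ρ k - 1) • w := by rw [sub_smul, one_smul]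
    rw [dist_eq_norm, e, norm_smul]
    rw [Real.dist_eq] at hk'
    refine lt_of_le_of_lt ?_ hk'
    exact mul_le_of_le_one_right (norm_nonneg _) (hw.trans hr1.le)
  refine (hC _ _ hb z le_rfl).trans_lt ?_
  rw [mul_div_assoc', div_lt_iff₀ (by positivity)]
  nlinarith

lemma radD_J_pow (hg : DifferentiableOn ℂ g (Bn n)) (hf : DifferentiableOn ℂ f (Bn n)) (m : ℕ)
    {z : En n} (hz : z ∈ Bn n) :
    radD (fun w ↦ J g f w ^ m) z = m * J g f z ^ (m - 1) * f z * radD g z := by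
  rw [radD_pow (differentiableOn_J hg hf) m hz, radD_J hg hf hz]
  ring

variable [NeZero n]

lemma VanishingCarleson.exists_hMean_primitive_le (hg : DifferentiableOn ℂ g (Bn n))
    (h : VanishingCarleson (muJ n g)) {q : ℝ} (hq : 0 < q) (hq2 : q ≤ 2) :
    ∃ C : ℝ≥0∞, C ≠ ⊤ ∧ ∀ f F : En n → ℂ, DifferentiableOn ℂ f (Bn n) →
      DifferentiableOn ℂ F (Bn n) → F 0 = 0 → (∀ z ∈ Bn n, radD F z = f z * radD g z) →
        hMean n q F ≤ C * hMean n q f := by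
  obtain ⟨ρ, hρ, A, hA, hmain⟩ := h.exists_hMean_le hg hq hq2 one_ne_zero ENNReal.one_ne_top
  obtain ⟨K, hK, hKle⟩ := exists_enorm_rpow_le_hMean (n := n) hq hρ
  refine ⟨A * K + 1, by finiteness, fun f F hf hF hF0 hR ↦ ?_⟩
  refine (hmain f F hf hF hF0 hR _ (hKle f hf)).trans_eq ?_
  ring

/-- Boundedness of the integration operator on bounded holomorphic functions. -/
lemma VanishingCarleson.hMean_J_lt_top (hg : DifferentiableOn ℂ g (Bn n))
    (h : VanishingCarleson (muJ n g)) {q : ℝ} (hq : 0 < q) (hq2 : q ≤ 2)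
    (hf : DifferentiableOn ℂ f (Bn n)) {B : ℝ} (hB : ∀ z ∈ Bn n, ‖f z‖ ≤ B) (m : ℕ) :
    hMean n q (fun z ↦ J g f z ^ m) < ⊤ := by
  obtain ⟨C, hC, hmain⟩ := h.exists_hMean_primitive_le hg hq hq2
  have hJ := differentiableOn_J hg hf
  have hB0 : 0 ≤ B := (norm_nonneg _).trans (hB 0 (mem_Bn.2 (by simp)))
  induction m with
  | zero =>
    simp only [pow_zero]
    exact (hMean_one q).trans_lt ENNReal.one_lt_top
  | succ m ih =>
    have hd : DifferentiableOn ℂ (fun z ↦ ((m + 1 : ℕ) : ℂ) * J g f z ^ m * f z) (Bn n) :=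
      ((hJ.pow m).const_mul _).mul hf
    refine (hmain _ _ hd (hJ.pow (m + 1)) (by simp [J_zero]) fun z hz ↦ ?_).trans_lt ?_
    · exact radD_J_pow hg hf (m + 1) hz
    · refine ENNReal.mul_lt_top hC.lt_top ((hMean_le_of_norm_le (c := (m + 1 : ℕ) * B)
        (F := fun z ↦ J g f z ^ m) (by positivity) hq.le fun z hz ↦ ?_).trans_lt
          (ENNReal.mul_lt_top ENNReal.ofReal_lt_top ih))
      rw [norm_mul, norm_mul, Complex.norm_natCast, mul_right_comm]
      gcongr
      exact hB z hz

lemma VanishingCarleson.exists_hMean_J_le (hg : DifferentiableOn ℂ g (Bn n))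
    (h : VanishingCarleson (muJ n g)) {p : ℝ} (hp : 0 < p) :
    ∃ D : ℝ≥0∞, D ≠ ⊤ ∧ ∀ f : En n → ℂ, DifferentiableOn ℂ f (Bn n) →
      hMean n p (J g f) ≤ D * hMean n p f := by
  obtain ⟨m, hm⟩ := exists_nat_gt p
  have hm0' : (0 : ℝ) < m := hp.trans hm
  have hm0 : m ≠ 0 := Nat.cast_ne_zero.1 hm0'.ne'
  have hq : 0 < p / m := by positivity
  have hq2 : p / m ≤ 2 := by
    rw [div_le_iff₀ hm0']
    linarith
  obtain ⟨C, hC, hmain⟩ := h.exists_hMean_primitive_le hg hq hq2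
  set D : ℝ≥0∞ := (C * ENNReal.ofReal ((m : ℝ) ^ (p / m))) ^ (1 / (1 / (m : ℝ))) with hD
  have hDtop : D ≠ ⊤ := ENNReal.rpow_ne_top_of_nonneg (by positivity) (by finiteness)
  have hbdd : ∀ f : En n → ℂ, DifferentiableOn ℂ f (Bn n) → (∃ B, ∀ z ∈ Bn n, ‖f z‖ ≤ B) →
      hMean n p (J g f) ≤ D * hMean n p f := by
    rintro f hf ⟨B, hB⟩
    have hJ := differentiableOn_J hg hf
    refine ENNReal_le_rpow_mul_of_le (by positivity) ?_ ?_
    · rw [← hMean_pow hm0]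
      exact (h.hMean_J_lt_top hg hq hq2 hf hB m).ne
    · rw [mul_assoc]
      refine le_trans ?_ (mul_le_mul_right (hMean_mul_pow_le hf hJ hp hm0) C)
      rw [← hMean_pow hm0 (J g f)]
      exact hmain _ _ (((hJ.pow (m - 1)).const_mul _).mul hf) (hJ.pow m)
        (by simp [J_zero, hm0]) fun z hz ↦ radD_J_pow hg hf m hz
  refine ⟨D, hDtop, fun f hf ↦ iSup₂_le fun R hR ↦ ?_⟩
  obtain ⟨ρ, -, hρ, hρlim⟩ := exists_seq_strictMono_tendsto' (zero_lt_one (α := ℝ))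
  have hρI : ∀ k, ρ k ∈ Icc (0 : ℝ) 1 := fun k ↦ ⟨(hρ k).1.le, (hρ k).2.le⟩
  have hfd : ∀ k, DifferentiableOn ℂ (fun w ↦ f (ρ k • w)) (Bn n) := fun k ↦
    differentiableOn_dilate hf (hρI k)
  calc ∫⁻ ζ, ‖J g f (R • ζ)‖ₑ ^ p ∂sigmaS n
      = ∫⁻ ζ, liminf (fun k ↦ ‖J g (fun w ↦ f (ρ k • w)) (R • ζ)‖ₑ ^ p) atTop ∂sigmaS n := by
        refine lintegral_congr_ae ?_
        filter_upwards [ae_norm_eq_one_sigmaS] with ζ hζ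
        have hm := real_smul_mem_Bn_of_norm_eq_one ⟨hR.1.le, hR.2⟩ hζ
        exact (((ENNReal.continuous_rpow_const (y := p)).tendsto _).comp
          (tendsto_J_dilate hg hf hρ hρlim hm).enorm).liminf_eq.symm
    _ ≤ liminf (fun k ↦ ∫⁻ ζ, ‖J g (fun w ↦ f (ρ k • w)) (R • ζ)‖ₑ ^ p ∂sigmaS n) atTop :=
        lintegral_liminf_le' fun k ↦
          (aemeasurable_sphere (differentiableOn_J hg (hfd k)).continuousOn hR).enorm.pow_const p
    _ ≤ D * hMean n p f := by
        refine liminf_le_of_le (by isBoundedDefault) fun c hc ↦ ?_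
        obtain ⟨k, hk⟩ := hc.exists
        refine hk.trans ((le_hMean hR).trans ((hbdd _ (hfd k) ?_).trans
          (mul_le_mul_right (hMean_dilate_le (hρ k) p) _)))
        obtain ⟨B, -, hB⟩ := exists_norm_le_of_continuousOn_Bn hf.continuousOn (hρ k).2
        refine ⟨B, fun z hz ↦ hB _ ?_⟩
        rw [norm_smul, Real.norm_of_nonneg (hρ k).1.le]
        exact mul_le_of_le_one_right (hρ k).1.le (mem_Bn.1 hz).le

end Boundedness

section Compactness

variable {n : ℕ} [NeZero n] {g : En n → ℂ}

lemma VanishingCarleson.eventually_hMean_J_le (hg : DifferentiableOn ℂ g (Bn n))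
    (h : VanishingCarleson (muJ n g)) {p : ℝ} (hp : 0 < p) {f : ℕ → En n → ℂ}
    (hf : ∀ k, DifferentiableOn ℂ (f k) (Bn n)) {B : ℝ≥0∞} (hB : B ≠ ⊤)
    (hfB : ∀ k, hMean n p (f k) ≤ B)
    (hlim : ∀ K ⊆ Bn n, IsCompact K → TendstoUniformlyOn (fun k ↦ f k) 0 atTop K)
    {ε : ℝ≥0∞} (hε : ε ≠ 0) (hε' : ε ≠ ⊤) :
    ∀ᶠ k in atTop, hMean n p (J g (f k)) ≤ ε := by
  obtain ⟨m, hm⟩ := exists_nat_gt p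
  have hm0' : (0 : ℝ) < m := hp.trans hm
  have hm0 : m ≠ 0 := Nat.cast_ne_zero.1 hm0'.ne'
  have hm1 : (1 : ℝ) ≤ m := Nat.one_le_cast.2 (Nat.pos_of_ne_zero hm0)
  have hq : 0 < p / m := by positivity
  have hq2 : p / m ≤ 2 := by
    rw [div_le_iff₀ hm0']
    linarith
  have hexp : 0 ≤ 1 - 1 / (m : ℝ) := by
    rw [sub_nonneg, div_le_one hm0']
    exact hm1
  have hexp' : 0 ≤ 1 / (m : ℝ) := by positivity
  obtain ⟨D, hD, hDle⟩ := h.exists_hMean_J_le hg hp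
  set L : ℝ≥0∞ := ENNReal.ofReal ((m : ℝ) ^ (p / m)) *
    ((D * B) ^ (1 - 1 / (m : ℝ)) * B ^ (1 / (m : ℝ))) with hL
  have hLtop : L ≠ ⊤ := ENNReal.mul_ne_top ENNReal.ofReal_ne_top
    (ENNReal.mul_ne_top (ENNReal.rpow_ne_top_of_nonneg hexp (ENNReal.mul_ne_top hD hB))
      (ENNReal.rpow_ne_top_of_nonneg hexp' hB))
  have hhalf : ε / 2 ≠ 0 := (ENNReal.half_pos hε).ne'
  have hhalf' : ε / 2 ≠ ⊤ := ENNReal.div_ne_top hε' two_ne_zero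
  have hdiv : ∀ X : ℝ≥0∞, X ≠ ⊤ → ε / 2 / (X + 1) ≠ 0 ∧ X * (ε / 2 / (X + 1)) ≤ ε / 2 := by
    refine fun X hX ↦ ⟨(ENNReal.div_pos hhalf (by finiteness)).ne', ?_⟩
    calc X * (ε / 2 / (X + 1)) ≤ (X + 1) * (ε / 2 / (X + 1)) := by
          gcongr
          exact le_self_add
      _ = ε / 2 := ENNReal.mul_div_cancel (by simp) (by finiteness)
  obtain ⟨ρ, hρ, A, hA, hmain⟩ := h.exists_hMean_le hg hq hq2 (hdiv L hLtop).1
    (ENNReal.div_ne_top hhalf' (by simp))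
  obtain ⟨C, hC0, hC⟩ := exists_norm_J_le hg hρ.2
  set b : ℝ≥0∞ := ε / 2 / (A + 1) with hb
  have hsmall : ∀ᶠ c : ℝ in 𝓝[>] 0, ENNReal.ofReal (m * (C * c) ^ (m - 1) * c) ^ (p / m) < b := by
    have hcont : Continuous fun c : ℝ ↦ ENNReal.ofReal (m * (C * c) ^ (m - 1) * c) ^ (p / m) := by
      refine (ENNReal.continuous_rpow_const (y := p / m)).comp (ENNReal.continuous_ofReal.comp ?_)
      fun_prop
    have h0 := hcont.tendsto 0
    rw [mul_zero (m * (C * 0) ^ (m - 1) : ℝ), ENNReal.ofReal_zero, ENNReal.zero_rpow_of_pos hq] at h0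
    exact (h0.mono_left nhdsWithin_le_nhds).eventually_lt_const
      (pos_iff_ne_zero.2 (hdiv A hA).1)
  obtain ⟨c, hcb, hc0⟩ := (hsmall.and self_mem_nhdsWithin).exists
  have hc0 : 0 < c := hc0
  filter_upwards [Metric.tendstoUniformlyOn_iff.1
    (hlim (closedBall 0 ρ) (closedBall_subset_ball hρ.2) (isCompact_closedBall 0 ρ)) c hc0] with k hk
  have hfk : ∀ w : En n, ‖w‖ ≤ ρ → ‖f k w‖ ≤ c := by
    intro w hw
    have := hk w (mem_closedBall_zero_iff.2 hw)
    simpa using this.le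
  have hJ := differentiableOn_J hg (hf k)
  rw [← hMean_pow hm0]
  refine (hmain (fun z ↦ m * J g (f k) z ^ (m - 1) * f k z) _
    (((hJ.pow (m - 1)).const_mul _).mul (hf k)) (hJ.pow m) (by simp [J_zero, hm0])
    (fun z hz ↦ radD_J_pow hg (hf k) m hz) b fun z hz ↦ ?_).trans ?_
  · refine le_trans (ENNReal.rpow_le_rpow ?_ hq.le) hcb.le
    rw [← ofReal_norm]
    refine ENNReal.ofReal_le_ofReal ?_
    rw [norm_mul, norm_mul, norm_pow, Complex.norm_natCast]
    gcongr
    · exact hC _ _ hfk z hz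
    · exact hfk z hz
  · have hle : hMean n (p / m) (fun z ↦ m * J g (f k) z ^ (m - 1) * f k z) ≤ L := by
      refine (hMean_mul_pow_le (hf k) hJ hp hm0).trans (mul_le_mul_right (mul_le_mul'
        (ENNReal.rpow_le_rpow ?_ hexp) (ENNReal.rpow_le_rpow (hfB k) hexp')) _)
      exact (hDle _ (hf k)).trans (mul_le_mul_right (hfB k) _)
    calc _ ≤ A * b + ε / 2 / (L + 1) * L := by gcongr
      _ ≤ ε / 2 + ε / 2 := by
          rw [mul_comm _ L]
          exact add_le_add (hdiv A hA).2 (hdiv L hLtop).2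
      _ = ε := ENNReal.add_halves ε

/-- If `|Rg|²(1-|z|²) dv` is a vanishing Carleson measure, then `J_g` is compact on `H^p`. -/
lemma VanishingCarleson.tendsto_hNorm_J (hg : DifferentiableOn ℂ g (Bn n))
    (h : VanishingCarleson (muJ n g)) {p : ℝ} (hp : 0 < p) {f : ℕ → En n → ℂ}
    (hf : ∀ k, DifferentiableOn ℂ (f k) (Bn n)) {M : ℝ≥0∞} (hM : M < ⊤)
    (hfM : ∀ k, hNorm n p (f k) ≤ M)
    (hlim : ∀ K ⊆ Bn n, IsCompact K → TendstoUniformlyOn (fun k ↦ f k) 0 atTop K) :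
    Tendsto (fun k ↦ hNorm n p (J g (f k))) atTop (𝓝 0) := by
  have hfB : ∀ k, hMean n p (f k) ≤ M ^ p := by
    intro k
    have := ENNReal.rpow_le_rpow (hfM k) hp.le
    rwa [hNorm_eq, ← ENNReal.rpow_mul, one_div_mul_cancel hp.ne', ENNReal.rpow_one] at this
  have h0 : Tendsto (fun k ↦ hMean n p (J g (f k))) atTop (𝓝 0) := by
    rw [ENNReal.tendsto_nhds_zero]
    intro ε hε
    filter_upwards [h.eventually_hMean_J_le hg hp hf
      (ENNReal.rpow_ne_top_of_nonneg hp.le hM.ne) hfB hlim (ε := min ε 1)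
      (by simp [hε.ne']) (by simp)] with k hk
    exact hk.trans (min_le_left _ _)
  have h1 := ((ENNReal.continuous_rpow_const (y := 1 / p)).tendsto 0).comp h0
  rwa [ENNReal.zero_rpow_of_pos (by positivity)] at h1

end Compactness

section TestFunctions

variable {n : ℕ} {a : En n} {p : ℝ}

/-- The normalized test function `((1-|a|²)/(1-⟨z,a⟩)²)^{n/p}`. -/
def testF (p : ℝ) (a z : En n) : ℂ :=
  (((1 - ‖a‖ ^ 2) ^ ((n : ℝ) / p) : ℝ) : ℂ) * powK a (-(2 * n / p)) z

lemma differentiableOn_testF (ha : ‖a‖ ≤ 1) : DifferentiableOn ℂ (testF p a) (Bn n) :=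
  (differentiableOn_powK ha _).const_mul _

lemma measurable_testF : Measurable (testF p a) := by
  unfold testF powK
  simp only [herm_eq_inner]
  fun_prop

lemma enorm_testF_rpow (hp : 0 < p) (ha : ‖a‖ < 1) {u : En n} (hu : ‖u‖ ≤ 1) :
    ‖testF p a u‖ₑ ^ p = ENNReal.ofReal (autK a u ^ n) := by
  have h0 : 0 ≤ 1 - ‖a‖ ^ 2 := by nlinarith [norm_nonneg a]
  rw [← enorm_powK_rpow ha hu hp rfl, testF, enorm_mul, ENNReal.mul_rpow_of_nonneg _ _ hp.le,
    ← ofReal_norm (_ : ℂ), Complex.norm_real, Real.norm_of_nonneg (by positivity),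
    ENNReal.ofReal_rpow_of_nonneg (by positivity) hp.le, ← Real.rpow_mul h0,
    div_mul_cancel₀ _ hp.ne', Real.rpow_natCast]

lemma hMean_testF_le [NeZero n] (hp : 0 < p) (ha : ‖a‖ < 1) :
    hMean n p (testF p a) ≤ 3 ^ (p / 2) * ENNReal.ofReal (6 * 2 ^ n) := by
  have hone : (1 : ℝ≥0∞) ≤ 3 ^ (p / 2) := ENNReal.one_le_rpow (by norm_num) (by positivity)
  have hbig : ∀ R : ℝ, 3 / 4 ≤ R → R < 1 →
      ∫⁻ ζ, ‖testF p a (R • ζ)‖ₑ ^ p ∂sigmaS n ≤ ENNReal.ofReal (6 * 2 ^ n) := by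
    intro R hR hR1
    refine le_trans (lintegral_mono_ae ?_)
      (lintegral_autK_smul_le ha (r₀ := R) (by linarith) hR1 (by nlinarith))
    filter_upwards [ae_norm_eq_one_sigmaS] with ζ hζ
    rw [enorm_testF_rpow hp ha]
    rw [norm_real_smul_eq (by linarith) hζ]
    exact hR1.le
  refine iSup₂_le fun R hR ↦ ?_
  rcases le_total (3 / 4) R with h | h
  · exact (hbig R h hR.2).trans (le_mul_of_one_le_left zero_le hone)
  · exact (lintegral_sphere_le (differentiableOn_testF ha.le) hp hR.1 h (by norm_num)).trans
      (mul_le_mul_right (hbig _ le_rfl (by norm_num)) _)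

lemma enorm_testF_rpow_le (hp : 0 < p) (ha : ‖a‖ < 1) {ρ : ℝ} (hρ : ρ < 1) {z : En n}
    (hz : ‖z‖ ≤ ρ) :
    ‖testF p a z‖ₑ ^ p ≤ ENNReal.ofReal (((1 - ‖a‖ ^ 2) / (1 - ρ) ^ 2) ^ n) := by
  rw [enorm_testF_rpow hp ha (hz.trans hρ.le)]
  refine ENNReal.ofReal_le_ofReal (pow_le_pow_left₀ (autK_pos ha (hz.trans hρ.le)).le ?_ n)
  have h0 : 0 ≤ 1 - ‖a‖ ^ 2 := by nlinarith [norm_nonneg a]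
  have h1 : 1 - ρ ≤ ‖1 - herm z a‖ := by
    have h2 := norm_sub_norm_le (1 : ℂ) (herm z a)
    rw [norm_one] at h2
    have h3 : ‖z‖ * ‖a‖ ≤ ρ * 1 :=
      mul_le_mul hz ha.le (norm_nonneg _) ((norm_nonneg z).trans hz)
    linarith [norm_herm_le z a]
  have h4 : 0 < 1 - ρ := by linarith
  unfold autK
  gcongr

lemma one_div_le_autK {ζ z : En n} (hζ : ‖ζ‖ = 1) {δ : ℝ} (hδ : 0 < δ) (hδ1 : δ ≤ 1)
    (hz : z ∈ cBox ζ δ) : 1 / (4 * δ) ≤ autK ((1 - δ) • ζ) z := by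
  have hz1 : ‖z‖ < 1 := mem_Bn.1 hz.1
  have hna : ‖(1 - δ) • ζ‖ = 1 - δ := norm_real_smul_eq (by linarith) hζ
  have hh : herm z ((1 - δ) • ζ) = (1 - δ : ℝ) * herm z ζ := by
    rw [herm_eq_inner, herm_eq_inner]
    simp
  have h1 : ‖1 - herm z ((1 - δ) • ζ)‖ ≤ 2 * δ := by
    rw [hh]
    have e : 1 - ((1 - δ : ℝ) : ℂ) * herm z ζ = (1 - herm z ζ) + (δ : ℂ) * herm z ζ := by
      push_cast
      ring
    rw [e]
    refine (norm_add_le _ _).trans ?_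
    rw [norm_mul, Complex.norm_real, Real.norm_of_nonneg hδ.le]
    have h2 := norm_herm_le z ζ
    rw [hζ, mul_one] at h2
    have h3 : ‖1 - herm z ζ‖ < δ := hz.2
    nlinarith
  have h2 : 0 < ‖1 - herm z ((1 - δ) • ζ)‖ := by
    refine norm_pos_iff.2 fun h ↦ ?_
    have h3 := norm_herm_le z ((1 - δ) • ζ)
    rw [← sub_eq_zero.1 h, norm_one, hna] at h3
    nlinarith [norm_nonneg z]
  unfold autK
  rw [hna, div_le_div_iff₀ (by positivity) (by positivity)]
  have h3 : ‖1 - herm z ((1 - δ) • ζ)‖ ^ 2 ≤ (2 * δ) ^ 2 := pow_le_pow_left₀ h2.le h1 2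
  nlinarith

lemma measure_cBox_le (hp : 0 < p) (ν : Measure (En n)) {ζ : En n} (hζ : ‖ζ‖ = 1) {δ : ℝ}
    (hδ : 0 < δ) (hδ1 : δ ≤ 1) :
    ν (cBox ζ δ) ≤
      (4 ^ n * ∫⁻ z, ‖testF p ((1 - δ) • ζ) z‖ₑ ^ p ∂ν) * ENNReal.ofReal (δ ^ n) := by
  have hna : ‖(1 - δ) • ζ‖ = 1 - δ := norm_real_smul_eq (by linarith) hζ
  have hsub : cBox ζ δ ⊆
      {z | ENNReal.ofReal ((1 / (4 * δ)) ^ n) ≤ ‖testF p ((1 - δ) • ζ) z‖ₑ ^ p} := by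
    intro z hz
    change ENNReal.ofReal ((1 / (4 * δ)) ^ n) ≤ ‖testF p ((1 - δ) • ζ) z‖ₑ ^ p
    rw [enorm_testF_rpow hp (by rw [hna]; linarith) (mem_Bn.1 hz.1).le]
    exact ENNReal.ofReal_le_ofReal (pow_le_pow_left₀ (by positivity)
      (one_div_le_autK hζ hδ hδ1 hz) n)
  have h1 := mul_meas_ge_le_lintegral (μ := ν)
    ((measurable_testF (p := p) (a := (1 - δ) • ζ)).enorm.pow_const p)
    (ENNReal.ofReal ((1 / (4 * δ)) ^ n))
  have h2 := (mul_le_mul_right (measure_mono hsub) _).trans h1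
  calc ν (cBox ζ δ) = ENNReal.ofReal ((4 * δ) ^ n) *
        (ENNReal.ofReal ((1 / (4 * δ)) ^ n) * ν (cBox ζ δ)) := by
        rw [← mul_assoc, ← ENNReal.ofReal_mul (p := (4 * δ) ^ n) (by positivity), ← mul_pow,
          mul_one_div_cancel (by positivity), one_pow, ENNReal.ofReal_one, one_mul]
    _ ≤ ENNReal.ofReal ((4 * δ) ^ n) * ∫⁻ z, ‖testF p ((1 - δ) • ζ) z‖ₑ ^ p ∂ν :=
        mul_le_mul_right h2 _
    _ = _ := by
        rw [mul_pow, ENNReal.ofReal_mul (by positivity), ENNReal.ofReal_pow (by norm_num)]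
        norm_num
        ring

end TestFunctions

section Necessity

variable {n : ℕ} [NeZero n] {f F g : En n → ℂ}

lemma lintegral_nuW_le_of_two_le (hf : DifferentiableOn ℂ f (Bn n))
    (hF : DifferentiableOn ℂ F (Bn n)) (h : ∀ z ∈ Bn n, radD F z = f z * radD g z) {p η R : ℝ}
    (hp : 2 ≤ p) (hη : 0 < η) (hR : R ∈ Ioo (0 : ℝ) 1) :
    ENNReal.ofReal (p / 2 * η ^ (p - 2)) * ∫⁻ z, ‖f z‖ₑ ^ p ∂nuW n g R ≤
      3 ^ (p / 2) * (hMean n p F + ENNReal.ofReal (η ^ p) * hMean n p f) := by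
  have hp0 : 0 < p := by linarith
  have hs : 0 < p / 2 := half_pos hp0
  have hs1 : 1 ≤ p / 2 := by linarith
  set f' : En n → ℂ := fun z ↦ (η : ℂ) * f z with hf'
  have hf'd : DifferentiableOn ℂ f' (Bn n) := hf.const_mul _
  have hηn : ‖(η : ℂ)‖ = η := by rw [Complex.norm_real, Real.norm_of_nonneg hη.le]
  refine ENNReal_le_of_forall_ofReal_rpow hs (K := 3 ^ (p / 2)) (by finiteness) fun ε hε ↦ ?_
  have h1 := le_add_self.trans (le_lintegral_sqSum_rpow hF hf'd hε hs hR)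
  rw [min_eq_left (by nlinarith)] at h1
  refine le_trans ?_ (h1.trans ((lintegral_ofReal_sqSum_rpow_le hF.continuousOn hf'd.continuousOn hε
    hp0 ⟨hR.1.le, hR.2⟩).trans ?_))
  · rw [ENNReal.ofReal_mul hs.le, mul_assoc, lintegral_nuW,
      ← lintegral_const_mul' _ _ ENNReal.ofReal_ne_top]
    refine mul_le_mul_right (lintegral_mono_ae ?_) _
    filter_upwards [ae_mem_Bn_volN] with z hz
    have h2 : η ^ (p - 2) * ‖f z‖ ^ p ≤ sqSum F f' ε z ^ (p / 2 - 1) * ‖f z‖ ^ 2 := by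
      have h3 : (η * ‖f z‖) ^ (p - 2) ≤ sqSum F f' ε z ^ (p / 2 - 1) := by
        have e : p - 2 = 2 * (p / 2 - 1) := by ring
        rw [e, Real.rpow_mul (by positivity), Real.rpow_two]
        refine Real.rpow_le_rpow (by positivity) ?_ (by linarith)
        simp only [hf', sqSum, norm_mul, hηn]
        nlinarith [sq_nonneg ‖F z‖]
      refine le_trans (le_of_eq ?_) (mul_le_mul_of_nonneg_right h3 (sq_nonneg _))
      rw [Real.mul_rpow hη.le (norm_nonneg _), mul_assoc, ← Real.rpow_two,
        ← Real.rpow_add_of_nonneg (norm_nonneg _) (by linarith) zero_le_two, sub_add_cancel]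
    have h4 : ENNReal.ofReal (η ^ (p - 2)) * (‖radD g z‖ₑ ^ 2 * ‖f z‖ₑ ^ p) =
        ENNReal.ofReal (η ^ (p - 2) * ‖f z‖ ^ p * ‖radD g z‖ ^ 2) := by
      rw [ENNReal.ofReal_mul (by positivity), ENNReal.ofReal_mul (by positivity),
        ENNReal.ofReal_pow (norm_nonneg _), ofReal_norm,
        ← ENNReal.ofReal_rpow_of_nonneg (norm_nonneg _) hp0.le, ofReal_norm]
      ring
    calc ENNReal.ofReal (η ^ (p - 2)) * (greenW n R z * ‖radD g z‖ₑ ^ 2 * ‖f z‖ₑ ^ p)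
        = greenW n R z * (ENNReal.ofReal (η ^ (p - 2)) * (‖radD g z‖ₑ ^ 2 * ‖f z‖ₑ ^ p)) := by
          ring
      _ ≤ _ := by
          rw [h4]
          refine mul_le_mul_right (ENNReal.ofReal_le_ofReal ?_) _
          rw [h z hz, norm_mul, mul_pow, mul_add, ← mul_assoc]
          exact (mul_le_mul_of_nonneg_right h2 (sq_nonneg _)).trans
            (le_add_of_nonneg_right (mul_nonneg (Real.rpow_nonneg (sqSum_pos hε z).le _)
              (sq_nonneg _)))
  · have h5 : ∫⁻ ζ, ‖f' (R • ζ)‖ₑ ^ p ∂sigmaS n ≤ ENNReal.ofReal (η ^ p) * hMean n p f := by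
      refine (le_hMean hR).trans (hMean_le_of_norm_le hη.le hp0.le fun z _ ↦ ?_)
      rw [hf', norm_mul, hηn]
    rw [← mul_add]
    exact mul_le_mul_right (add_le_add (add_le_add (le_hMean hR) h5) le_rfl) _

end Necessity

section NecessitySmallExponent

variable {n : ℕ} [NeZero n] {f F g : En n → ℂ}

lemma lintegral_sqSum_rpow_sub_one_le (hF : DifferentiableOn ℂ F (Bn n))
    (h : ∀ z ∈ Bn n, radD F z = f z * radD g z) {p ε R : ℝ} (hp : 0 < p) (hp2 : p ≤ 2)
    (hε : 0 < ε) (hR : R ∈ Ioo (0 : ℝ) 1) :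
    ∫⁻ z, ENNReal.ofReal (sqSum F (fun _ ↦ 0) ε z ^ (p / 2 - 1) * ‖f z‖ ^ 2) ∂nuW n g R ≤
      ENNReal.ofReal (((p / 2) ^ 2)⁻¹) * 3 ^ (p / 2) *
        (hMean n p F + ENNReal.ofReal ε ^ (p / 2)) := by
  have hs : 0 < p / 2 := half_pos hp
  have h0d : DifferentiableOn ℂ (fun _ : En n ↦ (0 : ℂ)) (Bn n) := differentiableOn_const _
  have h1 := le_add_self.trans (le_lintegral_sqSum_rpow hF h0d hε hs hR)
  rw [min_eq_right (by nlinarith)] at h1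
  have h2 := h1.trans (lintegral_ofReal_sqSum_rpow_le hF.continuousOn h0d.continuousOn hε hp
    ⟨hR.1.le, hR.2⟩)
  have h3 : ∫⁻ z, ENNReal.ofReal (sqSum F (fun _ ↦ 0) ε z ^ (p / 2 - 1) * ‖f z‖ ^ 2) ∂nuW n g R ≤
      ∫⁻ z, greenW n R z * ENNReal.ofReal (sqSum F (fun _ ↦ 0) ε z ^ (p / 2 - 1) *
        (‖radD F z‖ ^ 2 + ‖radD (fun _ ↦ (0 : ℂ)) z‖ ^ 2)) ∂volN n := by
    rw [lintegral_nuW]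
    refine lintegral_mono_ae ?_
    filter_upwards [ae_mem_Bn_volN] with z hz
    have hX := Real.rpow_nonneg (sqSum_pos (f₁ := F) (f₂ := fun _ ↦ 0) hε z).le (p / 2 - 1)
    rw [mul_assoc, ← ofReal_norm, ← ENNReal.ofReal_pow (norm_nonneg _),
      ← ENNReal.ofReal_mul (sq_nonneg _)]
    refine mul_le_mul_right (ENNReal.ofReal_le_ofReal ?_) _
    rw [h z hz, norm_mul, mul_pow]
    nlinarith [mul_nonneg hX (sq_nonneg ‖radD (fun _ ↦ (0 : ℂ)) z‖)]
  calc _ ≤ ENNReal.ofReal (((p / 2) ^ 2)⁻¹) * (ENNReal.ofReal ((p / 2) ^ 2) *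
        ∫⁻ z, greenW n R z * ENNReal.ofReal (sqSum F (fun _ ↦ 0) ε z ^ (p / 2 - 1) *
          (‖radD F z‖ ^ 2 + ‖radD (fun _ ↦ (0 : ℂ)) z‖ ^ 2)) ∂volN n) := by
        rw [← mul_assoc, ← ENNReal.ofReal_mul (p := ((p / 2) ^ 2)⁻¹) (by positivity),
          inv_mul_cancel₀ (by positivity), ENNReal.ofReal_one, one_mul]
        exact h3
    _ ≤ _ := by
        rw [mul_assoc]
        refine mul_le_mul_right (h2.trans (mul_le_mul_right (add_le_add ?_ le_rfl) _)) _
        simpa [ENNReal.zero_rpow_of_pos hp] using le_hMean (f := F) (q := p) hR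

lemma lintegral_nuW_le_of_lt_two (hg : DifferentiableOn ℂ g (Bn n))
    (hf : DifferentiableOn ℂ f (Bn n)) (hF : DifferentiableOn ℂ F (Bn n))
    (h : ∀ z ∈ Bn n, radD F z = f z * radD g z) {p R : ℝ} (hp : 0 < p)
    (hp2 : p < 2) (hR : R ∈ Ioo (0 : ℝ) 1) {N : ℝ≥0∞} (hN : N ≠ ⊤)
    (hν : ∀ ζ ∈ Sn n, ∀ δ : ℝ, 0 < δ → nuW n g R (cBox ζ δ) ≤ N * ENNReal.ofReal (δ ^ n))
    (hH : hMean n p F ≠ ⊤) :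
    ∫⁻ z, ‖f z‖ₑ ^ p ∂nuW n g R ≤
      (ENNReal.ofReal (((p / 2) ^ 2)⁻¹) * 3 ^ (p / 2) * hMean n p F) ^ (p / 2) *
        (3 ^ (p / 2) * (ENNReal.ofReal (carlC n p) * N * hMean n p F)) ^ (1 - p / 2) := by
  have hs : 0 < p / 2 := half_pos hp
  have hs1 : 0 ≤ 1 - p / 2 := by linarith
  set H := hMean n p F with hHdef
  set V := nuW n g R univ with hV
  have hVtop : V ≠ ⊤ := (nuW_univ_lt_top hg hR).ne
  have hac : nuW n g R ≪ volN n := withDensity_absolutelyContinuous _ _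
  have hcarl : ∫⁻ z, ‖F z‖ₑ ^ p ∂nuW n g R ≤ ENNReal.ofReal (carlC n p) * N * H := by
    refine le_trans (le_of_eq ?_) (lintegral_Bn_le_hMean hν hF hp)
    rw [Measure.restrict_eq_self_of_ae_mem (ae_mem_Bn_nuW R)]
  have hstep : ∀ ε : ℝ, 0 < ε → ∫⁻ z, ‖f z‖ₑ ^ p ∂nuW n g R ≤
      (ENNReal.ofReal (((p / 2) ^ 2)⁻¹) * 3 ^ (p / 2) * (H + ENNReal.ofReal ε ^ (p / 2))) ^ (p / 2) *
      (3 ^ (p / 2) * (ENNReal.ofReal (carlC n p) * N * H + ENNReal.ofReal ε ^ (p / 2) * V)) ^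
        (1 - p / 2) := by
    intro ε hε
    set X : En n → ℝ := sqSum F (fun _ ↦ 0) ε with hX
    have hXpos : ∀ z, 0 < X z := fun z ↦ sqSum_pos hε z
    have hfm : AEMeasurable f (nuW n g R) := (aemeasurable_volN hf.continuousOn).mono_ac hac
    have hXm : AEMeasurable X (nuW n g R) := by
      have hFm : AEMeasurable F (nuW n g R) := (aemeasurable_volN hF.continuousOn).mono_ac hac
      change AEMeasurable (fun z ↦ ‖F z‖ ^ 2 + ‖(0 : ℂ)‖ ^ 2 + ε) _
      fun_prop
    have hle1 := lintegral_sqSum_rpow_sub_one_le hF h hp hp2.le hε hR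
    have hle2 : ∫⁻ z, ENNReal.ofReal (X z ^ (p / 2)) ∂nuW n g R ≤
        3 ^ (p / 2) * (ENNReal.ofReal (carlC n p) * N * H + ENNReal.ofReal ε ^ (p / 2) * V) := by
      refine (lintegral_mono fun z ↦ ofReal_sqSum_rpow_le hε hp z).trans ?_
      rw [lintegral_const_mul' _ _ (by finiteness)]
      refine mul_le_mul_right ?_ _
      simp only [enorm_zero, ENNReal.zero_rpow_of_pos hp, add_zero]
      rw [lintegral_add_right _ measurable_const, lintegral_const]
      exact add_le_add hcarl le_rfl
    refine le_trans (le_of_eq ?_) ((ENNReal.lintegral_mul_norm_pow_le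
      (f := fun z ↦ ENNReal.ofReal (X z ^ (p / 2 - 1) * ‖f z‖ ^ 2))
      (g := fun z ↦ ENNReal.ofReal (X z ^ (p / 2)))
      (by fun_prop) (by fun_prop) hs.le hs1 (by ring)).trans
      (mul_le_mul' (ENNReal.rpow_le_rpow hle1 hs.le) (ENNReal.rpow_le_rpow hle2 hs1)))
    refine lintegral_congr fun z ↦ ?_
    have hX1 := (Real.rpow_pos_of_pos (hXpos z) (p / 2 - 1)).le
    rw [ENNReal.ofReal_rpow_of_nonneg (by positivity) hs.le,
      ENNReal.ofReal_rpow_of_nonneg (Real.rpow_nonneg (hXpos z).le _) hs1,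
      ← ENNReal.ofReal_mul (by positivity), ← ofReal_norm,
      ENNReal.ofReal_rpow_of_nonneg (norm_nonneg _) hp.le]
    congr 1
    rw [Real.mul_rpow hX1 (sq_nonneg _), ← Real.rpow_mul (hXpos z).le, ← Real.rpow_mul (hXpos z).le,
      ← Real.rpow_two, ← Real.rpow_mul (norm_nonneg _), mul_div_cancel₀ _ two_ne_zero, mul_right_comm,
      ← Real.rpow_add (hXpos z), show (p / 2 - 1) * (p / 2) + p / 2 * (1 - p / 2) = 0 by ring,
      Real.rpow_zero, one_mul]
  have he : Tendsto (fun ε : ℝ ↦ ENNReal.ofReal ε ^ (p / 2)) (𝓝[>] 0) (𝓝 0) := by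
    have hc : Continuous fun ε : ℝ ↦ ENNReal.ofReal ε ^ (p / 2) :=
      (ENNReal.continuous_rpow_const).comp ENNReal.continuous_ofReal
    have h0 := (hc.tendsto 0).mono_left (nhdsWithin_le_nhds (s := Ioi 0))
    rwa [ENNReal.ofReal_zero, ENNReal.zero_rpow_of_pos hs] at h0
  have hB1 : ENNReal.ofReal (((p / 2) ^ 2)⁻¹) * 3 ^ (p / 2) ≠ ⊤ := by finiteness
  have hB2 : ENNReal.ofReal (carlC n p) * N * H ≠ ⊤ := by finiteness
  have ht1 : Tendsto (fun ε : ℝ ↦ (ENNReal.ofReal (((p / 2) ^ 2)⁻¹) * 3 ^ (p / 2) *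
      (H + ENNReal.ofReal ε ^ (p / 2))) ^ (p / 2)) (𝓝[>] 0)
      (𝓝 ((ENNReal.ofReal (((p / 2) ^ 2)⁻¹) * 3 ^ (p / 2) * H) ^ (p / 2))) := by
    refine ((ENNReal.continuous_rpow_const (y := p / 2)).tendsto _).comp
      (ENNReal.Tendsto.const_mul ?_ (Or.inr hB1))
    simpa using he.const_add H
  have ht2 : Tendsto (fun ε : ℝ ↦ (3 ^ (p / 2) * (ENNReal.ofReal (carlC n p) * N * H +
      ENNReal.ofReal ε ^ (p / 2) * V)) ^ (1 - p / 2)) (𝓝[>] 0)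
      (𝓝 ((3 ^ (p / 2) * (ENNReal.ofReal (carlC n p) * N * H)) ^ (1 - p / 2))) := by
    refine ((ENNReal.continuous_rpow_const (y := 1 - p / 2)).tendsto _).comp
      (ENNReal.Tendsto.const_mul ?_ (Or.inr (by finiteness)))
    have h5 := (ENNReal.Tendsto.mul_const he (Or.inr hVtop)).const_add
      (ENNReal.ofReal (carlC n p) * N * H)
    simpa using h5
  refine ge_of_tendsto (ENNReal.Tendsto.mul ht1 (Or.inr ?_) ht2 (Or.inr ?_))
    (eventually_nhdsWithin_of_forall fun ε hε ↦ hstep ε hε)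
  · exact ENNReal.rpow_ne_top_of_nonneg hs1 (by finiteness)
  · exact ENNReal.rpow_ne_top_of_nonneg hs.le (ENNReal.mul_ne_top hB1 hH)

/-- A Carleson-type bound for the measures `nuW` in terms of the images of the test functions. -/
lemma exists_lintegral_testF_le_of_lt_two (hg : DifferentiableOn ℂ g (Bn n)) {p : ℝ} (hp : 0 < p)
    (hp2 : p < 2) {A : ℝ≥0∞} (hA : A ≠ ⊤)
    (hJ : ∀ a : En n, ‖a‖ < 1 → hMean n p (J g (testF p a)) ≤ A) :
    ∃ K : ℝ≥0∞, K ≠ ⊤ ∧ ∀ a : En n, ‖a‖ < 1 →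
      ∫⁻ z, ‖testF p a z‖ₑ ^ p ∂nuW n g 1 ≤ K * hMean n p (J g (testF p a)) := by
  have hs : 0 < p / 2 := half_pos hp
  have hs1 : 0 ≤ 1 - p / 2 := by linarith
  set K₀ : ℝ≥0∞ := (ENNReal.ofReal (((p / 2) ^ 2)⁻¹) * 3 ^ (p / 2)) ^ (p / 2) *
    (3 ^ (p / 2) * (ENNReal.ofReal (carlC n p) * 4 ^ n)) ^ (1 - p / 2) with hK₀
  have hK₀top : K₀ ≠ ⊤ := ENNReal.mul_ne_top (ENNReal.rpow_ne_top_of_nonneg hs.le (by finiteness))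
    (ENNReal.rpow_ne_top_of_nonneg hs1 (by finiteness))
  have hd : ∀ a : En n, ‖a‖ < 1 → DifferentiableOn ℂ (testF p a) (Bn n) := fun a ha ↦
    differentiableOn_testF ha.le
  set S : ℝ → ℝ≥0∞ := fun R ↦ ⨆ a ∈ Bn n, ∫⁻ z, ‖testF p a z‖ₑ ^ p ∂nuW n g R with hS
  have hle_S : ∀ (R : ℝ) (a : En n), ‖a‖ < 1 → ∫⁻ z, ‖testF p a z‖ₑ ^ p ∂nuW n g R ≤ S R :=
    fun R a ha ↦ le_iSup₂ (f := fun a (_ : a ∈ Bn n) ↦ ∫⁻ z, ‖testF p a z‖ₑ ^ p ∂nuW n g R) a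
      (mem_Bn.2 ha)
  have hSbound : ∀ R ∈ Ioo (0 : ℝ) 1, S R ≠ ⊤ := by
    intro R hR
    refine ne_top_of_le_ne_top (b := ENNReal.ofReal ((1 / (1 - R) ^ 2) ^ n) * nuW n g R univ)
      (ENNReal.mul_ne_top ENNReal.ofReal_ne_top (nuW_univ_lt_top hg hR).ne)
      (iSup₂_le fun a ha ↦ ?_)
    have ha1 := mem_Bn.1 ha
    rw [← lintegral_const, lintegral_nuW, lintegral_nuW]
    refine lintegral_mono_ae ?_
    filter_upwards [ae_mem_Bn_volN] with z hz
    rcases le_total ‖z‖ R with hzR | hzR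
    · refine mul_le_mul_right ((enorm_testF_rpow_le hp ha1 hR.2 hzR).trans
        (ENNReal.ofReal_le_ofReal ?_)) _
      have h0 : 0 ≤ 1 - ‖a‖ ^ 2 := by nlinarith [norm_nonneg a]
      have h1 : 0 < 1 - R := by linarith [hR.2]
      gcongr
      nlinarith [sq_nonneg ‖a‖]
    · have hz0 : greenW n R z = 0 := by
        have hzpos : 0 < ‖z‖ := hR.1.trans_le hzR
        refine ENNReal.ofReal_eq_zero.2 ?_
        refine mul_nonpos_of_nonneg_of_nonpos (by positivity)
          (div_nonpos_of_nonpos_of_nonneg (Real.log_nonpos (by have := hR.1; positivity) ?_)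
            (by positivity))
        exact (div_le_one hzpos).2 hzR
      simp [hz0]
  have hmain : ∀ R ∈ Ioo (0 : ℝ) 1, ∀ a : En n, ‖a‖ < 1 →
      ∫⁻ z, ‖testF p a z‖ₑ ^ p ∂nuW n g R ≤
        K₀ * (S R ^ (1 - p / 2) * hMean n p (J g (testF p a))) := by
    intro R hR a ha
    have hcar : ∀ ζ ∈ Sn n, ∀ δ : ℝ, 0 < δ →
        nuW n g R (cBox ζ δ) ≤ 4 ^ n * S R * ENNReal.ofReal (δ ^ n) := by
      intro ζ hζ δ hδ
      have hζ1 : ‖ζ‖ = 1 := mem_sphere_zero_iff_norm.1 hζ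
      rcases le_or_gt δ 1 with hδ1 | hδ1
      · refine (measure_cBox_le hp _ hζ1 hδ hδ1).trans
          (mul_le_mul_left (mul_le_mul_right (hle_S R _ ?_) _) _)
        rw [norm_real_smul_eq (by linarith) hζ1]
        linarith
      · have h1 : nuW n g R (cBox ζ δ) ≤ S R := by
          refine (measure_mono (subset_univ _)).trans (le_trans (le_of_eq ?_) (hle_S R 0 (by simp)))
          rw [← lintegral_one]
          refine lintegral_congr_ae ?_
          filter_upwards [ae_mem_Bn_nuW R] with z hz
          rw [enorm_testF_rpow hp (by simp) (mem_Bn.1 hz).le]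
          simp [autK, herm]
        have h2 : 1 ≤ ENNReal.ofReal (δ ^ n) :=
          ENNReal.one_le_ofReal.2 (one_le_pow₀ hδ1.le)
        have h3 : S R ≤ 4 ^ n * S R :=
          le_mul_of_one_le_left zero_le (one_le_pow₀ (by norm_num))
        exact (h1.trans h3).trans (le_mul_of_one_le_right zero_le h2)
    have hH : hMean n p (J g (testF p a)) ≠ ⊤ := ne_top_of_le_ne_top hA (hJ a ha)
    refine (lintegral_nuW_le_of_lt_two hg (hd a ha) (differentiableOn_J hg (hd a ha))
      (fun z hz ↦ radD_J hg (hd a ha) hz) hp hp2 hR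
      (ENNReal.mul_ne_top (by finiteness) (hSbound R hR)) hcar hH).trans_eq ?_
    set H := hMean n p (J g (testF p a))
    have e : 3 ^ (p / 2) * (ENNReal.ofReal (carlC n p) * (4 ^ n * S R) * H) =
        3 ^ (p / 2) * (ENNReal.ofReal (carlC n p) * 4 ^ n) * S R * H := by ring
    have eH : H = H ^ (p / 2) * H ^ (1 - p / 2) := by
      rw [← ENNReal.rpow_add_of_nonneg _ _ hs.le hs1, add_sub_cancel, ENNReal.rpow_one]
    rw [e, ENNReal.mul_rpow_of_nonneg _ _ hs.le, ENNReal.mul_rpow_of_nonneg _ _ hs1,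
      ENNReal.mul_rpow_of_nonneg _ _ hs1, hK₀]
    nth_rewrite 3 [eH]
    ring
  set T : ℝ≥0∞ := (K₀ * A) ^ (1 / (p / 2)) with hT
  have hTtop : T ≠ ⊤ := ENNReal.rpow_ne_top_of_nonneg (by positivity) (by finiteness)
  have hST : ∀ R ∈ Ioo (0 : ℝ) 1, S R ≤ T := by
    intro R hR
    have h1 := ENNReal_le_rpow_mul_of_le (X := S R) (Y := 1) (D := K₀ * A) hs (hSbound R hR)
      (iSup₂_le fun a ha ↦ ?_)
    · rwa [mul_one] at h1
    · refine (hmain R hR a (mem_Bn.1 ha)).trans ((mul_le_mul_right (mul_le_mul_right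
        (hJ a (mem_Bn.1 ha)) _) _).trans_eq ?_)
      rw [ENNReal.one_rpow]
      ring
  refine ⟨K₀ * T ^ (1 - p / 2), ENNReal.mul_ne_top hK₀top
    (ENNReal.rpow_ne_top_of_nonneg hs1 hTtop), fun a ha ↦ ?_⟩
  refine lintegral_nuW_one_le (measurable_testF.enorm.pow_const p)
    (fun z ↦ ENNReal.rpow_ne_top_of_nonneg hp.le enorm_ne_top) fun R hR ↦ ?_
  rw [mul_assoc]
  exact (hmain R hR a ha).trans (mul_le_mul_right (mul_le_mul_left
    (ENNReal.rpow_le_rpow (hST R hR) hs1) _) _)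

end NecessitySmallExponent

section CompactImpliesCarleson

variable {n : ℕ} {g : En n → ℂ}

/-- Compactness of `J_g` on `H^p` in the sequential form. -/
def CompactJ (n : ℕ) (p : ℝ) (g : En n → ℂ) : Prop :=
  ∀ f : ℕ → En n → ℂ, (∀ k, MemHp n p (f k)) → (∃ M : ℝ≥0∞, M < ⊤ ∧ ∀ k, hNorm n p (f k) ≤ M) →
    (∀ K : Set (En n), K ⊆ Bn n → IsCompact K → TendstoUniformlyOn (fun k ↦ f k) 0 atTop K) →
      Tendsto (fun k ↦ hNorm n p (J g (f k))) atTop (𝓝 0)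

lemma CompactJ.tendsto_hMean {p : ℝ} (h : CompactJ n p g) (hp : 0 < p) {f : ℕ → En n → ℂ}
    (hf : ∀ k, DifferentiableOn ℂ (f k) (Bn n)) {B : ℝ≥0∞} (hB : B ≠ ⊤)
    (hfB : ∀ k, hMean n p (f k) ≤ B)
    (hlim : ∀ ρ < 1, ∃ b : ℕ → ℝ≥0∞, Tendsto b atTop (𝓝 0) ∧
      ∀ k z, ‖z‖ ≤ ρ → ‖f k z‖ₑ ^ p ≤ b k) :
    Tendsto (fun k ↦ hMean n p (J g (f k))) atTop (𝓝 0) := by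
  have hM : B ^ (1 / p) < ⊤ := (ENNReal.rpow_ne_top_of_nonneg (by positivity) hB).lt_top
  have hle : ∀ k, hNorm n p (f k) ≤ B ^ (1 / p) := fun k ↦
    ENNReal.rpow_le_rpow (hfB k) (by positivity)
  have h1 := h f (fun k ↦ ⟨hf k, (hle k).trans_lt hM⟩) ⟨_, hM, hle⟩ fun K hK hKc ↦ ?_
  · have h2 := ((ENNReal.continuous_rpow_const (y := p)).tendsto 0).comp h1
    rw [ENNReal.zero_rpow_of_pos hp] at h2
    refine h2.congr fun k ↦ ?_
    rw [Function.comp_apply, hNorm_eq, ← ENNReal.rpow_mul, one_div_mul_cancel hp.ne',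
      ENNReal.rpow_one]
  · obtain ⟨ρ, hρ, hKρ⟩ := exists_lt_subset_ball hKc.isClosed hK
    obtain ⟨b, hb, hfb⟩ := hlim ρ hρ
    refine Metric.tendstoUniformlyOn_iff.2 fun ε hε ↦ ?_
    have hε' : 0 < ENNReal.ofReal ε ^ p :=
      ENNReal.rpow_pos (ENNReal.ofReal_pos.2 hε) ENNReal.ofReal_ne_top
    filter_upwards [hb.eventually_lt_const hε'] with k hk z hz
    have h2 := (hfb k z (mem_ball_zero_iff.1 (hKρ hz)).le).trans_lt hk
    rw [ENNReal.rpow_lt_rpow_iff hp, ← ofReal_norm] at h2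
    simpa using (ENNReal.ofReal_lt_ofReal_iff hε).1 h2

variable [NeZero n]

lemma exists_lintegral_testF_le (hg : DifferentiableOn ℂ g (Bn n)) {p : ℝ} (hp : 0 < p)
    {A : ℝ≥0∞} (hA : A ≠ ⊤) (hJ : ∀ a : En n, ‖a‖ < 1 → hMean n p (J g (testF p a)) ≤ A)
    {τ : ℝ≥0∞} (hτ : τ ≠ 0) :
    ∃ K : ℝ≥0∞, K ≠ ⊤ ∧ ∀ a : En n, ‖a‖ < 1 →
      ∫⁻ z, ‖testF p a z‖ₑ ^ p ∂nuW n g 1 ≤ K * hMean n p (J g (testF p a)) + τ := by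
  rcases lt_or_ge p 2 with hp2 | hp2
  · obtain ⟨K, hK, hle⟩ := exists_lintegral_testF_le_of_lt_two hg hp hp2 hA hJ
    exact ⟨K, hK, fun a ha ↦ (hle a ha).trans le_self_add⟩
  have hs : 0 < p / 2 := half_pos hp
  set B : ℝ≥0∞ := ENNReal.ofReal (p / 2)⁻¹ * 3 ^ (p / 2) * (3 ^ (p / 2) * ENNReal.ofReal (6 * 2 ^ n))
    with hB
  have hBtop : B ≠ ⊤ := by finiteness
  have hlim : Tendsto (fun η : ℝ ↦ ENNReal.ofReal (η ^ 2) * B) (𝓝[>] 0) (𝓝 0) := by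
    have hc : Continuous fun η : ℝ ↦ ENNReal.ofReal (η ^ 2) :=
      ENNReal.continuous_ofReal.comp (by fun_prop)
    have h0 := (hc.tendsto 0).mono_left (nhdsWithin_le_nhds (s := Ioi 0))
    have h1 := ENNReal.Tendsto.mul_const (b := B) h0 (Or.inr hBtop)
    simpa using h1
  obtain ⟨η, hηB, hη⟩ := ((hlim.eventually_lt_const (pos_iff_ne_zero.2 hτ)).and
    self_mem_nhdsWithin).exists
  have hη : 0 < η := hη
  have hc : 0 < p / 2 * η ^ (p - 2) := by positivity
  refine ⟨ENNReal.ofReal (p / 2 * η ^ (p - 2))⁻¹ * 3 ^ (p / 2), by finiteness, fun a ha ↦ ?_⟩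
  refine lintegral_nuW_one_le (measurable_testF.enorm.pow_const p)
    (fun z ↦ ENNReal.rpow_ne_top_of_nonneg hp.le enorm_ne_top) fun R hR ↦ ?_
  have hd : DifferentiableOn ℂ (testF p a) (Bn n) := differentiableOn_testF ha.le
  have h1 := lintegral_nuW_le_of_two_le hd (differentiableOn_J hg hd)
    (fun z hz ↦ radD_J hg hd hz) hp2 hη hR
  calc ∫⁻ z, ‖testF p a z‖ₑ ^ p ∂nuW n g R
      = ENNReal.ofReal (p / 2 * η ^ (p - 2))⁻¹ * (ENNReal.ofReal (p / 2 * η ^ (p - 2)) *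
          ∫⁻ z, ‖testF p a z‖ₑ ^ p ∂nuW n g R) := by
        rw [← mul_assoc, ← ENNReal.ofReal_mul (p := (p / 2 * η ^ (p - 2))⁻¹) (by positivity),
          inv_mul_cancel₀ hc.ne', ENNReal.ofReal_one, one_mul]
    _ ≤ ENNReal.ofReal (p / 2 * η ^ (p - 2))⁻¹ * (3 ^ (p / 2) * (hMean n p (J g (testF p a)) +
          ENNReal.ofReal (η ^ p) * (3 ^ (p / 2) * ENNReal.ofReal (6 * 2 ^ n)))) :=
        mul_le_mul_right (h1.trans (mul_le_mul_right (add_le_add le_rfl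
          (mul_le_mul_right (hMean_testF_le hp ha) _)) _)) _
    _ = ENNReal.ofReal (p / 2 * η ^ (p - 2))⁻¹ * 3 ^ (p / 2) * hMean n p (J g (testF p a)) +
          ENNReal.ofReal (η ^ 2) * B := by
        have e : ENNReal.ofReal (p / 2 * η ^ (p - 2))⁻¹ * ENNReal.ofReal (η ^ p) =
            ENNReal.ofReal (η ^ 2) * ENNReal.ofReal (p / 2)⁻¹ := by
          rw [← ENNReal.ofReal_mul (by positivity), ← ENNReal.ofReal_mul (by positivity)]
          congr 1
          rw [← Real.rpow_two, show η ^ p = η ^ (p - 2) * η ^ (2 : ℝ) by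
            rw [← Real.rpow_add hη, sub_add_cancel]]
          have := (Real.rpow_pos_of_pos hη (p - 2)).ne'
          field_simp
        rw [hB, mul_add, mul_add, ← mul_assoc, mul_comm (3 ^ (p / 2)) (ENNReal.ofReal (η ^ p) * _),
          ← mul_assoc, ← mul_assoc (ENNReal.ofReal _) (ENNReal.ofReal (η ^ p)), e]
        ring
    _ ≤ _ := add_le_add le_rfl hηB.le

lemma CompactJ.exists_hMean_J_testF_le {p : ℝ} (h : CompactJ n p g)
    (hp : 0 < p) : ∃ A : ℝ≥0∞, A ≠ ⊤ ∧ ∀ a : En n, ‖a‖ < 1 → hMean n p (J g (testF p a)) ≤ A := by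
  by_contra! hcon
  choose a ha hlt using fun k : ℕ ↦ hcon (((k + 1 : ℕ) : ℝ≥0∞) ^ p)
    (ENNReal.rpow_ne_top_of_nonneg hp.le (ENNReal.natCast_ne_top _))
  set c : ℕ → ℂ := fun k ↦ ((k + 1 : ℕ) : ℂ)⁻¹ with hc
  have hce : ∀ k, ‖c k‖ₑ ^ p = ((((k + 1 : ℕ) : ℝ≥0∞)) ^ p)⁻¹ := by
    intro k
    rw [hc, enorm_inv (by exact_mod_cast k.succ_ne_zero), ENNReal.inv_rpow, ← ofReal_norm,
      Complex.norm_natCast, ENNReal.ofReal_natCast]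
  have hmul : ∀ k (u : En n → ℂ) z, ‖c k * u z‖ₑ ^ p = ‖c k‖ₑ ^ p * ‖u z‖ₑ ^ p := by
    intro k u z
    rw [enorm_mul, ENNReal.mul_rpow_of_nonneg _ _ hp.le]
  have hce1 : ∀ k, ‖c k‖ₑ ^ p ≤ 1 := by
    intro k
    rw [hce, ENNReal.inv_le_one]
    exact ENNReal.one_le_rpow (by exact_mod_cast k.succ_pos) hp
  have hmean : ∀ k (u : En n → ℂ), hMean n p (fun z ↦ c k * u z) = ‖c k‖ₑ ^ p * hMean n p u := by
    intro k u
    have hctop : ‖c k‖ₑ ^ p ≠ ⊤ := ne_top_of_le_ne_top ENNReal.one_ne_top (hce1 k)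
    simp only [hMean, hmul, lintegral_const_mul' _ _ hctop, ENNReal.mul_iSup]
  have hclim : Tendsto (fun k ↦ ‖c k‖ₑ ^ p) atTop (𝓝 0) := by
    have h1 : Tendsto (fun k : ℕ ↦ ((((k + 1 : ℕ) : ℝ≥0∞))⁻¹) ^ p) atTop (𝓝 0) := by
      have h2 := ((ENNReal.continuous_rpow_const (y := p)).tendsto 0).comp
        (ENNReal.tendsto_inv_nat_nhds_zero.comp (tendsto_add_atTop_nat 1))
      rwa [ENNReal.zero_rpow_of_pos hp] at h2
    refine h1.congr fun k ↦ ?_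
    rw [hce, ENNReal.inv_rpow]
  have hlim := h.tendsto_hMean hp (f := fun k z ↦ c k * testF p (a k) z)
    (B := 3 ^ (p / 2) * ENNReal.ofReal (6 * 2 ^ n))
    (fun k ↦ (differentiableOn_testF (ha k).le).const_mul _) (by finiteness) (fun k ↦ ?_)
    fun ρ hρ ↦ ⟨fun k ↦ ‖c k‖ₑ ^ p * ENNReal.ofReal ((1 / (1 - ρ) ^ 2) ^ n), ?_, fun k z hz ↦ ?_⟩
  · obtain ⟨k, hk⟩ := (hlim.eventually_lt_const zero_lt_one).exists
    have e : J g (fun z ↦ c k * testF p (a k) z) = fun z ↦ c k * J g (testF p (a k)) z := by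
      funext z
      simp only [J, ← integral_const_mul]
      congr 1 with t
      ring
    rw [e, hmean, hce] at hk
    refine hk.not_ge ?_
    have hpow0 : (((k + 1 : ℕ) : ℝ≥0∞)) ^ p ≠ 0 :=
      (ENNReal.rpow_pos (by exact_mod_cast k.succ_pos) (ENNReal.natCast_ne_top _)).ne'
    have hpowtop : (((k + 1 : ℕ) : ℝ≥0∞)) ^ p ≠ ⊤ :=
      ENNReal.rpow_ne_top_of_nonneg hp.le (ENNReal.natCast_ne_top _)
    rw [← ENNReal.inv_mul_cancel hpow0 hpowtop]
    exact mul_le_mul_right (hlt k).le _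
  · rw [hmean]
    exact mul_le_of_le_one_of_le (hce1 k) (hMean_testF_le hp (ha k))
  · have h1 := ENNReal.Tendsto.mul_const (b := ENNReal.ofReal ((1 / (1 - ρ) ^ 2) ^ n)) hclim
      (Or.inr ENNReal.ofReal_ne_top)
    simpa using h1
  · rw [hmul]
    refine mul_le_mul_right ((enorm_testF_rpow_le hp (ha k) hρ hz).trans
      (ENNReal.ofReal_le_ofReal ?_)) _
    have h0 : 0 ≤ 1 - ‖a k‖ ^ 2 := by nlinarith [norm_nonneg (a k), ha k]
    have h1 : 0 < 1 - ρ := by linarith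
    gcongr
    nlinarith [sq_nonneg ‖a k‖]

lemma CompactJ.exists_forall_hMean_J_testF_le {p : ℝ} (h : CompactJ n p g) (hp : 0 < p)
    {τ : ℝ≥0∞} (hτ : τ ≠ 0) :
    ∃ r < 1, ∀ a : En n, r ≤ ‖a‖ → ‖a‖ < 1 → hMean n p (J g (testF p a)) ≤ τ := by
  by_contra! hcon
  have hr : ∀ k : ℕ, 1 - 1 / ((k : ℝ) + 1) < 1 := fun k ↦ by
    have : 0 < 1 / ((k : ℝ) + 1) := by positivity
    linarith
  choose a hra ha hlt using fun k : ℕ ↦ hcon _ (hr k)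
  have hlim := h.tendsto_hMean hp (f := fun k ↦ testF p (a k))
    (B := 3 ^ (p / 2) * ENNReal.ofReal (6 * 2 ^ n))
    (fun k ↦ differentiableOn_testF (ha k).le) (by finiteness) (fun k ↦ hMean_testF_le hp (ha k))
    fun ρ hρ ↦ ⟨fun k ↦ ENNReal.ofReal (((1 - ‖a k‖ ^ 2) / (1 - ρ) ^ 2) ^ n), ?_,
      fun k z hz ↦ enorm_testF_rpow_le hp (ha k) hρ hz⟩
  · obtain ⟨k, hk⟩ := (hlim.eventually_lt_const (pos_iff_ne_zero.2 hτ)).exists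
    exact (hlt k).not_gt hk
  · have h1 : Tendsto (fun k ↦ ‖a k‖) atTop (𝓝 1) := by
      have h2 := (tendsto_one_div_add_atTop_nhds_zero_nat (𝕜 := ℝ)).const_sub 1
      rw [sub_zero] at h2
      exact tendsto_of_tendsto_of_tendsto_of_le_of_le h2 tendsto_const_nhds hra fun k ↦ (ha k).le
    have hc : Continuous fun x : ℝ ↦ ENNReal.ofReal (((1 - x ^ 2) / (1 - ρ) ^ 2) ^ n) :=
      ENNReal.continuous_ofReal.comp (by fun_prop)
    have h3 := (hc.tendsto 1).comp h1
    simpa [Function.comp_def, NeZero.ne n] using h3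

/-- If `J_g` is compact on `H^p`, then `|Rg|²(1-|z|²) dv` is a vanishing Carleson measure. -/
lemma CompactJ.vanishingCarleson {p : ℝ} (h : CompactJ n p g) (hg : DifferentiableOn ℂ g (Bn n))
    (hp : 0 < p) : VanishingCarleson (muJ n g) := by
  refine ENNReal.tendsto_nhds_zero.2 fun τ hτ ↦ ?_
  obtain ⟨A, hA, hJA⟩ := h.exists_hMean_J_testF_le hp
  set κ : ℝ≥0∞ := n * 4 ^ n with hκ
  have hκtop : κ ≠ ⊤ := by finiteness
  set τ' : ℝ≥0∞ := τ / κ / 2 with hτ'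
  have hτ'0 : τ' ≠ 0 := (ENNReal.half_pos (ENNReal.div_pos hτ.ne' hκtop).ne').ne'
  obtain ⟨K, hK, hle⟩ := exists_lintegral_testF_le hg hp hA hJA hτ'0
  obtain ⟨r, hr, hsmall⟩ := h.exists_forall_hMean_J_testF_le hp (τ := τ' / K)
    (ENNReal.div_pos hτ'0 hK).ne'
  have hδ₀ : 0 < min 1 (1 - r) := lt_min one_pos (by linarith)
  filter_upwards [Ioo_mem_nhdsGT hδ₀] with δ hδ
  have hδ1 : δ < 1 := hδ.2.trans_le (min_le_left _ _)
  have hδr : δ < 1 - r := hδ.2.trans_le (min_le_right _ _)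
  refine iSup₂_le fun ζ hζ ↦ ENNReal.div_le_of_le_mul ?_
  have hζ1 : ‖ζ‖ = 1 := mem_sphere_zero_iff_norm.1 hζ
  have hna : ‖(1 - δ) • ζ‖ = 1 - δ := norm_real_smul_eq (by linarith) hζ1
  have ha1 : ‖(1 - δ) • ζ‖ < 1 := by
    rw [hna]
    linarith [hδ.1]
  have hI : ∫⁻ z, ‖testF p ((1 - δ) • ζ) z‖ₑ ^ p ∂nuW n g 1 ≤ τ / κ := by
    refine (hle _ ha1).trans ((add_le_add (mul_le_mul_right (hsmall _ ?_ ha1) K) le_rfl).trans ?_)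
    · rw [hna]
      linarith
    · refine (add_le_add ENNReal.mul_div_le le_rfl).trans_eq ?_
      rw [hτ', ENNReal.add_halves]
  calc muJ n g (cBox ζ δ) ≤ n * nuW n g 1 (cBox ζ δ) := by
        simpa using muJ_le_nuW g (cBox ζ δ)
    _ ≤ n * ((4 ^ n * (τ / κ)) * ENNReal.ofReal (δ ^ n)) :=
        mul_le_mul_right ((measure_cBox_le hp _ hζ1 hδ.1 hδ1.le).trans
          (mul_le_mul_left (mul_le_mul_right hI _) _)) _
    _ = κ * (τ / κ) * ENNReal.ofReal (δ ^ n) := by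
        rw [hκ]
        ring
    _ ≤ τ * ENNReal.ofReal (δ ^ n) := mul_le_mul_left ENNReal.mul_div_le _

end CompactImpliesCarleson

/-- For `0 < p < ∞` and `g` holomorphic on `B_n`, the operator `J_g` is
compact on `H^p` iff `μ_g` is a vanishing Carleson measure, i.e.
`lim_{δ→0⁺} sup_{ζ∈S_n} δ^{-n} μ_g(B_δ(ζ)) = 0`. -/
theorem stmt12 (n : ℕ) (hn : 1 ≤ n) (p : ℝ) (hp : 0 < p)
    (g : En n → ℂ) (hg : DifferentiableOn ℂ g (Bn n)) :
    (∀ f : ℕ → En n → ℂ, (∀ k, MemHp n p (f k)) →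
        (∃ M : ℝ≥0∞, M < ⊤ ∧ ∀ k, hNorm n p (f k) ≤ M) →
        (∀ K : Set (En n), K ⊆ Bn n → IsCompact K →
          TendstoUniformlyOn (fun k => f k) 0 atTop K) →
        Tendsto (fun k => hNorm n p (J g (f k))) atTop (𝓝 0)) ↔
      Tendsto
        (fun δ : ℝ => ⨆ ζ ∈ Sn n, muJ n g (cBox ζ δ) / ENNReal.ofReal (δ ^ n))
        (𝓝[>] (0 : ℝ)) (𝓝 0) := by
  have : NeZero n := ⟨by omega⟩
  exact ⟨fun h ↦ CompactJ.vanishingCarleson h hg hp, fun h f hf ⟨M, hM, hfM⟩ hlim ↦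
    VanishingCarleson.tendsto_hNorm_J hg h hp (fun k ↦ (hf k).1) hM hfM hlim⟩

end
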